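/- Real analyticity of joint quasinormal modes on subextremal Kerr (Theorem 1, Λ = 0, scalar case, spherical chart): Let I := (r_e − c₁, ∞) with c₁ > 0 and r_e − c₁ > r_C, let S² ⊂ ℝ³ be the unit sphere, and Φ(φ,θ) := (sin θ cos φ, sin θ sin φ, cos θ). Let V : I × ℝ³ → ℂ be real analytic and axisymmetric (invariant under rotations of ℝ³ about the third axis in the second argument). Let u : ℝ × I × S² → ℂ be smooth and set ũ(t,r,φ,θ) := u(t, r, Φ(φ,θ)) on Ω := ℝ × I × ℝ × (0,π). Assume: (i) there is a real analytic F : ℝ × I × ℝ³ → ℂ with □_{g*}ũ + V(r,Φ(φ,θ))ũ = F(t,r,Φ(φ,θ)) on Ω; (ii) ∂_t ũ = −iσ ũ for some σ ∈ ℂ; (iii) ∂_φ ũ = −ik ũ for some k ∈ ℤ. Then ũ is real analytic on Ω. -/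

import Mathlib

open Set Real

noncomputable section

namespace KerrModes

/-- Partial derivative of `w : ℝ⁴ → ℂ` in the `i`-th of the coordinates `(t*, r, φ*, θ)`. -/
def pd (i : Fin 4) (w : (Fin 4 → ℝ) → ℂ) (x : Fin 4 → ℝ) : ℂ :=
  deriv (fun s => w (Function.update x i s)) (x i)

/-- The Kerr horizon polynomial `μ(r) = r² − 2mr + a²`. -/
def mu (a m r : ℝ) : ℝ := r ^ 2 - 2 * m * r + a ^ 2

/-- `ρ²(r,θ) = r² + a²cos²θ`. -/
def rhosq (a r θ : ℝ) : ℝ := r ^ 2 + a ^ 2 * Real.cos θ ^ 2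

/-- The extended Kerr metric in the coordinates `(t*, r, φ*, θ)`. -/
def gstar (a m r θ : ℝ) : Matrix (Fin 4) (Fin 4) ℝ :=
  !![(a ^ 2 * Real.sin θ ^ 2 - mu a m r) / rhosq a r θ, -1,
       a * Real.sin θ ^ 2 * (mu a m r - (r ^ 2 + a ^ 2)) / rhosq a r θ, 0;
     -1, 0, a * Real.sin θ ^ 2, 0;
     a * Real.sin θ ^ 2 * (mu a m r - (r ^ 2 + a ^ 2)) / rhosq a r θ, a * Real.sin θ ^ 2,
       Real.sin θ ^ 2 * ((r ^ 2 + a ^ 2) ^ 2 - mu a m r * a ^ 2 * Real.sin θ ^ 2) /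
         rhosq a r θ, 0;
     0, 0, 0, rhosq a r θ]

/-- The wave operator `□_{g*}` of the extended Kerr metric, acting on C² functions of the
coordinates `x = (t*, r, φ*, θ)`:
`□_{g*}w = −(1/(ρ²sin θ)) Σ_{α,β} ∂_α(ρ²sin θ·((g*)⁻¹)_{αβ} ∂_β w)`. -/
def box (a m : ℝ) (w : (Fin 4 → ℝ) → ℂ) (x : Fin 4 → ℝ) : ℂ :=
  -(((1 / (rhosq a (x 1) (x 3) * Real.sin (x 3)) : ℝ)) : ℂ) *
    ∑ α : Fin 4, ∑ β : Fin 4,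
      pd α (fun y =>
        (((rhosq a (y 1) (y 3) * Real.sin (y 3) *
            (gstar a m (y 1) (y 3))⁻¹ α β : ℝ)) : ℂ) * pd β w y) x

/-- The spherical chart `Φ(φ,θ) = (sin θ cos φ, sin θ sin φ, cos θ) ∈ ℝ³`. -/
def Phi (φ θ : ℝ) : Fin 3 → ℝ :=
  ![Real.sin θ * Real.cos φ, Real.sin θ * Real.sin φ, Real.cos θ]

/-- Rotation of `ℝ³` about the third coordinate axis by the angle `α`. -/
def rotZ (α : ℝ) (ω : Fin 3 → ℝ) : Fin 3 → ℝ :=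
  ![Real.cos α * ω 0 - Real.sin α * ω 1, Real.sin α * ω 0 + Real.cos α * ω 1, ω 2]

end KerrModes

open KerrModes

section
namespace KerrAux

/-- Taylor expansion of a smooth jet with Cauchy-type bounds. -/
lemma taylor_jet {g : ℕ → ℝ → ℂ} {x0 ρ A C : ℝ} (hA : 0 ≤ A) (hC : 0 ≤ C)
    (hd : ∀ i x, |x - x0| < ρ → HasDerivAt (g i) (g (i+1) x) x)
    (hb : ∀ i x, |x - x0| < ρ → ‖g i x‖ ≤ A * C ^ i * (i.factorial : ℝ))
    {s : ℝ} (hs : |s| < ρ) (hCs : C * |s| < 1) :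
    HasSum (fun i : ℕ => g i x0 * ((s ^ i / (i.factorial : ℝ) : ℝ) : ℂ)) (g 0 (x0 + s)) := by
  have hρ : 0 < ρ := lt_of_le_of_lt (abs_nonneg s) hs
  have hsum : Summable (fun i : ℕ => g i x0 * ((s ^ i / (i.factorial : ℝ) : ℝ) : ℂ)) := by
    refine Summable.of_norm_bounded (g := fun i : ℕ => A * (C * |s|) ^ i)
      ((summable_geometric_of_lt_one (by positivity) hCs).mul_left A) (fun i => ?_)
    have h1 := hb i x0 (by simpa using hρ)
    rw [norm_mul, Complex.norm_real, Real.norm_eq_abs, abs_div, abs_pow,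
      abs_of_pos (by positivity : (0:ℝ) < i.factorial)]
    have hf : (0:ℝ) < i.factorial := by positivity
    calc ‖g i x0‖ * (|s| ^ i / i.factorial) ≤ (A * C ^ i * i.factorial) * (|s| ^ i / i.factorial) := by
          gcongr
      _ = A * (C * |s|) ^ i := by rw [mul_pow]; field_simp
  rw [hsum.hasSum_iff_tendsto_nat]
  rw [← tendsto_sub_nhds_zero_iff]
  have key : ∀ N : ℕ, ‖(∑ i ∈ Finset.range (N+1), g i x0 * ((s ^ i / (i.factorial : ℝ) : ℝ) : ℂ))
      - g 0 (x0 + s)‖ ≤ A * C * |s| * ((N + 1 : ℕ) * (C * |s|) ^ N) := by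
    intro N
    let ψ : ℝ → ℂ := fun τ => ∑ i ∈ Finset.range (N+1),
      g i (x0 + τ) * (((s - τ) ^ i / (i.factorial : ℝ) : ℝ) : ℂ)
    have hψd : ∀ τ ∈ uIcc 0 s, HasDerivAt ψ
        (g (N+1) (x0 + τ) * (((s - τ) ^ N / (N.factorial : ℝ) : ℝ) : ℂ)) τ := by
      intro τ hτ
      have hτs : |τ| ≤ |s| := by
        have := abs_sub_left_of_mem_uIcc hτ
        simpa using this
      have hdi : ∀ i, HasDerivAt (fun τ => g i (x0 + τ)) (g (i+1) (x0 + τ)) τ := by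
        intro i
        have := hd i (x0 + τ) (by simpa using lt_of_le_of_lt hτs hs)
        exact this.comp_const_add x0 τ
      have aux : ∀ M : ℕ, HasDerivAt (fun τ => ∑ i ∈ Finset.range (M+1),
          g i (x0 + τ) * (((s - τ) ^ i / (i.factorial : ℝ) : ℝ) : ℂ))
          (g (M+1) (x0 + τ) * (((s - τ) ^ M / (M.factorial : ℝ) : ℝ) : ℂ)) τ := by
        intro M
        induction M with
        | zero => simpa using hdi 0
        | succ M ih =>
          have h2 : HasDerivAt (fun τ : ℝ => (s - τ) ^ (M+1) / ((M+1).factorial : ℝ))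
              (-((s - τ) ^ M / (M.factorial : ℝ))) τ := by
            have := (((hasDerivAt_id τ).const_sub s).pow (M+1)).div_const ((M+1).factorial : ℝ)
            refine this.congr_deriv ?_
            rw [Nat.factorial_succ]; push_cast; simp
            field_simp
          have h3 := (hdi (M+1)).mul h2.ofReal_comp
          have h4 := ih.add h3
          simp only [Finset.sum_range_succ _ (M+1)]
          refine h4.congr_deriv ?_
          push_cast; ring
      exact aux N
    have hbd : ∀ τ ∈ uIcc 0 s, ‖g (N+1) (x0 + τ) * (((s - τ) ^ N / (N.factorial : ℝ) : ℝ) : ℂ)‖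
        ≤ A * C * ((N + 1 : ℕ) * (C * |s|) ^ N) := by
      intro τ hτ
      have hτs : |τ| ≤ |s| := by
        have := abs_sub_left_of_mem_uIcc hτ
        simpa using this
      have hτs' : |s - τ| ≤ |s| := by
        have := abs_sub_right_of_mem_uIcc hτ
        simpa using this
      have h1 := hb (N+1) (x0 + τ) (by simpa using lt_of_le_of_lt hτs hs)
      rw [norm_mul, Complex.norm_real, Real.norm_eq_abs, abs_div, abs_pow,
        abs_of_pos (by positivity : (0:ℝ) < N.factorial)]
      have hf : (0:ℝ) < N.factorial := by positivity
      calc _ ≤ (A * C ^ (N+1) * (N+1).factorial) * (|s| ^ N / N.factorial) := by gcongr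
        _ = _ := by
          rw [Nat.factorial_succ, mul_pow]; push_cast; field_simp; ring
    have hmv := Convex.norm_image_sub_le_of_norm_hasDerivWithin_le
      (f := ψ) (s := uIcc 0 s) (x := 0) (y := s)
      (fun τ hτ => (hψd τ hτ).hasDerivWithinAt) hbd (convex_uIcc 0 s) left_mem_uIcc right_mem_uIcc
    have e1 : ψ s = g 0 (x0 + s) := by
      simp only [ψ, sub_self]
      rw [Finset.sum_eq_single 0]
      · simp
      · intro i _ hi; simp [hi]
      · simp
    have e0 : ψ 0 = ∑ i ∈ Finset.range (N+1), g i x0 * ((s ^ i / (i.factorial : ℝ) : ℝ) : ℂ) := by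
      simp [ψ]
    rw [e1, e0, norm_sub_rev] at hmv
    refine hmv.trans (le_of_eq ?_)
    simp; ring
  have hlim : Filter.Tendsto (fun N : ℕ => A * C * |s| * ((N + 1 : ℕ) * (C * |s|) ^ N))
      Filter.atTop (nhds 0) := by
    have h1 := tendsto_self_mul_const_pow_of_lt_one (r := C * |s|) (by positivity) hCs
    have h2 := tendsto_pow_atTop_nhds_zero_of_lt_one (r := C * |s|) (by positivity) hCs
    have := (h1.add h2).const_mul (A * C * |s|)
    simp only [add_zero, mul_zero] at this
    refine this.congr (fun N => ?_)
    push_cast; ring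
  have := squeeze_zero_norm key hlim
  exact (Filter.tendsto_add_atTop_iff_nat 1).1 this

/-- Monomial multilinear maps on the plane. -/
def mono (m i : ℕ) : ContinuousMultilinearMap ℝ (fun _ : Fin m => ℝ × ℝ) ℝ :=
  (ContinuousMultilinearMap.mkPiAlgebra ℝ (Fin m) ℝ).compContinuousLinearMap
    (fun j => if (j : ℕ) < i then ContinuousLinearMap.fst ℝ ℝ ℝ else ContinuousLinearMap.snd ℝ ℝ ℝ)

lemma mono_norm (m i : ℕ) : ‖mono m i‖ ≤ 1 := by
  refine (ContinuousMultilinearMap.norm_compContinuousLinearMap_le _ _).trans ?_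
  rw [ContinuousMultilinearMap.norm_mkPiAlgebra, one_mul]
  refine Finset.prod_le_one (fun _ _ => norm_nonneg _) (fun j _ => ?_)
  split_ifs
  · exact ContinuousLinearMap.norm_fst_le _ _ _
  · exact ContinuousLinearMap.norm_snd_le _ _ _

lemma mono_apply (m i : ℕ) (hi : i ≤ m) (v : ℝ × ℝ) :
    mono m i (fun _ => v) = v.1 ^ i * v.2 ^ (m - i) := by
  have : mono m i (fun _ => v) = ∏ j : Fin m, (if (j : ℕ) < i then v.1 else v.2) := by
    simp only [mono, ContinuousMultilinearMap.compContinuousLinearMap_apply,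
      ContinuousMultilinearMap.mkPiAlgebra_apply]
    refine Finset.prod_congr rfl (fun j _ => ?_)
    split_ifs <;> rfl
  rw [this, Fin.prod_univ_eq_prod_range (fun j => if j < i then v.1 else v.2) m,
    Finset.prod_ite]
  simp only [Finset.prod_const]
  congr 2
  · have : (Finset.range m).filter (fun x => x < i) = Finset.range i := by
      ext x; simp; omega
    rw [this]; simp
  · have : (Finset.range m).filter (fun x => ¬ x < i) = Finset.Ico i m := by
      ext x; simp; omega
    rw [this]; simp

/-- The formal multilinear series of a double power series. -/
def dser (g : ℕ → ℕ → ℂ) : FormalMultilinearSeries ℝ (ℝ × ℝ) ℂ := fun m =>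
  ∑ q ∈ Finset.HasAntidiagonal.antidiagonal m, (mono m q.1).smulRight (g q.1 q.2)

lemma analytic_of_double {g : ℕ → ℕ → ℂ} {A C ρ : ℝ} (hA : 0 ≤ A) (hC : 0 < C) (hρ : 0 < ρ)
    (hg : ∀ i n, ‖g i n‖ ≤ A * C ^ (i + n)) {f : ℝ × ℝ → ℂ} {p : ℝ × ℝ}
    (hf : ∀ s t : ℝ, |s| < ρ → |t| < ρ →
      HasSum (fun q : ℕ × ℕ => g q.1 q.2 * ((s ^ q.1 * t ^ q.2 : ℝ) : ℂ)) (f (p.1 + s, p.2 + t))) :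
    AnalyticAt ℝ f p := by
  have hrad : ENNReal.ofReal (1 / (2 * C)) ≤ (dser g).radius := by
    have : ENNReal.ofReal (1 / (2 * C)) = ((1 / (2 * C)).toNNReal : ENNReal) := rfl
    rw [this]
    refine (dser g).le_radius_of_bound A (fun m => ?_)
    rw [Real.coe_toNNReal _ (by positivity)]
    have h1 : ‖dser g m‖ ≤ (m + 1) * (A * C ^ m) := by
      refine (norm_sum_le _ _).trans ?_
      have : ∀ q ∈ Finset.HasAntidiagonal.antidiagonal m, ‖(mono m q.1).smulRight (g q.1 q.2)‖ ≤ A * C ^ m := by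
        intro q hq
        rw [ContinuousMultilinearMap.norm_smulRight]
        have h2 := hg q.1 q.2
        rw [Finset.HasAntidiagonal.mem_antidiagonal.1 hq] at h2
        calc _ ≤ 1 * (A * C ^ m) := by gcongr; exact mono_norm _ _
          _ = _ := one_mul _
      refine (Finset.sum_le_card_nsmul _ _ _ this).trans ?_
      simp
    have h2 : ((m:ℝ) + 1) ≤ 2 ^ m := by
      have := Nat.lt_two_pow_self (n := m)
      exact_mod_cast this
    calc ‖dser g m‖ * (1 / (2 * C)) ^ m ≤ ((m + 1) * (A * C ^ m)) * (1 / (2 * C)) ^ m := by gcongr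
      _ ≤ (2 ^ m * (A * C ^ m)) * (1 / (2 * C)) ^ m := by gcongr
      _ = A := by
        rw [div_pow, mul_pow]; field_simp; simp
  let R : ℝ := min ρ (1 / (2 * C))
  have hR : 0 < R := by positivity
  have : HasFPowerSeriesOnBall f (dser g) p (ENNReal.ofReal R) := by
    refine ⟨le_trans (ENNReal.ofReal_le_ofReal (min_le_right _ _)) hrad, by simpa using hR, ?_⟩
    intro v hv
    have hv' : ‖v‖ < R := by
      simpa [Metric.mem_eball, edist_zero_right, enorm_eq_nnnorm, ← ENNReal.ofReal_coe_nnreal,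
        ENNReal.ofReal_lt_ofReal_iff hR] using hv
    have hvρ : ‖v‖ < ρ := hv'.trans_le (min_le_left _ _)
    have h1 : |v.1| < ρ := lt_of_le_of_lt (norm_fst_le v) hvρ
    have h2 : |v.2| < ρ := lt_of_le_of_lt (norm_snd_le v) hvρ
    have hs := hf v.1 v.2 h1 h2
    have hs' := (Finset.HasAntidiagonal.sigmaAntidiagonalEquivProd (A := ℕ)).hasSum_iff.2 hs
    have hs'' := hs'.sigma (fun m => hasSum_fintype _)
    have e : (fun m : ℕ => (dser g m) fun _ => v) = (fun m => ∑ b, ((fun q : ℕ × ℕ => g q.1 q.2 * ((v.1 ^ q.1 * v.2 ^ q.2 : ℝ) : ℂ)) ∘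
        (Finset.HasAntidiagonal.sigmaAntidiagonalEquivProd (A := ℕ))) ⟨m, b⟩) := by
      funext m
      simp only [dser, ContinuousMultilinearMap.sum_apply, ContinuousMultilinearMap.smulRight_apply]
      rw [← Finset.sum_coe_sort]
      refine Finset.sum_congr rfl (fun q _ => ?_)
      have hq := Finset.HasAntidiagonal.mem_antidiagonal.1 q.2
      rw [mono_apply _ _ (by omega)]
      have : m - q.1.1 = q.1.2 := by omega
      rw [this, Complex.real_smul, mul_comm]
      rfl
    rw [e]
    exact hs''
  exact this.analyticAt

/-- A jet with Cauchy bounds is analytic. -/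
lemma analytic_of_jet {G : ℕ → ℕ → ℝ → ℝ → ℂ} {r0 y0 ρ A C : ℝ} (hρ : 0 < ρ) (hA : 0 ≤ A)
    (hC : 0 < C)
    (hdr : ∀ i n r y, |r - r0| < ρ → |y - y0| < ρ →
      HasDerivAt (fun r => G i n r y) (G (i+1) n r y) r)
    (hdy : ∀ i n r y, |r - r0| < ρ → |y - y0| < ρ →
      HasDerivAt (fun y => G i n r y) (G i (n+1) r y) y)
    (hb : ∀ i n r y, |r - r0| < ρ → |y - y0| < ρ →
      ‖G i n r y‖ ≤ A * C ^ (i + n) * (i.factorial : ℝ) * (n.factorial : ℝ)) :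
    AnalyticAt ℝ (fun p : ℝ × ℝ => G 0 0 p.1 p.2) (r0, y0) := by
  let g : ℕ → ℕ → ℂ := fun i n => G i n r0 y0 * ((1 / (i.factorial * n.factorial : ℝ) : ℝ) : ℂ)
  have hg : ∀ i n, ‖g i n‖ ≤ A * C ^ (i + n) := by
    intro i n
    have h := hb i n r0 y0 (by simpa) (by simpa)
    have hi : (0:ℝ) < i.factorial := by positivity
    have hn : (0:ℝ) < n.factorial := by positivity
    simp only [g]
    rw [norm_mul, Complex.norm_real, Real.norm_eq_abs, abs_of_pos (by positivity)]
    calc _ ≤ (A * C ^ (i + n) * (i.factorial : ℝ) * (n.factorial : ℝ)) *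
        (1 / (i.factorial * n.factorial : ℝ)) := by gcongr
      _ = _ := by field_simp
  refine analytic_of_double (g := g) (ρ := min ρ (1 / (2 * C))) hA hC (by positivity) hg ?_
  intro s t hs ht
  have hsρ := hs.trans_le (min_le_left _ _)
  have htρ := ht.trans_le (min_le_left _ _)
  have hCs : C * |s| < 1 := by
    have := hs.trans_le (min_le_right _ _)
    rw [lt_div_iff₀ (by positivity)] at this
    nlinarith [abs_nonneg s]
  have hCt : C * |t| < 1 := by
    have := ht.trans_le (min_le_right _ _)
    rw [lt_div_iff₀ (by positivity)] at this
    nlinarith [abs_nonneg t]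
  have hsum : Summable (fun q : ℕ × ℕ => g q.1 q.2 * ((s ^ q.1 * t ^ q.2 : ℝ) : ℂ)) := by
    refine Summable.of_norm_bounded (g := fun q : ℕ × ℕ => A * ((C * |s|) ^ q.1 * (C * |t|) ^ q.2))
      (Summable.mul_left _ ?_) ?_
    · exact (summable_geometric_of_lt_one (by positivity) hCs).mul_of_nonneg
        (summable_geometric_of_lt_one (by positivity) hCt)
        (fun _ => by positivity) (fun _ => by positivity)
    · intro q
      rw [norm_mul, Complex.norm_real, Real.norm_eq_abs, abs_mul, abs_pow, abs_pow]
      calc _ ≤ (A * C ^ (q.1 + q.2)) * (|s| ^ q.1 * |t| ^ q.2) := by gcongr; exact hg _ _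
        _ = _ := by rw [pow_add, mul_pow, mul_pow]; ring
  have hy : HasSum (fun n : ℕ => G 0 n (r0 + s) y0 * ((t ^ n / (n.factorial : ℝ) : ℝ) : ℂ))
      (G 0 0 (r0 + s) (y0 + t)) := by
    refine taylor_jet (g := fun n y => G 0 n (r0 + s) y) hA hC.le
      (fun n y hy => hdy 0 n _ y (by simpa) hy) (fun n y hy => ?_) htρ hCt
    simpa using hb 0 n (r0 + s) y (by simpa) hy
  have hr : ∀ n, HasSum (fun i : ℕ => G i n r0 y0 * ((s ^ i / (i.factorial : ℝ) : ℝ) : ℂ))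
      (G 0 n (r0 + s) y0) := by
    intro n
    refine taylor_jet (g := fun i r => G i n r y0) (A := A * C ^ n * n.factorial) (by positivity) hC.le
      (fun i r hr => hdr i n r y0 hr (by simpa)) (fun i r hr => ?_) hsρ hCs
    refine (hb i n r y0 hr (by simpa)).trans (le_of_eq ?_)
    rw [pow_add]; ring
  have hswap : HasSum (fun q : ℕ × ℕ => g q.2 q.1 * ((s ^ q.2 * t ^ q.1 : ℝ) : ℂ))
      (∑' q : ℕ × ℕ, g q.1 q.2 * ((s ^ q.1 * t ^ q.2 : ℝ) : ℂ)) :=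
    (Equiv.prodComm ℕ ℕ).hasSum_iff.2 hsum.hasSum
  have h3 := hswap.prod_fiberwise (g := fun n => G 0 n (r0 + s) y0 * ((t ^ n / (n.factorial : ℝ) : ℝ) : ℂ))
    (fun n => by
      have := (hr n).mul_right ((t ^ n / (n.factorial : ℝ) : ℝ) : ℂ)
      refine this.congr_fun (fun i => ?_)
      show G i n r0 y0 * ((1 / (i.factorial * n.factorial : ℝ) : ℝ) : ℂ) * ((s ^ i * t ^ n : ℝ) : ℂ) = _
      push_cast; field_simp)
  have := h3.unique hy
  rw [← this]
  exact hsum.hasSum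

end KerrAux
end

section
namespace KerrAux
open MeasureTheory

/-- weight -/
def wt (κ : ℤ) (y : ℝ) : ℝ := (1 - y ^ 2) ^ κ

lemma one_sub_pos {y : ℝ} (hy : y ∈ Ioo (-1:ℝ) 1) : 0 < 1 - y ^ 2 := by
  nlinarith [hy.1, hy.2]

lemma wt_pos (κ : ℤ) {y : ℝ} (hy : y ∈ Ioo (-1:ℝ) 1) : 0 < wt κ y :=
  zpow_pos (one_sub_pos hy) κ

lemma wt_cont (κ : ℤ) : ContinuousOn (wt κ) (Ioo (-1:ℝ) 1) := by
  refine ContinuousOn.zpow₀ (by fun_prop) κ (fun y hy => Or.inl (one_sub_pos hy).ne')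

lemma wt_succ (κ : ℤ) {y : ℝ} (hy : y ∈ Ioo (-1:ℝ) 1) : wt (κ + 1) y = wt κ y * (1 - y ^ 2) := by
  rw [wt, wt, zpow_add_one₀ (one_sub_pos hy).ne']

lemma wt_hasDeriv (κ : ℤ) {y : ℝ} (hy : y ∈ Ioo (-1:ℝ) 1) :
    HasDerivAt (wt (κ + 1)) (-(2 * (κ + 1) * y) * wt κ y) y := by
  have h1 : HasDerivAt (fun y : ℝ => 1 - y ^ 2) (-(2 * y)) y := by
    have := ((hasDerivAt_id y).pow 2).const_sub 1
    simpa using this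
  have h2 := (hasDerivAt_zpow (κ + 1) (1 - y ^ 2) (Or.inl (one_sub_pos hy).ne')).comp y h1
  refine h2.congr_deriv ?_
  simp [wt]; ring

/-- real bilinear form -/
def Bf (κ : ℤ) (P Q : ℝ → ℂ) : ℝ :=
  ∫ y in Ioo (-1:ℝ) 1, wt κ y * (P y * (starRingEnd ℂ) (Q y)).re

/-- weighted boundedness -/
def WB (κ : ℤ) (P : ℝ → ℂ) : Prop :=
  ContinuousOn P (Ioo (-1:ℝ) 1) ∧ ∃ M, ∀ y ∈ Ioo (-1:ℝ) 1, wt κ y * ‖P y‖ ^ 2 ≤ M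

lemma re_mul_conj_le (z w : ℂ) : |(z * (starRingEnd ℂ) w).re| ≤ ‖z‖ * ‖w‖ := by
  refine (Complex.abs_re_le_norm _).trans ?_
  rw [norm_mul, RCLike.norm_conj]

lemma re_mul_conj_self (z : ℂ) : (z * (starRingEnd ℂ) z).re = ‖z‖ ^ 2 := by
  rw [Complex.mul_conj, Complex.ofReal_re, Complex.normSq_eq_norm_sq]

lemma young (x y ε : ℝ) (hε : 0 < ε) : x * y ≤ ε * x ^ 2 + 1 / (4 * ε) * y ^ 2 := by
  have : ε * x ^ 2 + 1 / (4 * ε) * y ^ 2 - x * y = (2 * ε * x - y) ^ 2 / (4 * ε) := by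
    field_simp; ring
  have h2 : 0 ≤ (2 * ε * x - y) ^ 2 / (4 * ε) := by positivity
  linarith

lemma WB.add {κ : ℤ} {P Q : ℝ → ℂ} (hP : WB κ P) (hQ : WB κ Q) : WB κ (fun y => P y + Q y) := by
  obtain ⟨hP, M, hM⟩ := hP
  obtain ⟨hQ, N, hN⟩ := hQ
  refine ⟨hP.add hQ, 2 * M + 2 * N, fun y hy => ?_⟩
  have h1 : ‖P y + Q y‖ ^ 2 ≤ 2 * ‖P y‖ ^ 2 + 2 * ‖Q y‖ ^ 2 := by
    have := norm_add_le (P y) (Q y)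
    nlinarith [norm_nonneg (P y + Q y), sq_nonneg (‖P y‖ - ‖Q y‖)]
  have := hM y hy
  have := hN y hy
  have := mul_le_mul_of_nonneg_left h1 (wt_pos κ hy).le
  linarith

lemma WB.cmul {κ : ℤ} {P : ℝ → ℂ} (hP : WB κ P) (c : ℂ) : WB κ (fun y => c * P y) := by
  obtain ⟨hP, M, hM⟩ := hP
  refine ⟨continuousOn_const.mul hP, ‖c‖ ^ 2 * M, fun y hy => ?_⟩
  rw [norm_mul, mul_pow]
  have := mul_le_mul_of_nonneg_left (hM y hy) (sq_nonneg ‖c‖)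
  linarith

lemma WB.sub {κ : ℤ} {P Q : ℝ → ℂ} (hP : WB κ P) (hQ : WB κ Q) : WB κ (fun y => P y - Q y) := by
  have := hP.add (hQ.cmul (-1))
  refine (by simpa [sub_eq_add_neg] using this)

lemma WB.congr {κ : ℤ} {P Q : ℝ → ℂ} (hP : WB κ P) (h : ∀ y ∈ Ioo (-1:ℝ) 1, Q y = P y) : WB κ Q := by
  obtain ⟨hP, M, hM⟩ := hP
  exact ⟨hP.congr h, M, fun y hy => by rw [h y hy]; exact hM y hy⟩

lemma Bf_pt {κ : ℤ} {p q : ℂ} {y M N : ℝ} (hy : y ∈ Ioo (-1:ℝ) 1) (hM : wt κ y * ‖p‖ ^ 2 ≤ M)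
    (hN : wt κ y * ‖q‖ ^ 2 ≤ N) : |wt κ y * (p * (starRingEnd ℂ) q).re| ≤ M + N := by
  rw [abs_mul, abs_of_pos (wt_pos κ hy)]
  have h1 := re_mul_conj_le p q
  have h2 : ‖p‖ * ‖q‖ ≤ ‖p‖ ^ 2 + ‖q‖ ^ 2 := by
    nlinarith [sq_nonneg (‖p‖ - ‖q‖), sq_nonneg ‖p‖, sq_nonneg ‖q‖]
  have := mul_le_mul_of_nonneg_left (h1.trans h2) (wt_pos κ hy).le
  linarith

lemma Bf_cont {κ : ℤ} {P Q : ℝ → ℂ} (hP : ContinuousOn P (Ioo (-1:ℝ) 1))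
    (hQ : ContinuousOn Q (Ioo (-1:ℝ) 1)) :
    ContinuousOn (fun y => wt κ y * (P y * (starRingEnd ℂ) (Q y)).re) (Ioo (-1:ℝ) 1) := by
  refine (wt_cont κ).mul (Complex.continuous_re.comp_continuousOn (hP.mul ?_))
  exact Complex.continuous_conj.comp_continuousOn hQ

lemma Bf_int {κ : ℤ} {P Q : ℝ → ℂ} (hP : WB κ P) (hQ : WB κ Q) :
    IntegrableOn (fun y => wt κ y * (P y * (starRingEnd ℂ) (Q y)).re) (Ioo (-1:ℝ) 1) := by
  obtain ⟨hP, M, hM⟩ := hP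
  obtain ⟨hQ, N, hN⟩ := hQ
  refine Integrable.of_bound (μ := volume.restrict (Ioo (-1:ℝ) 1))
    ((Bf_cont hP hQ).aestronglyMeasurable measurableSet_Ioo) (M + N) ?_
  filter_upwards [ae_restrict_mem measurableSet_Ioo] with y hy
  exact Bf_pt hy (hM y hy) (hN y hy)

lemma Bf_congr {κ : ℤ} {P Q P' Q' : ℝ → ℂ} (h : ∀ y ∈ Ioo (-1:ℝ) 1, P y = P' y)
    (h' : ∀ y ∈ Ioo (-1:ℝ) 1, Q y = Q' y) : Bf κ P Q = Bf κ P' Q' := by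
  refine setIntegral_congr_fun measurableSet_Ioo (fun y hy => ?_)
  simp only [h y hy, h' y hy]

lemma Bf_comm {κ : ℤ} (P Q : ℝ → ℂ) : Bf κ P Q = Bf κ Q P := by
  unfold Bf
  congr 1; funext y
  congr 1
  simp [Complex.mul_re]; ring

lemma Bf_add {κ : ℤ} {P Q R : ℝ → ℂ} (hP : WB κ P) (hQ : WB κ Q) (hR : WB κ R) :
    Bf κ (fun y => P y + Q y) R = Bf κ P R + Bf κ Q R := by
  unfold Bf
  rw [← integral_add (Bf_int hP hR) (Bf_int hQ hR)]
  congr 1; funext y; rw [add_mul, Complex.add_re]; ring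

lemma Bf_rmul {κ : ℤ} (P R : ℝ → ℂ) (c : ℝ) :
    Bf κ (fun y => (c:ℂ) * P y) R = c * Bf κ P R := by
  unfold Bf
  rw [← integral_const_mul]
  congr 1; funext y; rw [mul_assoc, Complex.re_ofReal_mul]; ring

lemma Bf_sub {κ : ℤ} {P Q R : ℝ → ℂ} (hP : WB κ P) (hQ : WB κ Q) (hR : WB κ R) :
    Bf κ (fun y => P y - Q y) R = Bf κ P R - Bf κ Q R := by
  have h := Bf_add hP (hQ.cmul ((-1:ℝ):ℂ)) hR
  rw [Bf_rmul] at h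
  rw [sub_eq_add_neg, ← neg_one_mul, ← h]
  congr 1; funext y; push_cast; ring

lemma Bf_cself {κ : ℤ} (P : ℝ → ℂ) (c : ℂ) : Bf κ (fun y => c * P y) P = c.re * Bf κ P P := by
  unfold Bf
  rw [← integral_const_mul]
  congr 1; funext y; rw [mul_assoc, Complex.mul_conj, Complex.ofReal_re, mul_comm c,
    Complex.re_ofReal_mul]; ring

lemma Bf_self {κ : ℤ} (P : ℝ → ℂ) : Bf κ P P = ∫ y in Ioo (-1:ℝ) 1, wt κ y * ‖P y‖ ^ 2 := by
  unfold Bf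
  simp only [re_mul_conj_self]

lemma Bf_self_int {κ : ℤ} {P : ℝ → ℂ} (hP : WB κ P) :
    IntegrableOn (fun y => wt κ y * ‖P y‖ ^ 2) (Ioo (-1:ℝ) 1) := by
  have := Bf_int hP hP
  simpa only [re_mul_conj_self] using this

lemma Bf_nonneg {κ : ℤ} (P : ℝ → ℂ) : 0 ≤ Bf κ P P := by
  rw [Bf_self]
  exact setIntegral_nonneg measurableSet_Ioo (fun y hy => mul_nonneg (wt_pos κ hy).le (sq_nonneg _))

lemma Bf_young {κ : ℤ} {P Q : ℝ → ℂ} (hP : WB κ P) (hQ : WB κ Q) {ε : ℝ} (hε : 0 < ε) :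
    |Bf κ P Q| ≤ ε * Bf κ P P + 1 / (4 * ε) * Bf κ Q Q := by
  rw [Bf_self, Bf_self, ← integral_const_mul, ← integral_const_mul,
    ← integral_add ((Bf_self_int hP).const_mul _) ((Bf_self_int hQ).const_mul _)]
  refine (abs_integral_le_integral_abs).trans ?_
  refine setIntegral_mono_on (Bf_int hP hQ).abs
    (((Bf_self_int hP).const_mul _).add ((Bf_self_int hQ).const_mul _)) measurableSet_Ioo ?_
  intro y hy
  rw [abs_mul, abs_of_pos (wt_pos κ hy)]
  have h1 := (re_mul_conj_le (P y) (Q y)).trans (young _ _ ε hε)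
  have := mul_le_mul_of_nonneg_left h1 (wt_pos κ hy).le
  linarith

/-- Differentiation under the integral sign. -/
lemma Bf_hasDeriv {κ : ℤ} {P P' Q Q' : ℝ → ℝ → ℂ} {r0 ε M : ℝ} (hε : 0 < ε)
    (cP : ∀ r, |r - r0| < ε → ContinuousOn (P r) (Ioo (-1:ℝ) 1))
    (cP' : ∀ r, |r - r0| < ε → ContinuousOn (P' r) (Ioo (-1:ℝ) 1))
    (cQ : ∀ r, |r - r0| < ε → ContinuousOn (Q r) (Ioo (-1:ℝ) 1))
    (cQ' : ∀ r, |r - r0| < ε → ContinuousOn (Q' r) (Ioo (-1:ℝ) 1))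
    (bP : ∀ r, |r - r0| < ε → ∀ y ∈ Ioo (-1:ℝ) 1, wt κ y * ‖P r y‖ ^ 2 ≤ M)
    (bP' : ∀ r, |r - r0| < ε → ∀ y ∈ Ioo (-1:ℝ) 1, wt κ y * ‖P' r y‖ ^ 2 ≤ M)
    (bQ : ∀ r, |r - r0| < ε → ∀ y ∈ Ioo (-1:ℝ) 1, wt κ y * ‖Q r y‖ ^ 2 ≤ M)
    (bQ' : ∀ r, |r - r0| < ε → ∀ y ∈ Ioo (-1:ℝ) 1, wt κ y * ‖Q' r y‖ ^ 2 ≤ M)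
    (dP : ∀ r, |r - r0| < ε → ∀ y ∈ Ioo (-1:ℝ) 1, HasDerivAt (fun r => P r y) (P' r y) r)
    (dQ : ∀ r, |r - r0| < ε → ∀ y ∈ Ioo (-1:ℝ) 1, HasDerivAt (fun r => Q r y) (Q' r y) r) :
    HasDerivAt (fun r => Bf κ (P r) (Q r)) (Bf κ (P' r0) (Q r0) + Bf κ (P r0) (Q' r0)) r0 := by
  have h0 : |r0 - r0| < ε := by simpa using hε
  have key := hasDerivAt_integral_of_dominated_loc_of_deriv_le (μ := volume.restrict (Ioo (-1:ℝ) 1))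
    (F := fun r y => wt κ y * (P r y * (starRingEnd ℂ) (Q r y)).re)
    (F' := fun r y => wt κ y * (P' r y * (starRingEnd ℂ) (Q r y)).re +
      wt κ y * (P r y * (starRingEnd ℂ) (Q' r y)).re)
    (x₀ := r0) (s := Metric.ball r0 ε) (bound := fun _ => (M + M) + (M + M))
    (Metric.ball_mem_nhds r0 hε) ?_ ?_ ?_ ?_ ?_ ?_
  · refine key.2.congr_deriv ?_
    unfold Bf
    rw [integral_add]
    · exact Bf_int ⟨cP' r0 h0, M, bP' r0 h0⟩ ⟨cQ r0 h0, M, bQ r0 h0⟩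
    · exact Bf_int ⟨cP r0 h0, M, bP r0 h0⟩ ⟨cQ' r0 h0, M, bQ' r0 h0⟩
  · filter_upwards [Metric.ball_mem_nhds r0 hε] with r hr
    exact (Bf_cont (cP r hr) (cQ r hr)).aestronglyMeasurable measurableSet_Ioo
  · exact Bf_int ⟨cP r0 h0, M, bP r0 h0⟩ ⟨cQ r0 h0, M, bQ r0 h0⟩
  · exact ((Bf_cont (cP' r0 h0) (cQ r0 h0)).add
      (Bf_cont (cP r0 h0) (cQ' r0 h0))).aestronglyMeasurable measurableSet_Ioo
  · filter_upwards [ae_restrict_mem measurableSet_Ioo] with y hy r hr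
    refine (norm_add_le _ _).trans (add_le_add ?_ ?_)
    · exact Bf_pt hy (bP' r hr y hy) (bQ r hr y hy)
    · exact Bf_pt hy (bP r hr y hy) (bQ' r hr y hy)
  · exact integrable_const _
  · filter_upwards [ae_restrict_mem measurableSet_Ioo] with y hy r hr
    have h1 := (dP r hr y hy).mul ((dQ r hr y hy).star)
    have h2 := (Complex.reCLM.hasFDerivAt.comp_hasDerivAt r h1).const_mul (wt κ y)
    refine h2.congr_deriv ?_
    simp [Complex.mul_re]
    ring

/-- Integration by parts. -/
lemma Bf_ibp {κ : ℤ} {g0 g1 g2 k0 k1 L : ℝ → ℂ} {l : ℝ}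
    (d1 : ∀ y ∈ Ioo (-1:ℝ) 1, HasDerivAt g1 (g2 y) y)
    (e0 : ∀ y ∈ Ioo (-1:ℝ) 1, HasDerivAt k0 (k1 y) y)
    (hL : ∀ y ∈ Ioo (-1:ℝ) 1, L y = ((1 - y ^ 2 : ℝ) : ℂ) * g2 y
      - ((2 * (κ + 1) * y : ℝ) : ℂ) * g1 y - (l : ℂ) * g0 y)
    (w0 : WB κ g0) (w1 : WB (κ + 1) g1) (wL : WB κ L) (v0 : WB κ k0) (v1 : WB (κ + 1) k1) :
    Bf κ L k0 = - Bf (κ + 1) g1 k1 - l * Bf κ g0 k0 := by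
  let F : ℝ → ℝ := fun y => wt (κ + 1) y * (g1 y * (starRingEnd ℂ) (k0 y)).re
  let F' : ℝ → ℝ := fun y => (wt κ y * (L y * (starRingEnd ℂ) (k0 y)).re +
    l * (wt κ y * (g0 y * (starRingEnd ℂ) (k0 y)).re)) +
    wt (κ + 1) y * (g1 y * (starRingEnd ℂ) (k1 y)).re
  have hF : ∀ y ∈ Ioo (-1:ℝ) 1, HasDerivAt F (F' y) y := by
    intro y hy
    have h1 := (d1 y hy).mul ((e0 y hy).star)
    have h2 := (wt_hasDeriv κ hy).mul (Complex.reCLM.hasFDerivAt.comp_hasDerivAt y h1)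
    refine h2.congr_deriv ?_
    simp only [F', hL y hy, wt_succ κ hy]
    simp [Complex.mul_re, -Complex.ofReal_sub, -Complex.ofReal_pow]
    ring
  have i1 := Bf_int wL v0
  have i2 := (Bf_int w0 v0).const_mul l
  have i3 := Bf_int w1 v1
  have hint : IntegrableOn F' (Ioo (-1:ℝ) 1) := (i1.add i2).add i3
  have hint' : IntervalIntegrable F' volume (-1) 1 := by
    rw [intervalIntegrable_iff_integrableOn_Ioo_of_le (by norm_num)]
    exact hint
  obtain ⟨_, M, hM⟩ := w1
  obtain ⟨_, N, hN⟩ := v0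
  have hbd : ∀ y ∈ Ioo (-1:ℝ) 1, ‖F y‖ ≤ √(1 - y ^ 2) * (M + N) := by
    intro y hy
    have hp := one_sub_pos hy
    have hs : 0 < √(1 - y ^ 2) := Real.sqrt_pos.2 hp
    have hsq := Real.sq_sqrt hp.le
    have hw := wt_pos κ hy
    have h1 := hM y hy
    have h2 := hN y hy
    rw [wt_succ κ hy] at h1
    simp only [F, Real.norm_eq_abs]
    rw [wt_succ κ hy, abs_mul, abs_of_pos (by positivity)]
    have h3 := re_mul_conj_le (g1 y) (k0 y)
    calc wt κ y * (1 - y ^ 2) * |(g1 y * (starRingEnd ℂ) (k0 y)).re|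
        ≤ wt κ y * (1 - y ^ 2) * (‖g1 y‖ * ‖k0 y‖) := by gcongr
      _ = √(1 - y ^ 2) * (wt κ y * ((√(1 - y ^ 2) * ‖g1 y‖) * ‖k0 y‖)) := by
        nth_rw 1 [← hsq]; ring
      _ ≤ √(1 - y ^ 2) * (wt κ y * ((√(1 - y ^ 2) * ‖g1 y‖) ^ 2 + ‖k0 y‖ ^ 2)) := by
        gcongr
        nlinarith [sq_nonneg ((√(1 - y ^ 2) * ‖g1 y‖) - ‖k0 y‖),
          sq_nonneg (√(1 - y ^ 2) * ‖g1 y‖), sq_nonneg ‖k0 y‖]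
      _ ≤ √(1 - y ^ 2) * (M + N) := by
        gcongr
        rw [mul_pow, hsq]
        linarith
  have hlim : ∀ (y1 : ℝ) (l : Filter ℝ), y1 ^ 2 = 1 → l ≤ nhds y1 → Ioo (-1:ℝ) 1 ∈ l →
      Filter.Tendsto F l (nhds 0) := by
    intro y1 l hy1 hl hmem
    have hb : Filter.Tendsto (fun y : ℝ => √(1 - y ^ 2) * (M + N)) l (nhds 0) := by
      have : Continuous (fun y : ℝ => √(1 - y ^ 2) * (M + N)) := by fun_prop
      have := this.tendsto y1
      simp [hy1] at this
      exact this.mono_left hl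
    refine squeeze_zero_norm' ?_ hb
    filter_upwards [hmem] with y hy using hbd y hy
  have hmain := intervalIntegral.integral_eq_sub_of_hasDerivAt_of_tendsto (by norm_num : (-1:ℝ) < 1)
    (fun y hy => hF y hy) hint'
    (hlim (-1) (nhdsWithin (-1) (Ioi (-1))) (by norm_num) nhdsWithin_le_nhds
      (Ioo_mem_nhdsGT (by norm_num)))
    (hlim 1 (nhdsWithin 1 (Iio 1)) (by norm_num) nhdsWithin_le_nhds
      (Ioo_mem_nhdsLT (by norm_num)))
  rw [intervalIntegral.integral_of_le (by norm_num), integral_Ioc_eq_integral_Ioo] at hmain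
  have hsplit : ∫ y in Ioo (-1:ℝ) 1, F' y = Bf κ L k0 + l * Bf κ g0 k0 + Bf (κ + 1) g1 k1 := by
    simp only [F']
    have i12 : IntegrableOn (fun y => wt κ y * (L y * (starRingEnd ℂ) (k0 y)).re +
      l * (wt κ y * (g0 y * (starRingEnd ℂ) (k0 y)).re)) (Ioo (-1:ℝ) 1) := i1.add i2
    rw [integral_add i12 i3, integral_add i1 i2, integral_const_mul]
    rfl
  rw [hsplit] at hmain
  linarith

end KerrAux
end

section
namespace KerrAux
open MeasureTheory

abbrev ad (n : ℕ) : Finset (ℕ × ℕ) := Finset.HasAntidiagonal.antidiagonal n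

lemma leib {F : ℕ → ℕ → ℝ → ℂ} {x : ℝ}
    (h : ∀ i j, HasDerivAt (F i j) (F (i+1) j x + F i (j+1) x) x) (n : ℕ) :
    HasDerivAt (fun x => ∑ p ∈ ad n, (n.choose p.1 : ℂ) * F p.1 p.2 x)
      (∑ p ∈ ad (n+1), ((n+1).choose p.1 : ℂ) * F p.1 p.2 x) x := by
  have h1 := HasDerivAt.fun_sum (u := ad n) (fun p (_ : p ∈ ad n) => (h p.1 p.2).const_mul (n.choose p.1 : ℂ))
  refine h1.congr_deriv ?_
  have h2 := Finset.sum_antidiagonal_choose_succ_mul (fun i j => F i j x) n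
  rw [h2, ← Finset.sum_add_distrib]
  refine Finset.sum_congr rfl (fun p hp => ?_)
  have hp' := Finset.HasAntidiagonal.mem_antidiagonal.1 hp
  have : n.choose p.1 = n.choose p.2 := by
    rw [← hp']; exact Nat.choose_symm_add
  rw [← this]; ring

/-- A jet of functions of `(r,y)`. -/
structure Jet (ra : ℝ) (G : ℕ → ℕ → ℝ → ℝ → ℂ) : Prop where
  dr : ∀ i n r y, ra < r → y ∈ Ioo (-1:ℝ) 1 → HasDerivAt (fun r => G i n r y) (G (i+1) n r y) r
  dy : ∀ i n r y, ra < r → y ∈ Ioo (-1:ℝ) 1 → HasDerivAt (fun y => G i n r y) (G i (n+1) r y) y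
  cont : ∀ i n, ContinuousOn (fun p : ℝ × ℝ => G i n p.1 p.2) (Ioi ra ×ˢ Ioo (-1:ℝ) 1)

/-- Weighted Cauchy bounds. -/
def ABdd (ra : ℝ) (κ : ℤ) (f : ℕ → ℕ → ℝ → ℝ → ℂ) : Prop :=
  ∀ α β : ℝ, ra < α → ∃ A C : ℝ, 0 ≤ A ∧ 1 ≤ C ∧ ∀ (i n : ℕ), ∀ r ∈ Icc α β, ∀ y ∈ Ioo (-1:ℝ) 1,
    wt (κ + n) y * ‖f i n r y‖ ^ 2 ≤ (A * C ^ (i + n) * i.factorial * n.factorial) ^ 2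

/-- The reduced degenerate equation. -/
structure Sys where
  (rC re ra : ℝ)
  (hC : rC < ra)
  (he : ra < re)
  (κ : ℤ)
  (b0 b1 b2 : ℂ)
  (G c f : ℕ → ℕ → ℝ → ℝ → ℂ)
  (jG : Jet ra G)
  (jc : Jet ra c)
  (jf : Jet ra f)
  (wG : ∀ (i n : ℕ) (α β : ℝ), ra < α → ∃ M, ∀ r ∈ Icc α β, ∀ y ∈ Ioo (-1:ℝ) 1,
    wt (κ + n) y * ‖G i n r y‖ ^ 2 ≤ M)
  (ac : ABdd ra 0 c)
  (af : ABdd ra κ f)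
  (pde : ∀ r y, ra < r → y ∈ Ioo (-1:ℝ) 1 →
    (((r - rC) * (r - re) : ℝ) : ℂ) * G 2 0 r y
      + (((2 * r - rC - re : ℝ) : ℂ) + (b0 + b1 * r + b2 * r ^ 2)) * G 1 0 r y
      + ((1 - y ^ 2 : ℝ) : ℂ) * G 0 2 r y - ((2 * (κ + 1) * y : ℝ) : ℂ) * G 0 1 r y
      - ((κ * (κ + 1) : ℝ) : ℂ) * G 0 0 r y + c 0 0 r y * G 0 0 r y = f 0 0 r y)

namespace Sys
variable (S : Sys)

def mu (r : ℝ) : ℝ := (r - S.rC) * (r - S.re)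
def mu' (r : ℝ) : ℝ := 2 * r - S.rC - S.re
def b (r : ℝ) : ℂ := S.b0 + S.b1 * r + S.b2 * r ^ 2
def b' (r : ℝ) : ℂ := S.b1 + 2 * S.b2 * r
def lam (n : ℕ) : ℝ := (S.κ + n) * (S.κ + n + 1)
def al (i : ℕ) (r : ℝ) : ℂ := (i:ℂ) * (i + 1) + i * S.b' r
def be (i : ℕ) : ℂ := (i:ℂ) * (i - 1) * S.b2

/-- product jet -/
def cG (i n : ℕ) (r y : ℝ) : ℂ :=
  ∑ p ∈ ad i, (i.choose p.1 : ℂ) * ∑ q ∈ ad n, (n.choose q.1 : ℂ) *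
    (S.c p.1 q.1 r y * S.G p.2 q.2 r y)

/-- The operator `L`. -/
def L (i n : ℕ) (r y : ℝ) : ℂ := ((1 - y ^ 2 : ℝ) : ℂ) * S.G i (n+2) r y
  - ((2 * (((S.κ + n : ℤ) : ℝ) + 1) * y : ℝ) : ℂ) * S.G i (n+1) r y - (S.lam n : ℂ) * S.G i n r y

/-- right-hand side -/
def hh (i n : ℕ) (r y : ℝ) : ℂ :=
  S.f i n r y - S.cG i n r y - S.al i r * S.G i n r y - S.be i * S.G (i-1) n r y

lemma mu_deriv (r : ℝ) : HasDerivAt S.mu (S.mu' r) r := by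
  have := ((hasDerivAt_id r).sub_const S.rC).mul ((hasDerivAt_id r).sub_const S.re)
  refine this.congr_deriv ?_
  simp [mu']; ring

lemma b_deriv (r : ℝ) : HasDerivAt S.b (S.b' r) r := by
  have h0 : HasDerivAt (fun r : ℝ => (r:ℂ)) 1 r := Complex.ofRealCLM.hasDerivAt
  have := (((h0.const_mul S.b1).const_add S.b0).add ((h0.pow 2).const_mul S.b2))
  refine (this.congr_deriv ?_)
  simp [b']; ring

lemma al_deriv (i : ℕ) (r : ℝ) : HasDerivAt (S.al i) (i * (2 * S.b2)) r := by
  have h0 : HasDerivAt (fun r : ℝ => (r:ℂ)) 1 r := Complex.ofRealCLM.hasDerivAt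
  have := ((((h0.const_mul (2 * S.b2)).const_add S.b1).const_mul (i:ℂ))).const_add ((i:ℂ) * (i + 1))
  refine (this.congr_deriv ?_)
  simp

lemma cG_dy (i n : ℕ) {r y : ℝ} (hr : S.ra < r) (hy : y ∈ Ioo (-1:ℝ) 1) :
    HasDerivAt (fun y => S.cG i n r y) (S.cG i (n+1) r y) y := by
  refine HasDerivAt.fun_sum (fun p _ => HasDerivAt.const_mul _ ?_)
  refine leib (F := fun j k y => S.c p.1 j r y * S.G p.2 k r y) (fun j k => ?_) n
  exact (S.jc.dy _ _ _ _ hr hy).mul (S.jG.dy _ _ _ _ hr hy)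

lemma cG_dr (i n : ℕ) {r y : ℝ} (hr : S.ra < r) (hy : y ∈ Ioo (-1:ℝ) 1) :
    HasDerivAt (fun r => S.cG i n r y) (S.cG (i+1) n r y) r := by
  refine leib (F := fun j k r => ∑ q ∈ ad n, (n.choose q.1 : ℂ) *
    (S.c j q.1 r y * S.G k q.2 r y)) (fun j k => ?_) i
  rw [← Finset.sum_add_distrib]
  refine HasDerivAt.fun_sum (fun q _ => ?_)
  rw [← mul_add]
  refine HasDerivAt.const_mul _ ?_
  exact (S.jc.dr _ _ _ _ hr hy).mul (S.jG.dr _ _ _ _ hr hy)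

lemma cont_y {G : ℕ → ℕ → ℝ → ℝ → ℂ} {ra : ℝ} (j : Jet ra G) (i n : ℕ) {r : ℝ} (hr : ra < r) :
    ContinuousOn (fun y => G i n r y) (Ioo (-1:ℝ) 1) := fun y hy =>
  (j.dy i n r y hr hy).continuousAt.continuousWithinAt

lemma hasDeriv_unique_on_y {f g : ℝ → ℂ} {f' g' : ℂ} {y : ℝ} (hy : y ∈ Ioo (-1:ℝ) 1)
    (h : ∀ y ∈ Ioo (-1:ℝ) 1, f y = g y) (hf : HasDerivAt f f' y) (hg : HasDerivAt g g' y) :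
    f' = g' := by
  have : f =ᶠ[nhds y] g := by
    filter_upwards [isOpen_Ioo.mem_nhds hy] with z hz using h z hz
  exact hf.unique (hg.congr_of_eventuallyEq this)

lemma hasDeriv_unique_on_r {f g : ℝ → ℂ} {f' g' : ℂ} {r ra : ℝ} (hy : ra < r)
    (h : ∀ r, ra < r → f r = g r) (hf : HasDerivAt f f' r) (hg : HasDerivAt g g' r) :
    f' = g' := by
  have : f =ᶠ[nhds r] g := by
    filter_upwards [isOpen_Ioi.mem_nhds hy] with z hz using h z hz
  exact hf.unique (hg.congr_of_eventuallyEq this)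

/-- the differentiated equation -/
lemma pde_all (i n : ℕ) : ∀ r y, S.ra < r → y ∈ Ioo (-1:ℝ) 1 →
    (S.mu r : ℂ) * S.G (i+2) n r y + (((i + 1) * S.mu' r : ℝ) + S.b r) * S.G (i+1) n r y
      + S.L i n r y = S.hh i n r y := by
  induction i with
  | zero =>
    induction n with
    | zero =>
      intro r y hr hy
      have := S.pde r y hr hy
      simp only [L, hh, mu, mu', b, lam, cG, al, be]
      simp
      push_cast at this
      linear_combination this
    | succ n ih =>
      intro r y hr hy
      have d := fun i n => S.jG.dy i n r y hr hy
      have hy1 : HasDerivAt (fun y : ℝ => ((1 - y ^ 2 : ℝ) : ℂ)) (-(2 * y)) y := by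
        have h1 : HasDerivAt (fun y : ℝ => 1 - y ^ 2) (-(2 * y)) y := by
          have := ((hasDerivAt_id y).pow 2).const_sub 1
          simpa using this
        simpa using h1.ofReal_comp
      have hy2 : HasDerivAt (fun y : ℝ => ((2 * (((S.κ + n : ℤ) : ℝ) + 1) * y : ℝ) : ℂ))
          ((2 * (((S.κ + n : ℤ) : ℝ) + 1) : ℝ) : ℂ) y := by
        have h1 : HasDerivAt (fun y : ℝ => (2 * (((S.κ + n : ℤ) : ℝ) + 1) * y : ℝ))
          ((2 * (((S.κ + n : ℤ) : ℝ) + 1) : ℝ)) y := by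
          simpa using (hasDerivAt_id y).const_mul (2 * (((S.κ + n : ℤ) : ℝ) + 1))
        exact h1.ofReal_comp
      have hl := (((d 2 n).const_mul (S.mu r : ℂ)).add ((d 1 n).const_mul
        ((((0:ℕ) + 1) * S.mu' r : ℝ) + S.b r : ℂ))).add (((hy1.mul (d 0 (n+2))).sub
          (hy2.mul (d 0 (n+1)))).sub ((d 0 n).const_mul (S.lam n : ℂ)))
      have hr' := (((S.jf.dy 0 n r y hr hy).sub (S.cG_dy 0 n hr hy)).sub
        ((d 0 n).const_mul (S.al 0 r))).sub ((d 0 n).const_mul (S.be 0))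
      have := hasDeriv_unique_on_y hy (fun y hy => ih r y hr hy) hl hr'
      simp only [L, hh, lam, al, be] at this ⊢
      push_cast at this ⊢
      linear_combination this
  | succ i ih =>
    intro r y hr hy
    have d := fun i n => S.jG.dr i n r y hr hy
    have hmu := (S.mu_deriv r).ofReal_comp
    have hb : HasDerivAt (fun r => ((((i:ℝ) + 1) * S.mu' r : ℝ) : ℂ) + S.b r)
        (((i:ℂ) + 1) * 2 + S.b' r) r := by
      have h1 : HasDerivAt (fun r => ((i:ℝ) + 1) * S.mu' r) (((i:ℝ) + 1) * 2) r := by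
        refine HasDerivAt.const_mul _ ?_
        have := (((hasDerivAt_id r).const_mul 2).sub_const S.rC).sub_const S.re
        exact this.congr_deriv (by simp)
      have := h1.ofReal_comp.add (S.b_deriv r)
      refine this.congr_deriv ?_
      push_cast; ring
    have hl := ((hmu.mul (d (i+2) n)).add (hb.mul (d (i+1) n))).add
      ((((d i (n+2)).const_mul ((1 - y ^ 2 : ℝ) : ℂ)).sub ((d i (n+1)).const_mul
        ((2 * (((S.κ + n : ℤ) : ℝ) + 1) * y : ℝ) : ℂ))).sub ((d i n).const_mul (S.lam n : ℂ)))
    have hbe : HasDerivAt (fun r => S.be i * S.G (i-1) n r y) (S.be i * S.G i n r y) r := by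
      rcases i with _ | i
      · simp only [be, Nat.cast_zero, zero_mul]
        exact hasDerivAt_const _ _
      · exact (d i n).const_mul _
    have hr' := (((S.jf.dr i n r y hr hy).sub (S.cG_dr i n hr hy)).sub
        ((S.al_deriv i r).mul (d i n))).sub hbe
    have := hasDeriv_unique_on_r hr (fun r hr => ih r y hr hy) hl hr'
    simp only [L, hh, lam, al, be] at this ⊢
    push_cast at this ⊢
    try simp only [Nat.add_sub_cancel]
    linear_combination this

end Sys
end KerrAux
end

section
namespace KerrAux
open MeasureTheory
namespace Sys
variable (S : Sys)

def a (i n : ℕ) (r : ℝ) : ℝ := Bf (S.κ + n) (S.G i n r) (S.G i n r)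
def X (i n : ℕ) (r : ℝ) : ℝ := Bf (S.κ + n) (S.G (i+1) n r) (S.G i n r)
def H (i n : ℕ) (r : ℝ) : ℝ := Bf (S.κ + n) (S.hh i n r) (S.hh i n r)
/-- normalised energies -/
def ah (i n : ℕ) (r : ℝ) : ℝ := S.a i n r / (n.factorial : ℝ) ^ 2
def Sg (K : ℝ) (i n : ℕ) (r : ℝ) : ℝ := ∑ p ∈ ad i, ∑ q ∈ ad n, K ^ q.1 * S.ah p.2 q.2 r

lemma a_nonneg (i n : ℕ) (r : ℝ) : 0 ≤ S.a i n r := Bf_nonneg _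
lemma ah_nonneg (i n : ℕ) (r : ℝ) : 0 ≤ S.ah i n r := div_nonneg (S.a_nonneg i n r) (sq_nonneg _)
lemma H_nonneg (i n : ℕ) (r : ℝ) : 0 ≤ S.H i n r := Bf_nonneg _

lemma lam_nonneg (n : ℕ) : 0 ≤ S.lam n := by
  have : (0:ℤ) ≤ (S.κ + n) * (S.κ + n + 1) := by
    rcases le_or_gt 0 (S.κ + (n:ℤ)) with h | h
    · positivity
    · nlinarith
  unfold lam
  exact_mod_cast this

lemma wbG (i n : ℕ) {r : ℝ} (hr : S.ra < r) : WB (S.κ + n) (S.G i n r) := by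
  obtain ⟨M, hM⟩ := S.wG i n r r hr
  exact ⟨cont_y S.jG i n hr, M, fun y hy => hM r ⟨le_rfl, le_rfl⟩ y hy⟩

lemma wbf (i n : ℕ) {r : ℝ} (hr : S.ra < r) : WB (S.κ + n) (S.f i n r) := by
  obtain ⟨A, C, _, _, hM⟩ := S.af r r hr
  exact ⟨cont_y S.jf i n hr, _, fun y hy => hM i n r ⟨le_rfl, le_rfl⟩ y hy⟩

lemma wb_sum {ι : Type*} (s : Finset ι) {κ : ℤ} {P : ι → ℝ → ℂ} (h : ∀ i ∈ s, WB κ (P i)) :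
    WB κ (fun y => ∑ i ∈ s, P i y) := by
  classical
  induction s using Finset.induction_on with
  | empty => 
    refine ⟨by simpa using continuousOn_const, 0, fun y hy => by simp⟩
  | insert i s hi ih =>
    simp only [Finset.sum_insert hi]
    exact (h i (Finset.mem_insert_self i s)).add
      (ih (fun j hj => h j (Finset.mem_insert_of_mem hj)))

lemma wt_add (κ κ' : ℤ) {y : ℝ} (hy : y ∈ Ioo (-1:ℝ) 1) : wt (κ + κ') y = wt κ y * wt κ' y := by
  rw [wt, wt, wt, zpow_add₀ (one_sub_pos hy).ne']

/-- weighted bound for products -/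
lemma wt_prod {i j n m N : ℕ} (hN : m + n = N) {r y : ℝ} (hy : y ∈ Ioo (-1:ℝ) 1) :
    wt (S.κ + N) y * ‖S.c i m r y * S.G j n r y‖ ^ 2 =
      (wt (0 + m) y * ‖S.c i m r y‖ ^ 2) * (wt (S.κ + n) y * ‖S.G j n r y‖ ^ 2) := by
  have : (S.κ + N : ℤ) = (0 + m) + (S.κ + n) := by rw [← hN]; push_cast; ring
  rw [this, wt_add _ _ hy, norm_mul]; ring

lemma wb_cG (i n : ℕ) {r : ℝ} (hr : S.ra < r) : WB (S.κ + n) (S.cG i n r) := by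
  refine wb_sum _ (fun p _ => WB.cmul (wb_sum _ (fun q hq => WB.cmul ?_ _)) _)
  obtain ⟨A, C, _, _, hA⟩ := S.ac r r hr
  obtain ⟨M, hM⟩ := S.wG p.2 q.2 r r hr
  refine ⟨(cont_y S.jc _ _ hr).mul (cont_y S.jG _ _ hr),
    (A * C ^ (p.1 + q.1) * p.1.factorial * q.1.factorial) ^ 2 * M, fun y hy => ?_⟩
  rw [S.wt_prod (Finset.HasAntidiagonal.mem_antidiagonal.1 hq) hy]
  have h1 := hA p.1 q.1 r ⟨le_rfl, le_rfl⟩ y hy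
  have h2 := hM r ⟨le_rfl, le_rfl⟩ y hy
  have h3 : 0 ≤ wt (S.κ + q.2) y * ‖S.G p.2 q.2 r y‖ ^ 2 :=
    mul_nonneg (wt_pos _ hy).le (sq_nonneg _)
  exact mul_le_mul h1 h2 h3 (sq_nonneg _)

lemma wb_hh (i n : ℕ) {r : ℝ} (hr : S.ra < r) : WB (S.κ + n) (S.hh i n r) :=
  (((S.wbf i n hr).sub (S.wb_cG i n hr)).sub ((S.wbG i n hr).cmul _)).sub ((S.wbG (i-1) n hr).cmul _)

lemma L_eq (i n : ℕ) {r y : ℝ} (hr : S.ra < r) (hy : y ∈ Ioo (-1:ℝ) 1) :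
    S.L i n r y = (S.hh i n r y - (S.mu r : ℂ) * S.G (i+2) n r y) -
      (((i + 1) * S.mu' r : ℝ) + S.b r) * S.G (i+1) n r y := by
  rw [← S.pde_all i n r y hr hy]; ring

lemma wb_L (i n : ℕ) {r : ℝ} (hr : S.ra < r) : WB (S.κ + n) (S.L i n r) :=
  (((S.wb_hh i n hr).sub ((S.wbG (i+2) n hr).cmul _)).sub ((S.wbG (i+1) n hr).cmul _)).congr
    (fun _ hy => S.L_eq i n hr hy)

lemma ibp (i j n : ℕ) {r : ℝ} (hr : S.ra < r) :
    Bf (S.κ + n) (S.L i n r) (S.G j n r) =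
      - Bf (S.κ + (n+1 : ℕ)) (S.G i (n+1) r) (S.G j (n+1) r)
      - S.lam n * Bf (S.κ + n) (S.G i n r) (S.G j n r) := by
  have e : (S.κ + (n+1 : ℕ) : ℤ) = (S.κ + n) + 1 := by push_cast; ring
  have w1 := S.wbG i (n+1) hr
  have w2 := S.wbG j (n+1) hr
  rw [e] at w1 w2 ⊢
  refine Bf_ibp (g2 := S.G i (n+2) r) (fun y hy => S.jG.dy _ _ _ _ hr hy)
    (fun y hy => S.jG.dy _ _ _ _ hr hy) (fun y hy => ?_) (S.wbG i n hr) w1 (S.wb_L i n hr)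
    (S.wbG j n hr) w2
  rfl

lemma Bf_deriv (i j n : ℕ) {r : ℝ} (hr : S.ra < r) :
    HasDerivAt (fun r => Bf (S.κ + n) (S.G i n r) (S.G j n r))
      (Bf (S.κ + n) (S.G (i+1) n r) (S.G j n r) + Bf (S.κ + n) (S.G i n r) (S.G (j+1) n r)) r := by
  let ε := (r - S.ra) / 2
  have hε : 0 < ε := by simp only [ε]; linarith
  have hα : S.ra < r - ε := by simp only [ε]; linarith
  obtain ⟨M1, h1⟩ := S.wG i n (r - ε) (r + ε) hα
  obtain ⟨M2, h2⟩ := S.wG (i+1) n (r - ε) (r + ε) hα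
  obtain ⟨M3, h3⟩ := S.wG j n (r - ε) (r + ε) hα
  obtain ⟨M4, h4⟩ := S.wG (j+1) n (r - ε) (r + ε) hα
  have hm : ∀ s, |s - r| < ε → s ∈ Icc (r - ε) (r + ε) := fun s hs => by
    rw [abs_lt] at hs; constructor <;> linarith [hs.1, hs.2]
  have hra : ∀ s, |s - r| < ε → S.ra < s := fun s hs => hα.trans_le (hm s hs).1
  let M := max (max M1 M2) (max M3 M4)
  have m1 : M1 ≤ M := (le_max_left _ _).trans (le_max_left _ _)
  have m2 : M2 ≤ M := (le_max_right _ _).trans (le_max_left _ _)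
  have m3 : M3 ≤ M := (le_max_left _ _).trans (le_max_right _ _)
  have m4 : M4 ≤ M := (le_max_right _ _).trans (le_max_right _ _)
  refine Bf_hasDeriv (M := M) (P' := S.G (i+1) n) (Q' := S.G (j+1) n) hε
    (fun s hs => cont_y S.jG _ _ (hra s hs)) (fun s hs => cont_y S.jG _ _ (hra s hs))
    (fun s hs => cont_y S.jG _ _ (hra s hs)) (fun s hs => cont_y S.jG _ _ (hra s hs))
    (fun s hs y hy => (h1 s (hm s hs) y hy).trans m1) (fun s hs y hy => (h2 s (hm s hs) y hy).trans m2)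
    (fun s hs y hy => (h3 s (hm s hs) y hy).trans m3) (fun s hs y hy => (h4 s (hm s hs) y hy).trans m4)
    (fun s hs y hy => S.jG.dr _ _ _ _ (hra s hs) hy) (fun s hs y hy => S.jG.dr _ _ _ _ (hra s hs) hy)

lemma a_deriv (i n : ℕ) {r : ℝ} (hr : S.ra < r) : HasDerivAt (S.a i n) (2 * S.X i n r) r := by
  refine (S.Bf_deriv i i n hr).congr_deriv ?_
  rw [Bf_comm (S.G i n r)]; unfold X; ring

lemma a_cont (i n : ℕ) : ContinuousOn (S.a i n) (Ioi S.ra) := fun _ hr =>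
  (S.a_deriv i n hr).continuousAt.continuousWithinAt

lemma ah_cont (i n : ℕ) : ContinuousOn (S.ah i n) (Ioi S.ra) := (S.a_cont i n).div_const _

lemma a_deriv_le (i n : ℕ) {r : ℝ} (hr : S.ra < r) : |2 * S.X i n r| ≤ S.a i n r + S.a (i+1) n r := by
  have h := Bf_young (S.wbG (i+1) n hr) (S.wbG i n hr) (ε := 1/2) (by norm_num)
  rw [abs_mul]
  unfold X a
  norm_num at h ⊢
  linarith

lemma muG (i j n : ℕ) {r : ℝ} (hr : S.ra < r) :
    S.mu r * Bf (S.κ + n) (S.G (i+2) n r) (S.G j n r) = Bf (S.κ + n) (S.hh i n r) (S.G j n r)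
      - Bf (S.κ + n) (fun y => (((i + 1) * S.mu' r : ℝ) + S.b r) * S.G (i+1) n r y) (S.G j n r)
      - Bf (S.κ + n) (S.L i n r) (S.G j n r) := by
  rw [← Bf_rmul, ← Bf_sub (S.wb_hh i n hr) ((S.wbG (i+1) n hr).cmul _) (S.wbG j n hr),
    ← Bf_sub ((S.wb_hh i n hr).sub ((S.wbG (i+1) n hr).cmul _)) (S.wb_L i n hr) (S.wbG j n hr)]
  refine Bf_congr (fun y hy => ?_) (fun _ _ => rfl)
  rw [← S.pde_all i n r y hr hy]; ring

lemma J_deriv (i n : ℕ) {r : ℝ} (hr : S.ra < r) :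
    HasDerivAt (fun r => S.mu r * S.X i n r)
      (S.mu r * S.a (i+1) n r + S.a i (n+1) r + S.lam n * S.a i n r
        + Bf (S.κ + n) (S.hh i n r) (S.G i n r)
        - Bf (S.κ + n) (fun y => ((i * S.mu' r : ℝ) + S.b r) * S.G (i+1) n r y) (S.G i n r)) r := by
  refine ((S.mu_deriv r).mul (S.Bf_deriv (i+1) i n hr)).congr_deriv ?_
  have h1 := S.muG i i n hr
  rw [S.ibp i i n hr] at h1
  have h2 : Bf (S.κ + n) (fun y => (((i + 1) * S.mu' r : ℝ) + S.b r) * S.G (i+1) n r y) (S.G i n r)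
      = Bf (S.κ + n) (fun y => ((i * S.mu' r : ℝ) + S.b r) * S.G (i+1) n r y) (S.G i n r)
        + S.mu' r * Bf (S.κ + n) (S.G (i+1) n r) (S.G i n r) := by
    rw [← Bf_rmul, ← Bf_add ((S.wbG (i+1) n hr).cmul _) ((S.wbG (i+1) n hr).cmul _) (S.wbG i n hr)]
    refine Bf_congr (fun y hy => ?_) (fun _ _ => rfl)
    push_cast; ring
  rw [h2] at h1
  simp only [a]
  linear_combination h1

def e (i n : ℕ) (r : ℝ) : ℝ := S.a i (n+1) r + S.lam n * S.a i n r - S.mu r * S.a (i+1) n r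

lemma e_deriv (i n : ℕ) {r : ℝ} (hr : S.ra < r) :
    HasDerivAt (S.e i n) (((2 * i + 1) * S.mu' r + 2 * (S.b r).re) * S.a (i+1) n r
      - 2 * Bf (S.κ + n) (S.hh i n r) (S.G (i+1) n r)) r := by
  refine (((S.a_deriv i (n+1) hr).add ((S.a_deriv i n hr).const_mul (S.lam n))).sub
    ((S.mu_deriv r).mul (S.a_deriv (i+1) n hr))).congr_deriv ?_
  have h1 := S.muG i (i+1) n hr
  rw [S.ibp i (i+1) n hr, Bf_cself] at h1
  simp only [X, a]
  rw [Bf_comm (S.G i n r), Bf_comm (S.G i (n+1) r)] at h1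
  simp at h1
  push_cast
  linear_combination (-2) * h1

/-! bound for `H` -/

lemma half_sum (n : ℕ) : ∑ q ∈ ad n, ((1:ℝ)/2) ^ q.1 ≤ 2 := by
  have : ∑ q ∈ ad n, ((1:ℝ)/2) ^ q.1 = ∑ k ∈ Finset.range (n+1), ((1:ℝ)/2)^k :=
    Finset.Nat.sum_antidiagonal_eq_sum_range_succ_mk (fun q : ℕ × ℕ => ((1:ℝ)/2) ^ q.1) n
  rw [this]
  have := (summable_geometric_two).sum_le_tsum (Finset.range (n+1)) (fun _ _ => by positivity)
  rwa [tsum_geometric_two] at this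

lemma choose_fact {n : ℕ} {q : ℕ × ℕ} (hq : q ∈ ad n) :
    (n.choose q.1 : ℝ) * q.1.factorial = n.factorial / q.2.factorial := by
  have h := Finset.HasAntidiagonal.mem_antidiagonal.1 hq
  have h2 := Nat.add_choose_mul_factorial_mul_factorial q.1 q.2
  rw [h, show n.choose q.2 = n.choose q.1 by rw [← h]; exact Nat.choose_symm_add.symm] at h2
  have : (0:ℝ) < q.2.factorial := by positivity
  rw [eq_div_iff this.ne']
  exact_mod_cast h2

lemma cG_pt {A C : ℝ} (hA : 0 ≤ A) (hC : 1 ≤ C) {r : ℝ}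
    (hc : ∀ (i n : ℕ), ∀ y ∈ Ioo (-1:ℝ) 1,
      wt (0 + n) y * ‖S.c i n r y‖ ^ 2 ≤ (A * C ^ (i + n) * i.factorial * n.factorial) ^ 2)
    (i n : ℕ) {y : ℝ} (hy : y ∈ Ioo (-1:ℝ) 1) :
    wt (S.κ + n) y * ‖S.cG i n r y‖ ^ 2 ≤ 
      (2 * (i + 1) * (A * i.factorial * C ^ i) ^ 2 * (n.factorial : ℝ) ^ 2) * 
      ∑ p ∈ ad i, ∑ q ∈ ad n, (2 * C ^ 2) ^ q.1 * ((wt (S.κ + q.2) y * ‖S.G p.2 q.2 r y‖ ^ 2)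
        / (q.2.factorial : ℝ) ^ 2) := by
  let x : (ℕ × ℕ) × (ℕ × ℕ) → ℝ := fun z => (i.choose z.1.1 : ℝ) * ((n.choose z.2.1 : ℝ) *
    ‖S.c z.1.1 z.2.1 r y * S.G z.1.2 z.2.2 r y‖)
  have h1 : ‖S.cG i n r y‖ ≤ ∑ z ∈ ad i ×ˢ ad n, x z := by
    rw [Finset.sum_product]
    refine (norm_sum_le _ _).trans (Finset.sum_le_sum (fun p _ => ?_))
    show _ ≤ ∑ q ∈ ad n, (i.choose p.1 : ℝ) * ((n.choose q.1 : ℝ) *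
      ‖S.c p.1 q.1 r y * S.G p.2 q.2 r y‖)
    rw [norm_mul, Complex.norm_natCast, ← Finset.mul_sum]
    refine mul_le_mul_of_nonneg_left ?_ (by positivity)
    refine (norm_sum_le _ _).trans (Finset.sum_le_sum (fun q _ => ?_))
    rw [norm_mul, Complex.norm_natCast]
  have h2 : (∑ z ∈ ad i ×ˢ ad n, x z) ^ 2 ≤ (∑ z ∈ ad i ×ˢ ad n, ((1:ℝ)/2) ^ z.2.1) *
      ∑ z ∈ ad i ×ˢ ad n, 2 ^ z.2.1 * x z ^ 2 := by
    refine Finset.sum_sq_le_sum_mul_sum_of_sq_le_mul _ (fun _ _ => by positivity)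
      (fun _ _ => by positivity) (fun z _ => ?_)
    rw [← mul_assoc, ← mul_pow]; norm_num [le_refl]
  have h3 : ∑ z ∈ ad i ×ˢ ad n, ((1:ℝ)/2) ^ z.2.1 ≤ 2 * (i + 1) := by
    rw [Finset.sum_product]
    refine (Finset.sum_le_card_nsmul _ _ 2 (fun p _ => half_sum n)).trans (le_of_eq ?_)
    simp; ring
  have hw := wt_pos (S.κ + n) hy
  have h4 : wt (S.κ + n) y * ‖S.cG i n r y‖ ^ 2 ≤ (2 * (i + 1)) * 
      ∑ z ∈ ad i ×ˢ ad n, 2 ^ z.2.1 * (wt (S.κ + n) y * x z ^ 2) := by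
    have h5 : ‖S.cG i n r y‖ ^ 2 ≤ (2 * (i + 1)) * ∑ z ∈ ad i ×ˢ ad n, 2 ^ z.2.1 * x z ^ 2 := by
      refine (pow_le_pow_left₀ (norm_nonneg _) h1 2).trans (h2.trans ?_)
      exact mul_le_mul_of_nonneg_right h3 (Finset.sum_nonneg (fun _ _ => by positivity))
    refine (mul_le_mul_of_nonneg_left h5 hw.le).trans (le_of_eq ?_)
    rw [Finset.mul_sum, Finset.mul_sum, Finset.mul_sum]
    refine Finset.sum_congr rfl (fun z _ => by ring)
  refine h4.trans ?_
  rw [mul_assoc (2 * ((i:ℝ) + 1)), mul_assoc (2 * ((i:ℝ) + 1)), Finset.sum_product]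
  refine mul_le_mul_of_nonneg_left ?_ (by positivity)
  rw [Finset.mul_sum]
  refine Finset.sum_le_sum (fun p hp => ?_)
  rw [Finset.mul_sum]
  refine Finset.sum_le_sum (fun q hq => ?_)
  have hq' := Finset.HasAntidiagonal.mem_antidiagonal.1 hq
  have hp' := Finset.HasAntidiagonal.mem_antidiagonal.1 hp
  have h5 := S.wt_prod (i := p.1) (j := p.2) hq' (r := r) hy
  have h6 : wt (S.κ + n) y * x (p, q) ^ 2 = ((i.choose p.1 : ℝ) * (n.choose q.1 : ℝ)) ^ 2 *
      ((wt (0 + q.1) y * ‖S.c p.1 q.1 r y‖ ^ 2) * (wt (S.κ + q.2) y * ‖S.G p.2 q.2 r y‖ ^ 2)) := by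
    rw [← h5]; simp only [x]; ring
  rw [h6]
  have h7 : 0 ≤ wt (S.κ + q.2) y * ‖S.G p.2 q.2 r y‖ ^ 2 :=
    mul_nonneg (wt_pos _ hy).le (sq_nonneg _)
  have hip : (i.choose p.1 : ℝ) * p.1.factorial ≤ i.factorial := by
    rw [choose_fact hp]
    refine div_le_self (by positivity) ?_
    exact_mod_cast Nat.one_le_iff_ne_zero.2 (Nat.factorial_ne_zero _)
  calc 2 ^ q.1 * (((i.choose p.1 : ℝ) * (n.choose q.1 : ℝ)) ^ 2 *
      ((wt (0 + q.1) y * ‖S.c p.1 q.1 r y‖ ^ 2) * (wt (S.κ + q.2) y * ‖S.G p.2 q.2 r y‖ ^ 2)))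
      ≤ 2 ^ q.1 * (((i.choose p.1 : ℝ) * (n.choose q.1 : ℝ)) ^ 2 *
      ((A * C ^ (p.1 + q.1) * p.1.factorial * q.1.factorial) ^ 2 *
        (wt (S.κ + q.2) y * ‖S.G p.2 q.2 r y‖ ^ 2))) := by
        gcongr; exact hc p.1 q.1 y hy
    _ = 2 ^ q.1 * ((A * C ^ p.1 * C ^ q.1 * ((i.choose p.1 : ℝ) * p.1.factorial) *
        ((n.choose q.1 : ℝ) * q.1.factorial)) ^ 2 *
        (wt (S.κ + q.2) y * ‖S.G p.2 q.2 r y‖ ^ 2)) := by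
        rw [pow_add]; ring
    _ ≤ 2 ^ q.1 * ((A * C ^ i * C ^ q.1 * (i.factorial) *
        ((n.choose q.1 : ℝ) * q.1.factorial)) ^ 2 *
        (wt (S.κ + q.2) y * ‖S.G p.2 q.2 r y‖ ^ 2)) := by
        gcongr
        omega
    _ = _ := by
        rw [choose_fact hq, mul_pow 2 (C ^ 2), ← pow_mul, mul_comm 2 q.1, pow_mul]
        field_simp

end Sys
end KerrAux
end

section
namespace KerrAux
open MeasureTheory

lemma Bf_quad {κ : ℤ} {P Q : ℝ → ℂ} (hP : WB κ P) (hQ : WB κ Q) (s t : ℝ) :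
    2 * s * t * Bf κ P Q ≤ s ^ 2 * Bf κ P P + t ^ 2 * Bf κ Q Q := by
  have h0 := Bf_nonneg (κ := κ) (fun y => (s:ℂ) * P y - (t:ℂ) * Q y)
  have hs := hP.cmul (s:ℂ)
  have ht := hQ.cmul (t:ℂ)
  rw [Bf_sub hs ht (hs.sub ht), Bf_comm (fun y => (s:ℂ) * P y), Bf_comm (fun y => (t:ℂ) * Q y),
    Bf_sub hs ht hs, Bf_sub hs ht ht] at h0
  rw [Bf_rmul, Bf_rmul, Bf_rmul, Bf_rmul, Bf_comm P (fun y => (s:ℂ) * P y),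
    Bf_comm Q (fun y => (s:ℂ) * P y), Bf_comm P (fun y => (t:ℂ) * Q y),
    Bf_comm Q (fun y => (t:ℂ) * Q y), Bf_rmul, Bf_rmul, Bf_rmul, Bf_rmul, Bf_comm Q P] at h0
  linarith

lemma Bf_cc {κ : ℤ} (P : ℝ → ℂ) (c : ℂ) :
    Bf κ (fun y => c * P y) (fun y => c * P y) = ‖c‖ ^ 2 * Bf κ P P := by
  rw [Bf_self, Bf_self, ← integral_const_mul]
  congr 1; funext y; rw [norm_mul]; ring

/-- geometric bound -/
def GB (T : ℕ → ℝ) : Prop := ∃ A C : ℝ, 0 ≤ A ∧ 1 ≤ C ∧ ∀ n, T n ≤ A * C ^ n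

lemma GB.mono {T U : ℕ → ℝ} (h : GB U) (hT : ∀ n, T n ≤ U n) : GB T := by
  obtain ⟨A, C, h1, h2, h3⟩ := h
  exact ⟨A, C, h1, h2, fun n => (hT n).trans (h3 n)⟩

lemma GB.add {T U : ℕ → ℝ} (hT : GB T) (hU : GB U) : GB (fun n => T n + U n) := by
  obtain ⟨A, C, h1, h2, h3⟩ := hT
  obtain ⟨A', C', h1', h2', h3'⟩ := hU
  refine ⟨A + A', max C C', by positivity, h2.trans (le_max_left _ _), fun n => ?_⟩
  rw [add_mul]
  refine add_le_add ((h3 n).trans ?_) ((h3' n).trans ?_)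
  · gcongr; exact le_max_left _ _
  · gcongr; exact le_max_right _ _

lemma GB.mul {T U : ℕ → ℝ} (hT : GB T) (hU : GB U) (h0 : ∀ n, 0 ≤ U n) : GB (fun n => T n * U n) := by
  obtain ⟨A, C, h1, h2, h3⟩ := hT
  obtain ⟨A', C', h1', h2', h3'⟩ := hU
  refine ⟨A * A', C * C', by positivity, one_le_mul_of_one_le_of_one_le h2 h2', fun n => ?_⟩
  calc T n * U n ≤ (A * C ^ n) * U n := mul_le_mul_of_nonneg_right (h3 n) (h0 n)
    _ ≤ (A * C ^ n) * (A' * C' ^ n) := mul_le_mul_of_nonneg_left (h3' n) (by positivity)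
    _ = _ := by rw [mul_pow]; ring

lemma gb_const (c : ℝ) : GB (fun _ => c) := ⟨|c|, 1, abs_nonneg c, le_rfl, fun n => by
  simpa using le_abs_self c⟩

lemma gb_pow (K : ℝ) : GB (fun n => K ^ n) := ⟨1, |K| + 1, zero_le_one, by
  linarith [abs_nonneg K], fun n => by
  rw [one_mul]
  refine (le_abs_self _).trans ?_
  rw [abs_pow]
  exact pow_le_pow_left₀ (abs_nonneg _) (by linarith) n⟩

lemma gb_succ : GB (fun n => (n:ℝ) + 1) := ⟨1, 2, zero_le_one, by norm_num, fun n => by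
  have h : n + 1 ≤ 2 ^ n := Nat.lt_two_pow_self (n := n)
  show (n:ℝ) + 1 ≤ _
  rw [one_mul]
  exact_mod_cast h⟩

lemma GB.cmul {T : ℕ → ℝ} (hT : GB T) {c : ℝ} (hc : 0 ≤ c) : GB (fun n => c * T n) :=
  (hT.mul (gb_const c) (fun _ => hc)).mono (fun n => by rw [mul_comm])

lemma GB.shift {T : ℕ → ℝ} (hT : GB T) : GB (fun n => T (n+1)) := by
  obtain ⟨A, C, h1, h2, h3⟩ := hT
  exact ⟨A * C, C, by positivity, h2, fun n => (h3 (n+1)).trans (le_of_eq (by ring))⟩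

lemma GB.unshift {T : ℕ → ℝ} (hT : GB (fun n => T (n+1))) : GB T := by
  obtain ⟨A, C, h1, h2, h3⟩ := hT
  refine ⟨A + |T 0|, C, by positivity, h2, fun n => ?_⟩
  have hC : 0 ≤ C := by linarith
  rcases n with _ | n
  · simp; linarith [le_abs_self (T 0)]
  · refine (h3 n).trans ?_
    have : A * C ^ n ≤ A * C ^ (n+1) := by
      gcongr
      omega
    have : 0 ≤ |T 0| * C ^ (n+1) := by positivity
    nlinarith

lemma gb_sum {ι : Type*} (s : Finset ι) {T : ι → ℕ → ℝ} (h : ∀ i ∈ s, GB (T i)) :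
    GB (fun n => ∑ i ∈ s, T i n) := by
  classical
  induction s using Finset.induction_on with
  | empty => simpa using gb_const 0
  | insert i s hi ih =>
    simp only [Finset.sum_insert hi]
    exact (h i (Finset.mem_insert_self i s)).add (ih (fun j hj => h j (Finset.mem_insert_of_mem hj)))

lemma gb_conv {T : ℕ → ℝ} (hT : GB T) {K : ℝ} (hK : 0 ≤ K) :
    GB (fun n => ∑ q ∈ ad n, K ^ q.1 * T q.2) := by
  obtain ⟨A, C, h1, h2, h3⟩ := hT
  have hC : 0 ≤ C := by linarith
  refine GB.mono (U := fun n => (n + 1) * (A * (max K C) ^ n)) ?_ (fun n => ?_)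
  · exact gb_succ.mul ((gb_pow _).cmul h1) (fun n => by positivity)
  · refine (Finset.sum_le_card_nsmul _ _ (A * (max K C) ^ n) (fun q hq => ?_)).trans (le_of_eq ?_)
    · have hq' := Finset.HasAntidiagonal.mem_antidiagonal.1 hq
      calc K ^ q.1 * T q.2 ≤ K ^ q.1 * (A * C ^ q.2) := by gcongr; exact h3 _
        _ ≤ (max K C) ^ q.1 * (A * (max K C) ^ q.2) := by
          gcongr
          · exact le_max_left _ _
          · exact le_max_right _ _
        _ = A * (max K C) ^ n := by rw [← hq', pow_add]; ring
    · simp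

lemma gb_seq {T : ℕ → ℝ} (h0 : ∀ n, 0 ≤ T n) {K M : ℝ} (hK : 1 ≤ K) (hM : 0 ≤ M)
    {U : ℕ → ℝ} (hU : GB U)
    (h : ∀ n, T (n+1) ≤ U n + M * ∑ q ∈ ad n, K ^ q.1 * T q.2) : GB T := by
  obtain ⟨A, C, h1, h2, h3⟩ := hU
  let K' := max K C
  have hK' : 1 ≤ K' := hK.trans (le_max_left _ _)
  let s : ℕ → ℝ := fun n => A * K' ^ n + ∑ q ∈ ad n, K' ^ q.1 * T q.2
  have hTs : ∀ n, T n ≤ s n := by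
    intro n
    have : K' ^ ((0:ℕ), n).1 * T ((0:ℕ), n).2 ≤ ∑ q ∈ ad n, K' ^ q.1 * T q.2 :=
      Finset.single_le_sum (f := fun q : ℕ × ℕ => K' ^ q.1 * T q.2)
        (fun q _ => mul_nonneg (by positivity) (h0 _)) (by simp)
    simp at this
    have : 0 ≤ A * K' ^ n := by positivity
    simp only [s]; linarith
  have hsn : ∀ n, s (n+1) ≤ (K' + (1 + M)) * s n := by
    intro n
    have e1 : s (n+1) = K' * s n + T (n+1) := by
      simp only [s]
      have := Finset.Nat.sum_antidiagonal_succ (n := n) (f := fun q : ℕ × ℕ => K' ^ q.1 * T q.2)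
      rw [this, mul_add, Finset.mul_sum]
      have : ∀ q : ℕ × ℕ, K' ^ (q.1 + 1) * T q.2 = K' * (K' ^ q.1 * T q.2) := fun q => by ring
      simp only [this, pow_zero]
      ring
    have hsum : ∑ q ∈ ad n, K ^ q.1 * T q.2 ≤ ∑ q ∈ ad n, K' ^ q.1 * T q.2 := by
      refine Finset.sum_le_sum (fun q _ => ?_)
      have := h0 q.2
      gcongr
      exact le_max_left _ _
    have hU' : U n ≤ A * K' ^ n := by
      refine (h3 n).trans ?_
      gcongr; exact le_max_right _ _
    have hp : 0 ≤ ∑ q ∈ ad n, K' ^ q.1 * T q.2 :=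
      Finset.sum_nonneg (fun q _ => mul_nonneg (by positivity) (h0 _))
    have hp' : 0 ≤ A * K' ^ n := by positivity
    have := h n
    have h5 := mul_le_mul_of_nonneg_left hsum hM
    have h6 : 0 ≤ M * (A * K' ^ n) := by positivity
    rw [e1]
    simp only [s]
    nlinarith
  refine ⟨s 0, K' + (1 + M), (h0 0).trans (hTs 0), by linarith, fun n => (hTs n).trans ?_⟩
  induction n with
  | zero => simp
  | succ n ih =>
    refine (hsn n).trans ?_
    rw [pow_succ]
    have := mul_le_mul_of_nonneg_left ih (by linarith : 0 ≤ K' + (1 + M))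
    linarith

lemma ftc_le {Φ Φ' φ : ℝ → ℝ} {a b : ℝ} (hab : a ≤ b)
    (hd : ∀ x ∈ Icc a b, HasDerivAt Φ (Φ' x) x) (hφ : ContinuousOn φ (Icc a b))
    (h : ∀ x ∈ Icc a b, φ x ≤ Φ' x) : ∫ x in a..b, φ x ≤ Φ b - Φ a := by
  refine intervalIntegral.integral_le_sub_of_hasDeriv_right_of_le hab
    (fun x hx => (hd x hx).continuousAt.continuousWithinAt)
    (fun x hx => (hd x (Ioo_subset_Icc_self hx)).hasDerivWithinAt) hφ.integrableOn_Icc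
    (fun x hx => h x (Ioo_subset_Icc_self hx))

lemma ii_const (c a b : ℝ) : IntervalIntegrable (fun _ : ℝ => c) volume a b :=
  continuous_const.intervalIntegrable a b

/-- averaging lemma -/
lemma avg_le {Φ Φ' ψ : ℝ → ℝ} {a b : ℝ} (hab : a ≤ b)
    (hd : ∀ x ∈ Icc a b, HasDerivAt Φ (Φ' x) x) (hψ : ContinuousOn ψ (Icc a b))
    (h : ∀ x ∈ Icc a b, |Φ' x| ≤ ψ x) {x : ℝ} (hx : x ∈ Icc a b) :
    (b - a) * Φ x ≤ (∫ s in a..b, Φ s) + (b - a) * ∫ s in a..b, ψ s := by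
  have hΦ : ContinuousOn Φ (Icc a b) := fun x hx => (hd x hx).continuousAt.continuousWithinAt
  have hψ0 : ∀ s ∈ Icc a b, 0 ≤ ψ s := fun s hs => (abs_nonneg _).trans (h s hs)
  have key : ∀ s ∈ Icc a b, Φ x - (∫ s in a..b, ψ s) ≤ Φ s := by
    intro s hs
    have hmono : ∀ c d, a ≤ c → c ≤ d → d ≤ b → ∫ s in c..d, ψ s ≤ ∫ s in a..b, ψ s := by
      intro c d h1 h2 h3
      refine intervalIntegral.integral_mono_interval h1 h2 h3 ?_
        (hψ.intervalIntegrable_of_Icc hab)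
      filter_upwards [ae_restrict_mem measurableSet_Ioc] with z hz
      exact hψ0 z ⟨hz.1.le, hz.2⟩
    rcases le_total s x with hsx | hsx
    · have h1 : ∫ z in s..x, -ψ z ≤ -Φ x - -Φ s := ftc_le (Φ := fun z => - Φ z) hsx
        (fun z hz => (hd z ⟨hs.1.trans hz.1, hz.2.trans hx.2⟩).neg)
        ((hψ.mono (Icc_subset_Icc hs.1 hx.2)).neg)
        (fun z hz => by
          have := h z ⟨hs.1.trans hz.1, hz.2.trans hx.2⟩
          linarith [le_abs_self (Φ' z)])
      rw [intervalIntegral.integral_neg] at h1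
      have := hmono s x hs.1 hsx hx.2
      linarith
    · have h1 : ∫ z in x..s, -ψ z ≤ Φ s - Φ x := ftc_le hsx
        (fun z hz => (hd z ⟨hx.1.trans hz.1, hz.2.trans hs.2⟩))
        ((hψ.mono (Icc_subset_Icc hx.1 hs.2)).neg)
        (fun z hz => by
          have := h z ⟨hx.1.trans hz.1, hz.2.trans hs.2⟩
          linarith [neg_abs_le (Φ' z)])
      rw [intervalIntegral.integral_neg] at h1
      have := hmono x s hx.1 hsx hs.2
      linarith
  have h2 := intervalIntegral.integral_mono_on hab (f := fun _ => Φ x - (∫ s in a..b, ψ s))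
    (g := Φ) (ii_const _ _ _) (hΦ.intervalIntegrable_of_Icc hab) key
  rw [intervalIntegral.integral_const, smul_eq_mul] at h2
  linarith

namespace Sys
variable (S : Sys)

lemma Sg_mono {K K' : ℝ} (hK : 0 ≤ K) (h : K ≤ K') (i n : ℕ) (r : ℝ) : S.Sg K i n r ≤ S.Sg K' i n r := by
  refine Finset.sum_le_sum (fun p _ => Finset.sum_le_sum (fun q _ => ?_))
  have := S.ah_nonneg p.2 q.2 r
  gcongr

lemma Sg_nonneg {K : ℝ} (hK : 0 ≤ K) (i n : ℕ) (r : ℝ) : 0 ≤ S.Sg K i n r := by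
  refine Finset.sum_nonneg (fun p _ => Finset.sum_nonneg (fun q _ => ?_))
  have := S.ah_nonneg p.2 q.2 r
  positivity

lemma ah_le_Sg {K : ℝ} (hK : 0 ≤ K) {i j : ℕ} (hj : j ≤ i) (n : ℕ) (r : ℝ) :
    S.ah j n r ≤ S.Sg K i n r := by
  have h1 : ∑ q ∈ ad n, K ^ q.1 * S.ah (i - j, j).2 q.2 r ≤ S.Sg K i n r :=
    Finset.single_le_sum (f := fun p : ℕ × ℕ => ∑ q ∈ ad n, K ^ q.1 * S.ah p.2 q.2 r)
      (fun p _ => Finset.sum_nonneg (fun q _ => mul_nonneg (by positivity) (S.ah_nonneg _ _ _)))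
      (by simp; omega)
  have h2 : K ^ ((0:ℕ), n).1 * S.ah j ((0:ℕ), n).2 r ≤ ∑ q ∈ ad n, K ^ q.1 * S.ah j q.2 r :=
    Finset.single_le_sum (f := fun q : ℕ × ℕ => K ^ q.1 * S.ah j q.2 r)
      (fun q _ => mul_nonneg (by positivity) (S.ah_nonneg _ _ _)) (by simp)
  simp at h2
  exact h2.trans h1

lemma a_eq (i n : ℕ) (r : ℝ) : S.a i n r = (n.factorial : ℝ) ^ 2 * S.ah i n r := by
  unfold ah; field_simp

lemma hh_pt (x y z w : ℂ) : ‖x - y - z - w‖ ^ 2 ≤ 4 * (‖x‖ ^ 2 + ‖y‖ ^ 2 + ‖z‖ ^ 2 + ‖w‖ ^ 2) := by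
  have h1 : ‖x - y - z - w‖ ≤ ‖x‖ + ‖y‖ + ‖z‖ + ‖w‖ := by
    refine (norm_sub_le _ _).trans ?_
    gcongr
    refine (norm_sub_le _ _).trans ?_
    gcongr
    exact norm_sub_le _ _
  refine (pow_le_pow_left₀ (norm_nonneg _) h1 2).trans ?_
  nlinarith [sq_nonneg (‖x‖ - ‖y‖), sq_nonneg (‖x‖ - ‖z‖), sq_nonneg (‖x‖ - ‖w‖),
    sq_nonneg (‖y‖ - ‖z‖), sq_nonneg (‖y‖ - ‖w‖), sq_nonneg (‖z‖ - ‖w‖)]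

lemma Sg_int {K : ℝ} (i n : ℕ) {r : ℝ} (hr : S.ra < r) :
    IntegrableOn (fun y => ∑ p ∈ ad i, ∑ q ∈ ad n, K ^ q.1 *
      ((wt (S.κ + q.2) y * ‖S.G p.2 q.2 r y‖ ^ 2) / (q.2.factorial : ℝ) ^ 2)) (Ioo (-1:ℝ) 1) ∧
    ∫ y in Ioo (-1:ℝ) 1, (∑ p ∈ ad i, ∑ q ∈ ad n, K ^ q.1 *
      ((wt (S.κ + q.2) y * ‖S.G p.2 q.2 r y‖ ^ 2) / (q.2.factorial : ℝ) ^ 2)) = S.Sg K i n r := by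
  have h1 : ∀ (p q : ℕ × ℕ), Integrable (fun y => K ^ q.1 *
      ((wt (S.κ + q.2) y * ‖S.G p.2 q.2 r y‖ ^ 2) / (q.2.factorial : ℝ) ^ 2))
      (volume.restrict (Ioo (-1:ℝ) 1)) := fun p q =>
    ((Bf_self_int (S.wbG p.2 q.2 hr)).div_const _).const_mul _
  constructor
  · exact integrable_finsetSum _ (fun p _ => integrable_finsetSum _ (fun q _ => h1 p q))
  · rw [integral_finsetSum _ (fun p _ => integrable_finsetSum _ (fun q _ => h1 p q))]
    refine Finset.sum_congr rfl (fun p _ => ?_)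
    rw [integral_finsetSum _ (fun q _ => h1 p q)]
    refine Finset.sum_congr rfl (fun q _ => ?_)
    rw [integral_const_mul, integral_div, ← Bf_self]
    rfl

lemma H_bound (i : ℕ) {α β : ℝ} (hα : S.ra < α) : ∃ C K : ℝ, 0 ≤ C ∧ 1 ≤ K ∧ ∀ n, ∀ r ∈ Icc α β,
    S.H i n r ≤ (n.factorial : ℝ) ^ 2 * (C * (K ^ n + S.Sg K i n r)) := by
  obtain ⟨A, C, hA, hC, hc⟩ := S.ac α β hα
  obtain ⟨A', C', hA', hC', hf⟩ := S.af α β hα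
  obtain ⟨D, hD⟩ := isCompact_Icc.exists_bound_of_continuousOn (s := Icc α β) (f := S.al i)
    (fun r _ => (S.al_deriv i r).continuousAt.continuousWithinAt)
  let D' := max 0 D
  have hD' : ∀ r ∈ Icc α β, ‖S.al i r‖ ^ 2 ≤ D' ^ 2 := fun r hr =>
    pow_le_pow_left₀ (norm_nonneg _) ((hD r hr).trans (le_max_right _ _)) 2
  let M := 2 * (i + 1) * (A * i.factorial * C ^ i) ^ 2
  have hM : 0 ≤ M := by positivity
  let K := 2 * C ^ 2 + C' ^ 2
  have hK1 : 2 * C ^ 2 ≤ K := by simp only [K]; nlinarith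
  have hK2 : C' ^ 2 ≤ K := by simp only [K]; nlinarith
  have hK : 1 ≤ K := by nlinarith
  refine ⟨8 * (A' * i.factorial * C' ^ i) ^ 2 + 4 * M + 4 * D' ^ 2 + 4 * ‖S.be i‖ ^ 2, K,
    by positivity, hK, fun n r hr => ?_⟩
  have hra : S.ra < r := hα.trans_le hr.1
  obtain ⟨si, se⟩ := S.Sg_int (K := 2 * C ^ 2) i n hra
  have gi := Bf_self_int (S.wbG i n hra)
  have gi' := Bf_self_int (S.wbG (i-1) n hra)
  let E := (A' * C' ^ (i + n) * i.factorial * n.factorial) ^ 2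
  have i0 : IntegrableOn (fun _ : ℝ => 4 * E) (Ioo (-1:ℝ) 1) := integrableOn_const (by simp)
  have i1 := si.const_mul (4 * (M * (n.factorial : ℝ) ^ 2))
  have i2 := gi.const_mul (4 * D' ^ 2)
  have i3 := gi'.const_mul (4 * ‖S.be i‖ ^ 2)
  have i01 := i0.add i1
  have i012 := i01.add i2
  have h1 : S.H i n r ≤ 8 * E + 4 * (M * (n.factorial : ℝ) ^ 2) * S.Sg (2 * C ^ 2) i n r +
      4 * D' ^ 2 * S.a i n r + 4 * ‖S.be i‖ ^ 2 * S.a (i-1) n r := by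
    have e1 : 8 * E + 4 * (M * (n.factorial : ℝ) ^ 2) * S.Sg (2 * C ^ 2) i n r +
      4 * D' ^ 2 * S.a i n r + 4 * ‖S.be i‖ ^ 2 * S.a (i-1) n r = ∫ y in Ioo (-1:ℝ) 1, 
        (((4 * E + 4 * (M * (n.factorial : ℝ) ^ 2) * (∑ p ∈ ad i, ∑ q ∈ ad n, (2 * C ^ 2) ^ q.1 *
      ((wt (S.κ + q.2) y * ‖S.G p.2 q.2 r y‖ ^ 2) / (q.2.factorial : ℝ) ^ 2))) + 
        4 * D' ^ 2 * (wt (S.κ + n) y * ‖S.G i n r y‖ ^ 2)) + 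
        4 * ‖S.be i‖ ^ 2 * (wt (S.κ + n) y * ‖S.G (i-1) n r y‖ ^ 2)) := by
      have t3 := integral_add i012 i3
      have t2 := integral_add i01 i2
      have t1 := integral_add i0 i1
      simp only [Pi.add_apply] at t1 t2 t3
      rw [t3, t2, t1, setIntegral_const, integral_const_mul, integral_const_mul, integral_const_mul, se,
        ← Bf_self, ← Bf_self]
      simp only [a]
      simp
      ring
    rw [e1, H, Bf_self]
    refine setIntegral_mono_on (Bf_self_int (S.wb_hh i n hra)) (i012.add i3) measurableSet_Ioo ?_
    intro y hy
    have hw := wt_pos (S.κ + n) hy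
    have p1 := mul_le_mul_of_nonneg_left (hh_pt (S.f i n r y) (S.cG i n r y)
      (S.al i r * S.G i n r y) (S.be i * S.G (i-1) n r y)) hw.le
    have p2 := hf i n r hr y hy
    have p3 := S.cG_pt hA hC (r := r) (fun i n y hy => hc i n r hr y hy) i n hy
    have p4 : wt (S.κ + n) y * ‖S.al i r * S.G i n r y‖ ^ 2 ≤
        D' ^ 2 * (wt (S.κ + n) y * ‖S.G i n r y‖ ^ 2) := by
      rw [norm_mul, mul_pow]
      have := mul_le_mul_of_nonneg_right (hD' r hr)
        (mul_nonneg hw.le (sq_nonneg ‖S.G i n r y‖))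
      linarith
    have p5 : wt (S.κ + n) y * ‖S.be i * S.G (i-1) n r y‖ ^ 2 =
        ‖S.be i‖ ^ 2 * (wt (S.κ + n) y * ‖S.G (i-1) n r y‖ ^ 2) := by
      rw [norm_mul]; ring
    have e0 : S.hh i n r y = S.f i n r y - S.cG i n r y - S.al i r * S.G i n r y
      - S.be i * S.G (i-1) n r y := rfl
    rw [e0]
    refine p1.trans ?_
    simp only [M, E]
    linarith
  have hE : E ≤ (n.factorial : ℝ) ^ 2 * ((A' * i.factorial * C' ^ i) ^ 2 * K ^ n) := by
    have : E = (n.factorial : ℝ) ^ 2 * ((A' * i.factorial * C' ^ i) ^ 2 * (C' ^ 2) ^ n) := by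
      simp only [E]; rw [← pow_mul, mul_comm 2 n, pow_mul, pow_add]; ring
    rw [this]
    gcongr
  have hS : S.Sg (2 * C ^ 2) i n r ≤ S.Sg K i n r := S.Sg_mono (by positivity) hK1 i n r
  have a1 := S.ah_le_Sg (K := K) (by linarith) (le_refl i) n r
  have a2 := S.ah_le_Sg (K := K) (by linarith) (Nat.sub_le i 1) n r
  have hSn := S.Sg_nonneg (K := K) (by linarith) i n r
  have hKn : 0 ≤ K ^ n := by positivity
  rw [S.a_eq, S.a_eq] at h1
  refine h1.trans ?_
  calc 8 * E + 4 * (M * (n.factorial : ℝ) ^ 2) * S.Sg (2 * C ^ 2) i n r +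
      4 * D' ^ 2 * ((n.factorial : ℝ) ^ 2 * S.ah i n r) +
      4 * ‖S.be i‖ ^ 2 * ((n.factorial : ℝ) ^ 2 * S.ah (i-1) n r)
      ≤ 8 * ((n.factorial : ℝ) ^ 2 * ((A' * i.factorial * C' ^ i) ^ 2 * (K ^ n + S.Sg K i n r))) 
      + 4 * (M * (n.factorial : ℝ) ^ 2) * (K ^ n + S.Sg K i n r) +
      4 * D' ^ 2 * ((n.factorial : ℝ) ^ 2 * (K ^ n + S.Sg K i n r)) +
      4 * ‖S.be i‖ ^ 2 * ((n.factorial : ℝ) ^ 2 * (K ^ n + S.Sg K i n r)) := by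
        gcongr
        · refine hE.trans ?_
          gcongr; linarith
        · linarith
        · linarith
        · linarith
    _ = _ := by ring

end Sys
end KerrAux
end

section
namespace KerrAux
open MeasureTheory
namespace Sys
variable (S : Sys)

def LB (i : ℕ) (α β : ℝ) : Prop := GB (fun n => ∫ r in α..β, S.ah i n r)
def UB (i : ℕ) (α β : ℝ) : Prop :=
  ∃ A C : ℝ, 0 ≤ A ∧ 1 ≤ C ∧ ∀ n, ∀ r ∈ Icc α β, S.ah i n r ≤ A * C ^ n

lemma ah_cont' (i n : ℕ) {α β : ℝ} (hα : S.ra < α) : ContinuousOn (S.ah i n) (Icc α β) :=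
  (S.ah_cont i n).mono (fun _ hr => hα.trans_le hr.1)

lemma a_cont' (i n : ℕ) {α β : ℝ} (hα : S.ra < α) : ContinuousOn (S.a i n) (Icc α β) :=
  (S.a_cont i n).mono (fun _ hr => hα.trans_le hr.1)

lemma ah_ii (i n : ℕ) {α β : ℝ} (hα : S.ra < α) (hab : α ≤ β) :
    IntervalIntegrable (S.ah i n) volume α β :=
  (S.ah_cont' i n hα).intervalIntegrable_of_Icc hab

lemma Sg_cont (K : ℝ) (i n : ℕ) {α β : ℝ} (hα : S.ra < α) : ContinuousOn (S.Sg K i n) (Icc α β) :=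
  continuousOn_finsetSum _ (fun p _ => continuousOn_finsetSum _
    (fun q _ => continuousOn_const.mul (S.ah_cont' p.2 q.2 hα)))

lemma ah_deriv (i n : ℕ) {r : ℝ} (hr : S.ra < r) :
    HasDerivAt (S.ah i n) (2 * S.X i n r / (n.factorial : ℝ) ^ 2) r := (S.a_deriv i n hr).div_const _

lemma ah_deriv_le (i n : ℕ) {r : ℝ} (hr : S.ra < r) :
    |2 * S.X i n r / (n.factorial : ℝ) ^ 2| ≤ S.ah i n r + S.ah (i+1) n r := by
  rw [abs_div, abs_of_pos (by positivity : 0 < (n.factorial : ℝ) ^ 2)]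
  unfold ah
  rw [← add_div]
  have := S.a_deriv_le i n hr
  gcongr

lemma UB_of_LB {i : ℕ} {α β : ℝ} (hα : S.ra < α) (hab : α < β) (h1 : S.LB i α β)
    (h2 : S.LB (i+1) α β) : S.UB i α β := by
  have h3 : GB (fun n => (β - α)⁻¹ * (∫ r in α..β, S.ah i n r) +
      ((∫ r in α..β, S.ah i n r) + ∫ r in α..β, S.ah (i+1) n r)) :=
    (GB.cmul h1 (by rw [inv_nonneg]; linarith)).add (GB.add h1 h2)
  obtain ⟨A, C, hA, hC, h⟩ := h3
  refine ⟨A, C, hA, hC, fun n r hr => le_trans ?_ (h n)⟩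
  have := avg_le hab.le (fun x hx => S.ah_deriv i n (hα.trans_le hx.1))
    ((S.ah_cont' i n hα).add (S.ah_cont' (i+1) n hα))
    (fun x hx => S.ah_deriv_le i n (hα.trans_le hx.1)) hr
  simp only [Pi.add_apply] at this
  rw [intervalIntegral.integral_add (S.ah_ii i n hα hab.le) (S.ah_ii (i+1) n hα hab.le)] at this
  show S.ah i n r ≤ (β - α)⁻¹ * (∫ r in α..β, S.ah i n r) +
      ((∫ r in α..β, S.ah i n r) + ∫ r in α..β, S.ah (i+1) n r)
  have hp : 0 < β - α := by linarith
  rw [← sub_nonneg] at this ⊢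
  have h5 := mul_nonneg (inv_nonneg.2 hp.le) this
  have e : (β - α)⁻¹ * (β - α) = 1 := inv_mul_cancel₀ hp.ne'
  refine h5.trans (le_of_eq ?_)
  linear_combination ((∫ r in α..β, S.ah i n r) + (∫ r in α..β, S.ah (i+1) n r) - S.ah i n r) * e

lemma LB_of_UB {i : ℕ} {α β : ℝ} (hα : S.ra < α) (hab : α ≤ β) (h : S.UB i α β) : S.LB i α β := by
  obtain ⟨A, C, hA, hC, h⟩ := h
  refine ⟨A * (β - α), C, mul_nonneg hA (by linarith), hC, fun n => ?_⟩
  have := intervalIntegral.integral_mono_on hab (S.ah_ii i n hα hab) 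
    (ii_const _ _ _) (h n)
  rw [intervalIntegral.integral_const, smul_eq_mul] at this
  linarith

lemma LB_mono {i : ℕ} {α β α' β' : ℝ} (hα : S.ra < α) (h1 : α ≤ α') (h2 : α' ≤ β') (h3 : β' ≤ β)
    (h : S.LB i α β) : S.LB i α' β' := by
  refine GB.mono h (fun n => ?_)
  refine intervalIntegral.integral_mono_interval h1 h2 h3 ?_ (S.ah_ii i n hα (by linarith))
  exact Filter.Eventually.of_forall (fun z => S.ah_nonneg i n z)

lemma int_Sg (K : ℝ) (i n : ℕ) {α β : ℝ} (hα : S.ra < α) (hab : α ≤ β) :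
    ∫ r in α..β, (K ^ n + S.Sg K i n r) = (β - α) * K ^ n +
      ∑ p ∈ ad i, ∑ q ∈ ad n, K ^ q.1 * ∫ r in α..β, S.ah p.2 q.2 r := by
  rw [intervalIntegral.integral_add (ii_const _ _ _)
    ((S.Sg_cont K i n hα).intervalIntegrable_of_Icc hab), intervalIntegral.integral_const, smul_eq_mul]
  congr 1
  unfold Sg
  have h1 : ∀ p q : ℕ × ℕ, IntervalIntegrable (fun r => K ^ q.1 * S.ah p.2 q.2 r) volume α β :=
    fun p q => (S.ah_ii p.2 q.2 hα hab).const_mul _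
  rw [intervalIntegral.integral_finsetSum (fun p _ => by
    have := IntervalIntegrable.sum (ad n) (fun q _ => h1 p q)
    simpa [Finset.sum_fn] using this)]
  refine Finset.sum_congr rfl (fun p _ => ?_)
  rw [intervalIntegral.integral_finsetSum (fun q _ => h1 p q)]
  refine Finset.sum_congr rfl (fun q _ => ?_)
  rw [intervalIntegral.integral_const_mul]

lemma gb_int_Sg {K : ℝ} (hK : 0 ≤ K) (i : ℕ) {α β : ℝ} (hα : S.ra < α) (hab : α ≤ β)
    (h : ∀ j ≤ i, S.LB j α β) : GB (fun n => ∫ r in α..β, (K ^ n + S.Sg K i n r)) := by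
  simp only [S.int_Sg K i _ hα hab]
  refine ((gb_pow K).cmul (by linarith)).add (gb_sum _ (fun p hp => gb_conv (h p.2 ?_) hK))
  have := Finset.HasAntidiagonal.mem_antidiagonal.1 hp
  omega

lemma b_bdd (i : ℕ) (α β : ℝ) : ∃ M : ℝ, 0 ≤ M ∧ ∀ r ∈ Icc α β,
    |S.mu r| ≤ M ∧ |S.mu' r| ≤ M ∧ ‖S.b r‖ ≤ M ∧ ‖(((i * S.mu' r : ℝ)) : ℂ) + S.b r‖ ≤ M := by
  have c1 : Continuous S.mu := continuous_iff_continuousAt.2 (fun r => (S.mu_deriv r).continuousAt)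
  have c2 : Continuous S.mu' := by unfold mu'; fun_prop
  have c3 : Continuous S.b := continuous_iff_continuousAt.2 (fun r => (S.b_deriv r).continuousAt)
  obtain ⟨M1, h1⟩ := isCompact_Icc.exists_bound_of_continuousOn (s := Icc α β) c1.continuousOn
  obtain ⟨M2, h2⟩ := isCompact_Icc.exists_bound_of_continuousOn (s := Icc α β) c2.continuousOn
  obtain ⟨M3, h3⟩ := isCompact_Icc.exists_bound_of_continuousOn (s := Icc α β) c3.continuousOn
  have c4 : Continuous (fun r => (((i * S.mu' r : ℝ)) : ℂ) + S.b r) := by fun_prop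
  obtain ⟨M4, h4⟩ := isCompact_Icc.exists_bound_of_continuousOn (s := Icc α β) c4.continuousOn
  refine ⟨max (max M1 M2) (max (max M3 M4) 0), by simp, fun r hr => ⟨?_, ?_, ?_, ?_⟩⟩
  · exact (h1 r hr).trans (by simp)
  · exact (h2 r hr).trans (by simp)
  · exact (h3 r hr).trans (by simp)
  · exact (h4 r hr).trans (by simp)

/-- pointwise lower bound of `J'` -/
lemma J_low (i n : ℕ) {r M ε : ℝ} (hr : S.ra < r) (hM : ‖(((i * S.mu' r : ℝ)) : ℂ) + S.b r‖ ≤ M)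
    (hε : 0 < ε) :
    S.mu r * S.a (i+1) n r + S.a i (n+1) r - S.H i n r - (1/4) * S.a i n r
      - (ε * M ^ 2 * S.a (i+1) n r + 1 / (4 * ε) * S.a i n r) ≤
    S.mu r * S.a (i+1) n r + S.a i (n+1) r + S.lam n * S.a i n r
        + Bf (S.κ + n) (S.hh i n r) (S.G i n r)
        - Bf (S.κ + n) (fun y => ((i * S.mu' r : ℝ) + S.b r) * S.G (i+1) n r y) (S.G i n r) := by
  have h1 := Bf_young (S.wb_hh i n hr) (S.wbG i n hr) one_pos
  have h2 := Bf_young ((S.wbG (i+1) n hr).cmul ((i * S.mu' r : ℝ) + S.b r)) (S.wbG i n hr) hε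
  rw [Bf_cc] at h2
  have h3 : ‖(((i * S.mu' r : ℝ)) : ℂ) + S.b r‖ ^ 2 * S.a (i+1) n r ≤ M ^ 2 * S.a (i+1) n r := by
    have := S.a_nonneg (i+1) n r
    gcongr
  have h4 := mul_nonneg (S.lam_nonneg n) (S.a_nonneg i n r)
  have h5 := abs_le.1 h1
  have h6 := abs_le.1 h2
  have h7 := mul_le_mul_of_nonneg_left h3 hε.le
  unfold H a at *
  linarith [h5.1, h6.2]

end Sys
end KerrAux
end

section
namespace KerrAux
open MeasureTheory

def eta (α β r : ℝ) : ℝ := (r - α) * (β - r) / (β - α) ^ 2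
def eta' (α β r : ℝ) : ℝ := (α + β - 2 * r) / (β - α) ^ 2

lemma eta_deriv (α β r : ℝ) : HasDerivAt (eta α β) (eta' α β r) r := by
  have := (((hasDerivAt_id r).sub_const α).mul ((hasDerivAt_id r).const_sub β)).div_const ((β - α) ^ 2)
  refine this.congr_deriv ?_
  simp [eta']; ring

lemma eta_cont (α β : ℝ) : Continuous (eta α β) := by unfold eta; fun_prop

lemma eta_nonneg {α β r : ℝ} (hr : r ∈ Icc α β) : 0 ≤ eta α β r :=
  div_nonneg (mul_nonneg (by linarith [hr.1]) (by linarith [hr.2])) (sq_nonneg _)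

lemma eta_le {α β r : ℝ} (hr : r ∈ Icc α β) : eta α β r ≤ 1 := by
  unfold eta
  refine div_le_one_of_le₀ ?_ (sq_nonneg _)
  nlinarith [hr.1, hr.2]

lemma eta_low {α β α' β' : ℝ} (h1 : α < α') (h2 : α' ≤ β') (h3 : β' < β) : ∃ c, 0 < c ∧
    ∀ r ∈ Icc α' β', c ≤ eta α β r := by
  refine ⟨(α' - α) * (β - β') / (β - α) ^ 2, ?_, fun r hr => ?_⟩
  · have : 0 < β - α := by linarith
    have := mul_pos (sub_pos.2 h1) (sub_pos.2 h3)
    positivity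
  · unfold eta
    have := mul_le_mul (sub_le_sub_right hr.1 α) (sub_le_sub_left hr.2 β) (by linarith) (by linarith [hr.1])
    gcongr

namespace Sys
variable (S : Sys)

lemma mu_pos {α r : ℝ} (hα : S.re < α) (hr : α ≤ r) : (α - S.rC) * (α - S.re) ≤ S.mu r := by
  have := S.hC; have := S.he
  unfold mu
  gcongr
  linarith

set_option maxHeartbeats 2000000 in
lemma E_main (i : ℕ) {α β : ℝ} (hα : S.re < α) (hab : α < β) : ∃ δ C K : ℝ, 0 < δ ∧ 0 ≤ C ∧ 1 ≤ K ∧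
    ∀ N n : ℕ, ∫ r in α..β, (eta α β r ^ (2 * N + 2) * (δ * S.ah (i+1) n r + (n + 1) ^ 2 * S.ah i (n+1) r)
      - (C * (N + 1) ^ 2 * (eta α β r ^ (2 * N) * S.ah i n r) +
        C * (eta α β r ^ (2 * N + 2) * (K ^ n + S.Sg K i n r)))) ≤ 0 := by
  have hra : S.ra < α := S.he.trans hα
  obtain ⟨C0, K, hC0, hK, hH⟩ := S.H_bound i (α := α) (β := β) hra
  obtain ⟨M, hM0, hM⟩ := S.b_bdd i α β
  let δ := (α - S.rC) * (α - S.re)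
  have hδ : 0 < δ := mul_pos (by linarith [S.hC, S.he]) (by linarith)
  let ε := δ / (4 * (M ^ 2 + 1))
  have hε : 0 < ε := by positivity
  have hεM : ε * M ^ 2 ≤ δ / 4 := by
    simp only [ε]
    rw [div_mul_eq_mul_div, div_le_div_iff₀ (by positivity) (by positivity)]
    nlinarith
  let B := (1 / (β - α)) ^ 2
  let C2 := 1/4 + 1 / (4 * ε) + 4 / δ * B * M ^ 2
  have hC2 : 0 ≤ C2 := by positivity
  refine ⟨δ / 2, max C0 C2, K, by positivity, by positivity, hK, fun N n => ?_⟩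
  have hfn : (0:ℝ) < (n.factorial : ℝ) ^ 2 := by positivity
  have key := ftc_le (a := α) (b := β) hab.le
    (Φ := fun r => (eta α β r ^ (2 * N + 2) * (S.mu r * S.X i n r)) / (n.factorial : ℝ) ^ 2)
    (φ := fun r => (eta α β r ^ (2 * N + 2) * (δ / 2 * S.ah (i+1) n r + (n + 1) ^ 2 * S.ah i (n+1) r)
      - (max C0 C2 * (N + 1) ^ 2 * (eta α β r ^ (2 * N) * S.ah i n r) +
        max C0 C2 * (eta α β r ^ (2 * N + 2) * (K ^ n + S.Sg K i n r)))))
    (fun x hx => (((eta_deriv α β x).pow (2 * N + 2)).mul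
      (S.J_deriv i n (hra.trans_le hx.1))).div_const _) ?_ ?_
  · have e1 : eta α β α = 0 := by simp [eta]
    have e2 : eta α β β = 0 := by simp [eta]
    rw [e1, e2] at key
    simpa using key
  · have h1 := (eta_cont α β).continuousOn (s := Icc α β)
    have h2 := S.ah_cont' (i+1) n (β := β) hra
    have h3 := S.ah_cont' i (n+1) (β := β) hra
    have h4 := S.ah_cont' i n (β := β) hra
    have h5 := S.Sg_cont K i n (β := β) hra
    fun_prop
  · intro r hr
    have hr' := hra.trans_le hr.1
    obtain ⟨m1, m2, m3, m4⟩ := hM r hr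
    have hJ := S.J_low i n hr' m4 hε
    have hHr := hH n r hr
    have hη0 := eta_nonneg hr
    have hη1 := eta_le hr
    have hη' : eta' α β r ^ 2 ≤ B := by
      simp only [B, eta']
      have hp : 0 < β - α := by linarith
      rw [div_pow, div_pow, div_le_div_iff₀ (by positivity) (by positivity)]
      have h1 : (α + β - 2 * r) ^ 2 ≤ (β - α) ^ 2 := by nlinarith [hr.1, hr.2]
      have := mul_le_mul_of_nonneg_right h1 (sq_nonneg (β - α))
      nlinarith
    set η := eta α β r with hη
    set η' := eta' α β r
    have hmu := S.mu_pos hα hr.1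
    have p0 := S.a_nonneg (i+1) n r
    have q0 := S.a_nonneg i n r
    -- cross term
    have hX := Bf_quad (S.wbG (i+1) n hr') (S.wbG i n hr') (δ / 2 * η ^ (N + 1))
      (-(2 * (N + 1) * (η ^ N * η' * S.mu r)))
    have hcross : -(δ * (δ / 4 * η ^ (2 * N + 2) * S.a (i+1) n r + 4 / δ * (N + 1) ^ 2 * η ^ (2 * N) *
        (η' ^ 2 * S.mu r ^ 2) * S.a i n r)) ≤ δ * ((2 * N + 2) * η ^ (2 * N + 1) * η' * (S.mu r * S.X i n r)) := by
      have e1 : (2:ℝ) * (δ / 2 * η ^ (N + 1)) * (-(2 * (N + 1) * (η ^ N * η' * S.mu r))) *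
        Bf (S.κ + n) (S.G (i+1) n r) (S.G i n r) = - (δ * ((2 * N + 2) * η ^ (2 * N + 1) * η' * (S.mu r * S.X i n r))) := by
        unfold X; ring
      have e2 : (δ / 2 * η ^ (N + 1)) ^ 2 * Bf (S.κ + n) (S.G (i+1) n r) (S.G (i+1) n r) +
        (-(2 * (N + 1) * (η ^ N * η' * S.mu r))) ^ 2 * Bf (S.κ + n) (S.G i n r) (S.G i n r)
        = δ * (δ / 4 * η ^ (2 * N + 2) * S.a (i+1) n r + 4 / δ * (N + 1) ^ 2 * η ^ (2 * N) *
        (η' ^ 2 * S.mu r ^ 2) * S.a i n r) := by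
        unfold a; field_simp; ring
      rw [e1, e2] at hX
      linarith
    rw [← mul_neg] at hcross
    have hcross' := le_of_mul_le_mul_left hcross hδ
    have hmu2 : η' ^ 2 * S.mu r ^ 2 ≤ B * M ^ 2 := by
      have : S.mu r ^ 2 ≤ M ^ 2 := sq_le_sq' (by linarith [(abs_le.1 m1).1]) (abs_le.1 m1).2
      gcongr
    have hc2 : 4 / δ * (N + 1) ^ 2 * η ^ (2 * N) * (η' ^ 2 * S.mu r ^ 2) * S.a i n r
        ≤ (N + 1) ^ 2 * (4 / δ * B * M ^ 2) * (η ^ (2 * N) * S.a i n r) := by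
      have : 4 / δ * (N + 1) ^ 2 * η ^ (2 * N) * (η' ^ 2 * S.mu r ^ 2) * S.a i n r ≤
        4 / δ * (N + 1) ^ 2 * η ^ (2 * N) * (B * M ^ 2) * S.a i n r := by gcongr
      refine this.trans (le_of_eq (by ring))
    have hpw : η ^ (2 * N + 2) ≤ η ^ (2 * N) := pow_le_pow_of_le_one hη0 hη1 (by omega)
    have hN1 : (1:ℝ) ≤ (N + 1) ^ 2 := by
      have : (0:ℝ) ≤ N := Nat.cast_nonneg N
      exact one_le_pow₀ (by linarith)
    have hc3 : η ^ (2 * N + 2) * ((1/4 + 1 / (4 * ε)) * S.a i n r) ≤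
        (N + 1) ^ 2 * (1/4 + 1 / (4 * ε)) * (η ^ (2 * N) * S.a i n r) := by
      calc η ^ (2 * N + 2) * ((1/4 + 1 / (4 * ε)) * S.a i n r) ≤ 
          1 * (η ^ (2 * N) * ((1/4 + 1 / (4 * ε)) * S.a i n r)) := by rw [one_mul]; gcongr
        _ ≤ (N + 1) ^ 2 * (η ^ (2 * N) * ((1/4 + 1 / (4 * ε)) * S.a i n r)) := by gcongr
        _ = _ := by ring
    have hlow : η ^ (2 * N + 2) * (δ / 2 * S.a (i+1) n r + S.a i (n+1) r) -
        ((N + 1) ^ 2 * C2 * (η ^ (2 * N) * S.a i n r) + η ^ (2 * N + 2) * S.H i n r) ≤ 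
        (2 * N + 2) * η ^ (2 * N + 1) * η' * (S.mu r * S.X i n r) + η ^ (2 * N + 2) * 
        (S.mu r * S.a (i+1) n r + S.a i (n+1) r + S.lam n * S.a i n r
        + Bf (S.κ + n) (S.hh i n r) (S.G i n r)
        - Bf (S.κ + n) (fun y => ((i * S.mu' r : ℝ) + S.b r) * S.G (i+1) n r y) (S.G i n r)) := by
      have h1 := mul_le_mul_of_nonneg_left hJ (pow_nonneg hη0 (2 * N + 2))
      have h2 : η ^ (2 * N + 2) * (δ * 3 / 4 * S.a (i+1) n r) ≤
          η ^ (2 * N + 2) * (S.mu r * S.a (i+1) n r - ε * M ^ 2 * S.a (i+1) n r) := by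
        refine mul_le_mul_of_nonneg_left ?_ (by positivity)
        rw [← sub_mul]
        refine mul_le_mul_of_nonneg_right ?_ p0
        simp only [δ] at *
        linarith
      simp only [C2]
      linarith
    have hfin : η ^ (2 * N + 2) * (δ / 2 * S.a (i+1) n r + S.a i (n+1) r) -
        ((N + 1) ^ 2 * max C0 C2 * (η ^ (2 * N) * S.a i n r) + η ^ (2 * N + 2) * 
          ((n.factorial : ℝ) ^ 2 * (max C0 C2 * (K ^ n + S.Sg K i n r)))) ≤ 
        η ^ (2 * N + 2) * (δ / 2 * S.a (i+1) n r + S.a i (n+1) r) -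
        ((N + 1) ^ 2 * C2 * (η ^ (2 * N) * S.a i n r) + η ^ (2 * N + 2) * S.H i n r) := by
      have hs := S.Sg_nonneg (K := K) (by linarith) i n r
      have hkn : 0 ≤ K ^ n := by positivity
      gcongr
      · exact le_max_right _ _
      · refine hHr.trans ?_
        gcongr
        exact le_max_left _ _
    rw [le_div_iff₀ hfn]
    refine le_trans (le_of_eq ?_) ((hfin.trans hlow).trans (le_of_eq ?_))
    · rw [S.a_eq, S.a_eq, S.a_eq, Nat.factorial_succ]
      push_cast
      ring
    · simp only [Pi.pow_apply, ← hη]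
      push_cast
      ring

end Sys
end KerrAux
end

section
namespace KerrAux
open MeasureTheory
namespace Sys
variable (S : Sys)

/-- exterior, `i = 0` -/
lemma ext_zero {α β : ℝ} (hα : S.re < α) (hab : α ≤ β) : S.LB 0 α β := by
  let α0 := (S.re + α) / 2
  let β0 := β + 1
  have h0 : S.re < α0 := by simp only [α0]; linarith
  have h1 : α0 < α := by simp only [α0]; linarith
  have h2 : β < β0 := by simp only [β0]; linarith
  have hab0 : α0 < β0 := by linarith
  have hra : S.ra < α0 := S.he.trans h0
  obtain ⟨δ, C, K, hδ, hC, hK, hE⟩ := S.E_main 0 h0 hab0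
  let T : ℕ → ℝ := fun n => ∫ r in α0..β0, eta α0 β0 r ^ (2 * n) * S.ah 0 n r
  have ec := fun n : ℕ => ((eta_cont α0 β0).pow n).continuousOn (s := Icc α0 β0)
  have hc : ∀ i m n, ContinuousOn (fun r => eta α0 β0 r ^ m * S.ah i n r) (Icc α0 β0) := fun i m n =>
    (ec m).mul (S.ah_cont' i n hra)
  have hii : ∀ i m n, IntervalIntegrable (fun r => eta α0 β0 r ^ m * S.ah i n r) volume α0 β0 := fun i m n =>
    (hc i m n).intervalIntegrable_of_Icc hab0.le
  have hTT : GB T := by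
    refine gb_seq (K := K) (M := 2 * C) (U := fun n => C * ((β0 - α0) * K ^ n)) (fun n => ?_) hK (by positivity)
      (((gb_pow K).cmul (by linarith)).cmul hC) (fun n => ?_)
    · refine intervalIntegral.integral_nonneg hab0.le (fun r hr => ?_)
      exact mul_nonneg (pow_nonneg (eta_nonneg hr) _) (S.ah_nonneg 0 n r)
    · have h := hE n n
      have hn : (0:ℝ) < ((n:ℝ) + 1) ^ 2 := by positivity
      have hn1 : (1:ℝ) ≤ ((n:ℝ) + 1) ^ 2 := one_le_pow₀ (by linarith [(Nat.cast_nonneg n : (0:ℝ) ≤ n)])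
      have hlow : ∫ r in α0..β0, (((n:ℝ)+1)^2 * (eta α0 β0 r ^ (2 * (n + 1)) * S.ah 0 (n+1) r)
          - (C * (n + 1) ^ 2 * (eta α0 β0 r ^ (2 * n) * S.ah 0 n r) +
            (C * K ^ n + C * ∑ q ∈ ad n, K ^ q.1 * (eta α0 β0 r ^ (2 * q.2) * S.ah 0 q.2 r)))) ≤ 0 := by
        refine le_trans (intervalIntegral.integral_mono_on hab0.le ?_ ?_ ?_) h
        · refine ContinuousOn.intervalIntegrable_of_Icc hab0.le ?_
          refine ((hc 0 (2*(n+1)) (n+1)).const_smul (((n:ℝ)+1)^2)).sub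
            (((hc 0 (2*n) n).const_smul (C * ((n:ℝ) + 1) ^ 2)).add (continuousOn_const.add
            (continuousOn_const.mul (continuousOn_finsetSum _ (fun q _ => continuousOn_const.mul (hc 0 _ _))))))
        · refine ContinuousOn.intervalIntegrable_of_Icc hab0.le ?_
          have h1 := (eta_cont α0 β0).continuousOn (s := Icc α0 β0)
          have h2 := S.ah_cont' (0+1) n (β := β0) hra
          have h3 := S.ah_cont' 0 (n+1) (β := β0) hra
          have h4 := S.ah_cont' 0 n (β := β0) hra
          have h5 := S.Sg_cont K 0 n (β := β0) hra
          fun_prop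
        · intro r hr
          have hη0 := eta_nonneg hr
          have hη1 := eta_le hr
          set η := eta α0 β0 r
          have e1 : 0 ≤ η ^ (2 * n + 2) * (δ * S.ah (0+1) n r) :=
            mul_nonneg (by positivity) (mul_nonneg hδ.le (S.ah_nonneg _ _ _))
          have e2 : η ^ (2 * n + 2) * (K ^ n + S.Sg K 0 n r) ≤
            K ^ n + ∑ q ∈ ad n, K ^ q.1 * (η ^ (2 * q.2) * S.ah 0 q.2 r) := by
            rw [mul_add]
            refine add_le_add ?_ ?_
            · exact mul_le_of_le_one_left (by positivity) (pow_le_one₀ hη0 hη1)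
            · have : S.Sg K 0 n r = ∑ q ∈ ad n, K ^ q.1 * S.ah 0 q.2 r := by simp [Sg, ad]
              rw [this, Finset.mul_sum]
              refine Finset.sum_le_sum (fun q hq => ?_)
              have hq' := Finset.HasAntidiagonal.mem_antidiagonal.1 hq
              have e3 : η ^ (2 * n + 2) ≤ η ^ (2 * q.2) := pow_le_pow_of_le_one hη0 hη1 (by omega)
              have := mul_le_mul_of_nonneg_right e3 (mul_nonneg (by positivity : 0 ≤ K ^ q.1) (S.ah_nonneg 0 q.2 r))
              linarith
          have e3 := mul_le_mul_of_nonneg_left e2 hC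
          have e4 : η ^ (2 * (n + 1)) = η ^ (2 * n + 2) := by ring
          rw [e4]
          linarith
      have s1 : ∀ q : ℕ × ℕ, IntervalIntegrable (fun r => K ^ q.1 * (eta α0 β0 r ^ (2 * q.2) * S.ah 0 q.2 r)) volume α0 β0 :=
        fun q => (hii 0 _ _).const_mul _
      have s2 : IntervalIntegrable (fun r => ∑ q ∈ ad n, K ^ q.1 * (eta α0 β0 r ^ (2 * q.2) * S.ah 0 q.2 r)) volume α0 β0 := by
        have := IntervalIntegrable.sum (ad n) (fun q _ => s1 q)
        simpa [Finset.sum_fn] using this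
      rw [intervalIntegral.integral_sub ((hii 0 _ _).const_mul _) (((hii 0 _ _).const_mul _).add
        ((ii_const _ _ _).add (s2.const_mul _))), intervalIntegral.integral_add ((hii 0 _ _).const_mul _)
        ((ii_const _ _ _).add (s2.const_mul _)), intervalIntegral.integral_add (ii_const _ _ _) (s2.const_mul _),
        intervalIntegral.integral_const_mul, intervalIntegral.integral_const_mul,
        intervalIntegral.integral_const, intervalIntegral.integral_const_mul,
        intervalIntegral.integral_finsetSum (fun q _ => s1 q)] at hlow
      simp only [intervalIntegral.integral_const_mul, smul_eq_mul] at hlow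
      change ((n:ℝ)+1)^2 * T (n+1) - (C * ((n:ℝ)+1)^2 * T n + ((β0 - α0) * (C * K ^ n) + C * ∑ q ∈ ad n, K ^ q.1 * T q.2)) ≤ 0 at hlow
      have hT0 : ∀ n, 0 ≤ T n := fun n => intervalIntegral.integral_nonneg hab0.le (fun r hr =>
        mul_nonneg (pow_nonneg (eta_nonneg hr) _) (S.ah_nonneg 0 n r))
      have hTn : T n ≤ ∑ q ∈ ad n, K ^ q.1 * T q.2 := by
        have : K ^ ((0:ℕ), n).1 * T ((0:ℕ), n).2 ≤ ∑ q ∈ ad n, K ^ q.1 * T q.2 :=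
          Finset.single_le_sum (f := fun q : ℕ × ℕ => K ^ q.1 * T q.2)
            (fun q _ => mul_nonneg (by positivity) (hT0 _)) (by simp)
        simpa using this
      set s := ∑ q ∈ ad n, K ^ q.1 * T q.2
      have hs : 0 ≤ s := (hT0 n).trans hTn
      refine le_of_mul_le_mul_left (a := ((n:ℝ)+1)^2) ?_ hn
      have w0 : 0 ≤ C * ((β0 - α0) * K ^ n) + C * s := by
        have : 0 ≤ β0 - α0 := by linarith
        positivity
      have w1 := mul_le_mul_of_nonneg_right hn1 w0
      have w2 := mul_le_mul_of_nonneg_left hTn (by positivity : 0 ≤ C * ((n:ℝ)+1)^2)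
      show ((n:ℝ)+1)^2 * T (n+1) ≤ ((n:ℝ)+1)^2 * (C * ((β0 - α0) * K ^ n) + 2 * C * s)
      linarith
  obtain ⟨c, hc0, hcl⟩ := eta_low h1 hab h2
  have := hTT.mul (gb_pow ((c ^ 2)⁻¹)) (fun n => by positivity)
  refine this.mono (fun n => ?_)
  rw [inv_pow, ← div_eq_mul_inv, le_div_iff₀ (by positivity), mul_comm, ← intervalIntegral.integral_const_mul]
  calc ∫ r in α..β, (c ^ 2) ^ n * S.ah 0 n r ≤ ∫ r in α..β, eta α0 β0 r ^ (2 * n) * S.ah 0 n r := by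
        refine intervalIntegral.integral_mono_on hab ((S.ah_ii 0 n (hra.trans h1) hab).const_mul _)
          (((hc 0 (2*n) n).mono (Icc_subset_Icc h1.le h2.le)).intervalIntegrable_of_Icc hab) (fun r hr => ?_)
        refine mul_le_mul_of_nonneg_right ?_ (S.ah_nonneg _ _ _)
        rw [← pow_mul]
        exact pow_le_pow_left₀ hc0.le (hcl r hr) _
    _ ≤ T n := by
        refine intervalIntegral.integral_mono_interval h1.le hab h2.le ?_ (hii 0 _ _)
        filter_upwards [ae_restrict_mem measurableSet_Ioc] with z hz
        exact mul_nonneg (pow_nonneg (eta_nonneg ⟨hz.1.le, hz.2⟩) _) (S.ah_nonneg 0 n z)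

lemma ext_all (i : ℕ) : ∀ {α β : ℝ}, S.re < α → α ≤ β → S.LB i α β := by
  induction i using Nat.strong_induction_on with
  | _ i ih =>
    intro α β hα hab
    rcases i with _ | i
    · exact S.ext_zero hα hab
    let α0 := (S.re + α) / 2
    let β0 := β + 1
    have h0 : S.re < α0 := by simp only [α0]; linarith
    have h1 : α0 < α := by simp only [α0]; linarith
    have h2 : β < β0 := by simp only [β0]; linarith
    have hab0 : α0 < β0 := by linarith
    have hra : S.ra < α0 := S.he.trans h0
    obtain ⟨δ, C, K, hδ, hC, hK, hE⟩ := S.E_main i h0 hab0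
    obtain ⟨c, hc0, hcl⟩ := eta_low h1 hab h2
    have g1 : GB (fun n => C * ∫ r in α0..β0, S.ah i n r) := (ih i (by omega) h0 hab0.le).cmul hC
    have g2 : GB (fun n => C * ∫ r in α0..β0, (K ^ n + S.Sg K i n r)) :=
      (S.gb_int_Sg (by linarith) i hra hab0.le (fun j hj => ih j (by omega) h0 hab0.le)).cmul hC
    refine GB.mono ((g1.add g2).cmul (by positivity : 0 ≤ (c ^ 2 * δ)⁻¹)) (fun n => ?_)
    rw [inv_mul_eq_div, le_div_iff₀ (by positivity), mul_comm]
    have hS : IntervalIntegrable (fun r => C * (K ^ n + S.Sg K i n r)) volume α0 β0 :=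
      ((ii_const _ _ _).add ((S.Sg_cont K i n hra).intervalIntegrable_of_Icc hab0.le)).const_mul _
    have hA := (S.ah_ii i n hra hab0.le).const_mul C
    have hcc : ContinuousOn (fun r => eta α0 β0 r ^ 2 * (δ * S.ah (i+1) n r)) (Icc α0 β0) :=
      ((eta_cont α0 β0).pow 2).continuousOn.mul (continuousOn_const.mul (S.ah_cont' (i+1) n hra))
    have hB := hcc.intervalIntegrable_of_Icc (μ := volume) hab0.le
    have key : ∫ r in α0..β0, (eta α0 β0 r ^ 2 * (δ * S.ah (i+1) n r) - (C * S.ah i n r + C * (K ^ n + S.Sg K i n r))) ≤ 0 := by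
      refine le_trans (intervalIntegral.integral_mono_on hab0.le (hB.sub (hA.add hS)) ?_ ?_) (hE 0 n)
      · refine ContinuousOn.intervalIntegrable_of_Icc hab0.le ?_
        have h1 := (eta_cont α0 β0).continuousOn (s := Icc α0 β0)
        have h2 := S.ah_cont' (i+1) n (β := β0) hra
        have h3 := S.ah_cont' i (n+1) (β := β0) hra
        have h4 := S.ah_cont' i n (β := β0) hra
        have h5 := S.Sg_cont K i n (β := β0) hra
        fun_prop
      · intro r hr
        have hη0 := eta_nonneg hr
        have hη1 := eta_le hr
        set η := eta α0 β0 r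
        have e1 : 0 ≤ η ^ 2 * (((n:ℝ) + 1)^2 * S.ah i (n+1) r) :=
            mul_nonneg (by positivity) (mul_nonneg (by positivity) (S.ah_nonneg _ _ _))
        have e2 : η ^ 2 * (K ^ n + S.Sg K i n r) ≤ K ^ n + S.Sg K i n r := by
          refine mul_le_of_le_one_left ?_ (pow_le_one₀ hη0 hη1)
          have := S.Sg_nonneg (K := K) (by linarith) i n r
          positivity
        have e3 := mul_le_mul_of_nonneg_left e2 hC
        simp
        linarith
    rw [intervalIntegral.integral_sub hB (hA.add hS), intervalIntegral.integral_add hA hS,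
      intervalIntegral.integral_const_mul, intervalIntegral.integral_const_mul] at key
    have h5 : c ^ 2 * δ * (∫ r in α..β, S.ah (i+1) n r) ≤ ∫ r in α0..β0, eta α0 β0 r ^ 2 * (δ * S.ah (i+1) n r) := by
      rw [← intervalIntegral.integral_const_mul]
      refine (intervalIntegral.integral_mono_on (g := fun r => eta α0 β0 r ^ 2 * (δ * S.ah (i+1) n r)) hab 
        ((S.ah_ii (i+1) n (hra.trans h1) hab).const_mul _) ((hcc.mono (Icc_subset_Icc h1.le h2.le)).intervalIntegrable_of_Icc hab)
        (fun r hr => ?_)).trans ?_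
      · rw [mul_assoc]
        refine mul_le_mul_of_nonneg_right ?_ (mul_nonneg hδ.le (S.ah_nonneg _ _ _))
        exact pow_le_pow_left₀ hc0.le (hcl r hr) _
      · refine intervalIntegral.integral_mono_interval h1.le hab h2.le ?_ hB
        filter_upwards with z
        exact mul_nonneg (sq_nonneg _) (mul_nonneg hδ.le (S.ah_nonneg _ _ _))
    show c ^ 2 * δ * _ ≤ C * _ + C * _
    linarith

end Sys
end KerrAux
end

section
namespace KerrAux
open MeasureTheory
namespace Sys
variable (S : Sys)

lemma ext_UB (i : ℕ) {α β : ℝ} (hα : S.re < α) (hab : α < β) : S.UB i α β :=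
  S.UB_of_LB (S.he.trans hα) hab (S.ext_all i hα hab.le) (S.ext_all (i+1) hα hab.le)

lemma UB_at {i : ℕ} {α β r : ℝ} (h : S.UB i α β) (hr : r ∈ Icc α β) : GB (fun n => S.ah i n r) := by
  obtain ⟨A, C, hA, hC, h⟩ := h
  exact ⟨A, C, hA, hC, fun n => h n r hr⟩

lemma gb_lam : GB S.lam := by
  have h := (gb_succ.mul gb_succ (fun n => by positivity)).cmul (sq_nonneg (|(S.κ:ℝ)| + 1))
  refine h.mono (fun n => ?_)
  show S.lam n ≤ (|(S.κ:ℝ)| + 1) ^ 2 * (((n:ℝ)+1) * ((n:ℝ)+1))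
  unfold lam
  have hn : (0:ℝ) ≤ n := Nat.cast_nonneg n
  have h0 := abs_nonneg (S.κ:ℝ)
  have h1 := le_abs_self (S.κ:ℝ)
  have h2 := neg_abs_le (S.κ:ℝ)
  have h3 := mul_nonneg h0 hn
  have e1 : |(S.κ:ℝ) + n| ≤ (|(S.κ:ℝ)| + 1) * (n+1) := by
    rw [abs_le]; constructor <;> nlinarith
  have e2 : |(S.κ:ℝ) + n + 1| ≤ (|(S.κ:ℝ)| + 1) * (n+1) := by
    rw [abs_le]; constructor <;> nlinarith
  calc ((S.κ:ℝ) + n) * (S.κ + n + 1) ≤ |(S.κ:ℝ) + n| * |(S.κ:ℝ) + n + 1| := by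
        rw [← abs_mul]; exact le_abs_self _
    _ ≤ ((|(S.κ:ℝ)| + 1) * (n+1)) * ((|(S.κ:ℝ)| + 1) * (n+1)) := by gcongr
    _ = _ := by ring

def Q (i n : ℕ) (r : ℝ) : ℝ := (n + 1) ^ 2 * S.ah i (n+1) r + S.lam n * S.ah i n r

lemma Q_nonneg (i n : ℕ) (r : ℝ) : 0 ≤ S.Q i n r :=
  add_nonneg (mul_nonneg (by positivity) (S.ah_nonneg _ _ _)) (mul_nonneg (S.lam_nonneg n) (S.ah_nonneg _ _ _))

lemma gb_Q {i : ℕ} {r : ℝ} (h : GB (fun n => S.ah i n r)) : GB (fun n => S.Q i n r) := by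
  have h1 := gb_succ.mul gb_succ (fun n => by positivity)
  refine ((h1.mul h.shift (fun n => S.ah_nonneg _ _ _)).add (S.gb_lam.mul h (fun n => S.ah_nonneg _ _ _))).mono
    (fun n => le_of_eq ?_)
  simp only [Q]; ring

lemma e_eq (i n : ℕ) (r : ℝ) : S.e i n r / (n.factorial : ℝ) ^ 2 = S.Q i n r - S.mu r * S.ah (i+1) n r := by
  unfold e Q
  rw [S.a_eq i (n+1), S.a_eq i n, S.a_eq (i+1) n, Nat.factorial_succ]
  push_cast
  field_simp

lemma hb_ii (K : ℝ) (i n : ℕ) {α β : ℝ} (hα : S.ra < α) (hab : α ≤ β) :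
    IntervalIntegrable (fun r => K ^ n + S.Sg K i n r) volume α β :=
  (ii_const _ _ _).add ((S.Sg_cont K i n hα).intervalIntegrable_of_Icc hab)

lemma hb_nonneg {K : ℝ} (hK : 0 ≤ K) (i n : ℕ) (r : ℝ) : 0 ≤ K ^ n + S.Sg K i n r :=
  add_nonneg (by positivity) (S.Sg_nonneg hK i n r)

lemma A1 (i : ℕ) {r1 R1 : ℝ} (h1 : S.ra < r1) (h2 : r1 < S.re) (h3 : S.re < R1)
    (hi : ∀ r ∈ Icc r1 R1, 2 ≤ (2 * i + 1) * S.mu' r + 2 * (S.b r).re) :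
    ∃ C K : ℝ, 0 ≤ C ∧ 1 ≤ K ∧ ∀ n,
      (∫ r in r1..R1, S.ah (i+1) n r ≤ S.Q i n R1 + C * ∫ r in r1..R1, (K ^ n + S.Sg K i n r)) ∧
      (∫ r in r1..R1, S.ah i (n+1) r ≤ C * (S.Q i n R1 + C * ∫ r in r1..R1, (K ^ n + S.Sg K i n r))) := by
  obtain ⟨C, K, hC, hK, hH⟩ := S.H_bound i (α := r1) (β := R1) h1
  obtain ⟨M, hM0, hM⟩ := S.b_bdd i r1 R1
  have hab : r1 ≤ R1 := by linarith
  have hK0 : 0 ≤ K := by linarith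
  let C' := max C (R1 - r1 + M)
  have hCC : C ≤ C' := le_max_left _ _
  have hC' : 0 ≤ C' := hC.trans hCC
  refine ⟨C', K, hC', hK, fun n => ?_⟩
  have hf : (0:ℝ) < (n.factorial : ℝ) ^ 2 := by positivity
  have hii := S.hb_ii K i n h1 hab
  have hi0 : 0 ≤ ∫ r in r1..R1, (K ^ n + S.Sg K i n r) :=
    intervalIntegral.integral_nonneg hab (fun r _ => S.hb_nonneg hK0 i n r)
  have hpt : ∀ x ∈ Icc r1 R1, S.ah (i+1) n x - C * (K ^ n + S.Sg K i n x) ≤ 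
      (((2 * i + 1) * S.mu' x + 2 * (S.b x).re) * S.a (i+1) n x
      - 2 * Bf (S.κ + n) (S.hh i n x) (S.G (i+1) n x)) / (n.factorial : ℝ) ^ 2 := by
    intro x hx
    have hx' := h1.trans_le hx.1
    have y := Bf_young (S.wb_hh i n hx') (S.wbG (i+1) n hx') (ε := 1/2) (by norm_num)
    rw [le_div_iff₀ hf]
    have y1 := (abs_le.1 y).2
    have y2 := hH n x hx
    have y3 := mul_le_mul_of_nonneg_right (hi x hx) (S.a_nonneg (i+1) n x)
    have y4 := S.a_eq (i+1) n x
    unfold H at y2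
    have y5 : Bf (S.κ + n) (S.G (i+1) n x) (S.G (i+1) n x) = S.a (i+1) n x := rfl
    rw [y5] at y1
    norm_num at y1
    linarith
  have hW : ∀ r ∈ Icc r1 R1, (∫ x in r..R1, S.ah (i+1) n x) - C * (∫ x in r..R1, (K ^ n + S.Sg K i n x))
      ≤ S.Q i n R1 - (S.Q i n r - S.mu r * S.ah (i+1) n r) := by
    intro r hr
    have hr' := h1.trans_le hr.1
    have := ftc_le (a := r) (b := R1) hr.2 (Φ := fun r => S.e i n r / (n.factorial : ℝ) ^ 2)
      (fun x hx => (S.e_deriv i n (hr'.trans_le hx.1)).div_const _)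
      (φ := fun x => S.ah (i+1) n x - C * (K ^ n + S.Sg K i n x)) 
      ((S.ah_cont' (i+1) n hr').sub (continuousOn_const.mul (continuousOn_const.add (S.Sg_cont K i n hr'))))
      (fun x hx => hpt x ⟨hr.1.trans hx.1, hx.2⟩)
    rw [intervalIntegral.integral_sub (S.ah_ii _ _ hr' hr.2) ((S.hb_ii K i n hr' hr.2).const_mul C),
      intervalIntegral.integral_const_mul] at this
    simp only [S.e_eq] at this
    refine this.trans ?_
    have p1 : 0 ≤ S.mu R1 * S.ah (i+1) n R1 := by
      refine mul_nonneg ?_ (S.ah_nonneg _ _ _)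
      exact mul_nonneg (by linarith [S.hC]) (by linarith)
    linarith
  have first : ∫ r in r1..R1, S.ah (i+1) n r ≤ S.Q i n R1 + C * ∫ r in r1..R1, (K ^ n + S.Sg K i n r) := by
    have := hW r1 ⟨le_rfl, hab⟩
    have q1 := S.Q_nonneg i n r1
    have q2 : S.mu r1 * S.ah (i+1) n r1 ≤ 0 := by
      refine mul_nonpos_of_nonpos_of_nonneg ?_ (S.ah_nonneg _ _ _)
      exact mul_nonpos_of_nonneg_of_nonpos (by linarith [S.hC]) (by linarith)
    linarith
  have hCC' := mul_le_mul_of_nonneg_right hCC hi0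
  set I := ∫ r in r1..R1, (K ^ n + S.Sg K i n r)
  have first' : ∫ r in r1..R1, S.ah (i+1) n r ≤ S.Q i n R1 + C' * I := by linarith
  refine ⟨first', ?_⟩
  have hsec : ∀ r ∈ Icc r1 R1, S.ah i (n+1) r ≤ (S.Q i n R1 + C' * I) + M * S.ah (i+1) n r := by
    intro r hr
    have hr' := h1.trans_le hr.1
    have w := hW r hr
    have w1 : 0 ≤ ∫ x in r..R1, S.ah (i+1) n x :=
      intervalIntegral.integral_nonneg hr.2 (fun x _ => S.ah_nonneg _ _ _)
    have w2 : ∫ x in r..R1, (K ^ n + S.Sg K i n x) ≤ I := by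
      refine intervalIntegral.integral_mono_interval hr.1 hr.2 le_rfl ?_ hii
      exact Filter.Eventually.of_forall (fun x => S.hb_nonneg hK0 i n x)
    have w3 := mul_le_mul_of_nonneg_left w2 hC
    have w4 := mul_le_mul_of_nonneg_right (abs_le.1 (hM r hr).1).2 (S.ah_nonneg (i+1) n r)
    have w5 : S.ah i (n+1) r ≤ S.Q i n r := by
      unfold Q
      have := mul_nonneg (S.lam_nonneg n) (S.ah_nonneg i n r)
      have h6 : (1:ℝ) ≤ ((n:ℝ)+1)^2 := one_le_pow₀ (by linarith [(Nat.cast_nonneg n : (0:ℝ) ≤ n)])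
      have := mul_le_mul_of_nonneg_right h6 (S.ah_nonneg i (n+1) r)
      linarith
    linarith
  have hint := intervalIntegral.integral_mono_on hab (S.ah_ii i (n+1) h1 hab)
    ((ii_const _ _ _).add ((S.ah_ii (i+1) n h1 hab).const_mul M)) hsec
  rw [intervalIntegral.integral_add (ii_const _ _ _) ((S.ah_ii (i+1) n h1 hab).const_mul M),
    intervalIntegral.integral_const, intervalIntegral.integral_const_mul, smul_eq_mul] at hint
  refine hint.trans ?_
  have z1 := mul_le_mul_of_nonneg_left first' hM0
  have z2 : 0 ≤ S.Q i n R1 + C' * I := by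
    have := S.Q_nonneg i n R1
    positivity
  have z3 := mul_le_mul_of_nonneg_right (le_max_right C (R1 - r1 + M)) z2
  change _ ≤ C' * _ at z3
  linarith

lemma A2 (i : ℕ) {r1 R1 : ℝ} (h1 : S.ra < r1) (hab : r1 ≤ R1) : ∃ C : ℝ, 0 ≤ C ∧ ∀ n,
    ∫ r in r1..R1, S.ah i n r ≤ C * (S.ah i n R1 + ∫ r in r1..R1, S.ah (i+1) n r) := by
  refine ⟨(R1 - r1) * exp (R1 - r1), mul_nonneg (by linarith) (exp_pos _).le, fun n => ?_⟩
  have hpt : ∀ r ∈ Icc r1 R1, S.ah i n r ≤ exp (R1 - r1) * (S.ah i n R1 + ∫ r in r1..R1, S.ah (i+1) n r) := by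
    intro r hr
    have hr' := h1.trans_le hr.1
    have hI : ∫ x in r..R1, S.ah (i+1) n x ≤ ∫ r in r1..R1, S.ah (i+1) n r := by
      refine intervalIntegral.integral_mono_interval hr.1 hr.2 le_rfl ?_ (S.ah_ii _ _ h1 hab)
      exact Filter.Eventually.of_forall (fun x => S.ah_nonneg _ _ x)
    have hI0 : 0 ≤ ∫ x in r..R1, S.ah (i+1) n x :=
      intervalIntegral.integral_nonneg hr.2 (fun x _ => S.ah_nonneg _ _ _)
    have := ftc_le (a := r) (b := R1) hr.2 (Φ := fun x => exp (x - r) * S.ah i n x)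
      (fun x hx => (((hasDerivAt_id x).sub_const r).exp).mul (S.ah_deriv i n (hr'.trans_le hx.1)))
      (φ := fun x => -exp (R1 - r) * S.ah (i+1) n x)
      (continuousOn_const.mul (S.ah_cont' (i+1) n hr'))
      (fun x hx => by
        have := (abs_le.1 (S.ah_deriv_le i n (hr'.trans_le hx.1))).1
        have e1 : exp (x - r) ≤ exp (R1 - r) := exp_le_exp.2 (by linarith [hx.2])
        have e2 := mul_le_mul_of_nonneg_right e1 (S.ah_nonneg (i+1) n x)
        have e3 := mul_le_mul_of_nonneg_left this (exp_pos (x - r)).le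
        simp
        linarith)
    rw [intervalIntegral.integral_const_mul] at this
    simp at this
    have e4 : exp (R1 - r) ≤ exp (R1 - r1) := exp_le_exp.2 (by linarith [hr.1])
    have e5 := mul_le_mul e4 (add_le_add_right hI (S.ah i n R1)) (add_nonneg (S.ah_nonneg _ _ _) hI0) (exp_pos _).le
    linarith
  have := intervalIntegral.integral_mono_on hab (S.ah_ii i n h1 hab) (ii_const _ _ _) hpt
  rw [intervalIntegral.integral_const, smul_eq_mul] at this
  linarith

lemma A_all {r1 R1 : ℝ} (h1 : S.ra < r1) (hm : S.rC + S.re < 2 * r1) (h2 : r1 < S.re) (h3 : S.re < R1) :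
    ∀ i, S.LB i r1 R1 := by
  have hab : r1 ≤ R1 := by linarith
  obtain ⟨M, hM0, hM⟩ := S.b_bdd 0 r1 R1
  let d := 2 * r1 - S.rC - S.re
  have hd : 0 < d := by simp only [d]; linarith
  obtain ⟨j0, hj0⟩ := exists_nat_gt ((2 + 2 * M) / d)
  have hj : ∀ i ≥ j0, ∀ r ∈ Icc r1 R1, 2 ≤ (2 * (i:ℝ) + 1) * S.mu' r + 2 * (S.b r).re := by
    intro i hi r hr
    have e1 : d ≤ S.mu' r := by simp only [d, mu']; linarith [hr.1]
    have e2 := (abs_le.1 ((Complex.abs_re_le_norm _).trans (hM r hr).2.2.1)).1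
    have e3 : (2 + 2 * M) < i * d := by
      rw [div_lt_iff₀ hd] at hj0
      have : (j0:ℝ) ≤ i := by exact_mod_cast hi
      nlinarith
    have e4 : (2 * (i:ℝ) + 1) * d ≤ (2 * (i:ℝ) + 1) * S.mu' r := by gcongr
    have : (0:ℝ) ≤ i := Nat.cast_nonneg i
    nlinarith
  have hR : ∀ i, GB (fun n => S.ah i n R1) := fun i =>
    S.UB_at (S.ext_UB i h3 (by linarith : R1 < R1 + 1)) ⟨le_rfl, by linarith⟩
  -- downward
  have down : ∀ d i, i + d = j0 → ∃ (U : ℕ → ℝ) (D : ℝ), GB U ∧ 0 ≤ D ∧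
      ∀ n, ∫ r in r1..R1, S.ah i n r ≤ U n + D * ∫ r in r1..R1, S.ah j0 n r := by
    intro d
    induction d with
    | zero =>
      intro i hi
      obtain rfl : i = j0 := by omega
      exact ⟨fun _ => 0, 1, gb_const 0, zero_le_one, fun n => by simp⟩
    | succ d ih =>
      intro i hi
      obtain ⟨U, D, hU, hD, h⟩ := ih (i+1) (by omega)
      obtain ⟨C, hC, hh⟩ := S.A2 i h1 hab
      refine ⟨fun n => C * (S.ah i n R1 + U n), C * D, ((hR i).add hU).cmul hC, by positivity, fun n => ?_⟩
      refine (hh n).trans ?_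
      have := mul_le_mul_of_nonneg_left (h n) hC
      linarith
  have down' : ∀ p : ℕ × ℕ, ∃ (U : ℕ → ℝ) (D : ℝ), GB U ∧ 0 ≤ D ∧ (p ∈ ad j0 →
      ∀ n, ∫ r in r1..R1, S.ah p.2 n r ≤ U n + D * ∫ r in r1..R1, S.ah j0 n r) := by
    intro p
    by_cases hp : p ∈ ad j0
    · have hp' := Finset.HasAntidiagonal.mem_antidiagonal.1 hp
      obtain ⟨U, D, hU, hD, h⟩ := down p.1 p.2 (by omega)
      exact ⟨U, D, hU, hD, fun _ => h⟩
    · exact ⟨fun _ => 0, 0, gb_const 0, le_rfl, fun h => absurd h hp⟩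
  choose U D hU hD hUD using down'
  obtain ⟨C, K, hC, hK, hA⟩ := S.A1 j0 h1 h2 h3 (hj j0 le_rfl)
  let T : ℕ → ℝ := fun n => ∑ p ∈ ad j0, ∫ r in r1..R1, S.ah p.2 n r
  have hpos : ∀ i n, 0 ≤ ∫ r in r1..R1, S.ah i n r := fun i n =>
    intervalIntegral.integral_nonneg hab (fun r _ => S.ah_nonneg i n r)
  let Ds := ∑ p ∈ ad j0, D p
  have hDs : 0 ≤ Ds := Finset.sum_nonneg (fun p _ => hD p)
  have hT : GB T := by
    refine gb_seq (K := K) (M := Ds * C * C)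
      (U := fun n => (∑ p ∈ ad j0, U p (n+1)) + (Ds * C) * (S.Q j0 n R1 + C * ((R1 - r1) * K ^ n)))
      (fun n => Finset.sum_nonneg (fun p _ => hpos _ _)) hK (by positivity) ?_ (fun n => ?_)
    · refine (gb_sum _ (fun p _ => (hU p).shift)).add (GB.cmul ?_ (by positivity))
      exact (S.gb_Q (hR j0)).add (((gb_pow K).cmul (by linarith)).cmul hC)
    · have t1 : T (n+1) ≤ (∑ p ∈ ad j0, U p (n+1)) + Ds * ∫ r in r1..R1, S.ah j0 (n+1) r := by
        simp only [T, Ds]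
        rw [Finset.sum_mul, ← Finset.sum_add_distrib]
        exact Finset.sum_le_sum (fun p hp => hUD p hp (n+1))
      have t2 := (hA n).2
      rw [S.int_Sg K j0 n h1 hab, Finset.sum_comm] at t2
      simp only [← Finset.mul_sum] at t2
      have t3 := mul_le_mul_of_nonneg_left t2 hDs
      show T (n+1) ≤ _
      refine t1.trans ((add_le_add_right t3 _).trans (le_of_eq ?_))
      simp only [T]
      ring
  have low : ∀ i ≤ j0, S.LB i r1 R1 := by
    intro i hi
    refine hT.mono (fun n => ?_)
    exact Finset.single_le_sum (f := fun p : ℕ × ℕ => ∫ r in r1..R1, S.ah p.2 n r) (a := (j0 - i, i))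
      (fun p _ => hpos _ _) (by simp; omega)
  intro i
  induction i using Nat.strong_induction_on with
  | _ i ih =>
    rcases le_or_gt i j0 with h | h
    · exact low i h
    · obtain ⟨i, rfl⟩ : ∃ k, i = k + 1 := ⟨i - 1, by omega⟩
      obtain ⟨C, K, hC, hK, hA⟩ := S.A1 i h1 h2 h3 (hj i (by omega))
      refine GB.mono ((S.gb_Q (hR i)).add ((S.gb_int_Sg (by linarith) i h1 hab
        (fun j hj => ih j (by omega))).cmul hC)) (fun n => (hA n).1)

end Sys
end KerrAux
end

section
namespace KerrAux
open MeasureTheory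
namespace Sys
variable (S : Sys)

lemma B_all {r0 r1 : ℝ} (h1 : S.ra < r0) (h01 : r0 < r1) (h2 : r1 < S.re)
    (hR0 : GB (fun n => S.ah 0 n r1)) (hR1 : GB (fun n => S.ah 1 n r1)) :
    S.UB 0 r0 r1 ∧ S.UB 1 r0 r1 := by
  obtain ⟨C, K, hC, hK, hH⟩ := S.H_bound 0 (α := r0) (β := r1) h1
  obtain ⟨M, hM0, hM⟩ := S.b_bdd 0 r0 r1
  have hab : r0 ≤ r1 := h01.le
  have hK0 : 0 ≤ K := by linarith
  let δ := (r0 - S.rC) * (S.re - r1)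
  have hδ : 0 < δ := mul_pos (by linarith [S.hC]) (by linarith)
  have hmu : ∀ r ∈ Icc r0 r1, δ ≤ - S.mu r := by
    intro r hr
    simp only [δ, mu]
    have := mul_le_mul (sub_le_sub_right hr.1 S.rC) (sub_le_sub_left hr.2 S.re) (by linarith)
      (by linarith [S.hC, hr.1])
    linarith
  let Lc := (3 * M + 1) / δ
  have hL : 0 ≤ Lc := by positivity
  let E := exp (Lc * (r1 - r0))
  let ê : ℕ → ℝ → ℝ := fun n r => S.e 0 n r / (n.factorial : ℝ) ^ 2
  have hê : ∀ n r, ê n r = S.Q 0 n r - S.mu r * S.ah 1 n r := fun n r => S.e_eq 0 n r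
  have hê1 : ∀ n, ∀ r ∈ Icc r0 r1, S.Q 0 n r + δ * S.ah 1 n r ≤ ê n r := by
    intro n r hr
    rw [hê]
    have := mul_le_mul_of_nonneg_right (hmu r hr) (S.ah_nonneg 1 n r)
    linarith
  have hmain : ∀ n, ∀ r ∈ Icc r0 r1, ê n r ≤ E * (ê n r1 + C * ∫ x in r0..r1, (K ^ n + S.Sg K 0 n x)) := by
    intro n r hr
    have hr' := h1.trans_le hr.1
    have hf : (0:ℝ) < (n.factorial : ℝ) ^ 2 := by positivity
    have hpt : ∀ x ∈ Icc r0 r1, - (Lc * ê n x) - C * (K ^ n + S.Sg K 0 n x) ≤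
      (((2 * (0:ℕ) + 1) * S.mu' x + 2 * (S.b x).re) * S.a (0+1) n x
      - 2 * Bf (S.κ + n) (S.hh 0 n x) (S.G (0+1) n x)) / (n.factorial : ℝ) ^ 2 := by
      intro x hx
      have hx' := h1.trans_le hx.1
      have y := Bf_young (S.wb_hh 0 n hx') (S.wbG (0+1) n hx') (ε := 1/2) (by norm_num)
      rw [le_div_iff₀ hf]
      have y1 := (abs_le.1 y).2
      have y2 := hH n x hx
      have y4 := S.a_eq (0+1) n x
      unfold H at y2
      have y5 : Bf (S.κ + n) (S.G (0+1) n x) (S.G (0+1) n x) = S.a (0+1) n x := rfl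
      rw [y5] at y1
      norm_num at y1
      have m1 := (abs_le.1 (hM x hx).2.1).1
      have m2 := (abs_le.1 ((Complex.abs_re_le_norm _).trans (hM x hx).2.2.1)).1
      have y6 := mul_le_mul_of_nonneg_right (by linarith : -(3 * M) ≤ S.mu' x + 2 * (S.b x).re) (S.a_nonneg (0+1) n x)
      have y7 : (3 * M + 1) * S.ah 1 n x ≤ Lc * ê n x := by
        have e1 : (3 * M + 1) * S.ah 1 n x = Lc * (δ * S.ah 1 n x) := by
          simp only [Lc]; field_simp
        rw [e1]
        refine mul_le_mul_of_nonneg_left ?_ hL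
        linarith [hê1 n x hx, S.Q_nonneg 0 n x]
      have y8 := mul_le_mul_of_nonneg_right y7 hf.le
      simp at y4 y6 y1 ⊢
      rw [y4] at y6 y1 ⊢
      linarith
    have hii := S.hb_ii K 0 n h1 hab
    have := ftc_le (a := r) (b := r1) hr.2 (Φ := fun x => exp (Lc * (x - r)) * ê n x)
      (fun x hx => ((((hasDerivAt_id x).sub_const r).const_mul Lc).exp).mul
        ((S.e_deriv 0 n (hr'.trans_le hx.1)).div_const ((n.factorial : ℝ) ^ 2)))
      (φ := fun x => -E * (C * (K ^ n + S.Sg K 0 n x)))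
      (continuousOn_const.mul (continuousOn_const.mul (continuousOn_const.add (S.Sg_cont K 0 n hr'))))
      (fun x hx => by
        have p := hpt x ⟨hr.1.trans hx.1, hx.2⟩
        have e1 : exp (Lc * (x - r)) ≤ E := exp_le_exp.2 (by
          refine mul_le_mul_of_nonneg_left ?_ hL
          linarith [hx.2, hr.1])
        have e2 := mul_le_mul_of_nonneg_right e1 (mul_nonneg hC (S.hb_nonneg hK0 0 n x))
        have e3 := mul_le_mul_of_nonneg_left p (exp_pos (Lc * (x - r))).le
        simp only [id] at e3 ⊢
        linarith)
    rw [intervalIntegral.integral_const_mul, intervalIntegral.integral_const_mul] at this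
    simp only [sub_self, mul_zero, exp_zero, one_mul] at this
    have hI : ∫ x in r..r1, (K ^ n + S.Sg K 0 n x) ≤ ∫ x in r0..r1, (K ^ n + S.Sg K 0 n x) := by
      refine intervalIntegral.integral_mono_interval hr.1 hr.2 le_rfl ?_ hii
      exact Filter.Eventually.of_forall (fun x => S.hb_nonneg hK0 0 n x)
    have hE0 : 0 < E := exp_pos _
    have e1 : exp (Lc * (r1 - r)) ≤ E := exp_le_exp.2 (by
          refine mul_le_mul_of_nonneg_left ?_ hL
          linarith [hr.1])
    have e0 : 0 ≤ ê n r1 := by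
      have := hê1 n r1 ⟨hab, le_rfl⟩
      have := S.Q_nonneg 0 n r1
      have := mul_nonneg hδ.le (S.ah_nonneg 1 n r1)
      linarith
    have e2 := mul_le_mul_of_nonneg_right e1 e0
    have e3 := mul_le_mul_of_nonneg_left hI (by positivity : 0 ≤ E * C)
    linarith
  have hE0 : 0 < E := exp_pos _
  have gr1 : GB (fun n => ê n r1) := by
    have := (S.gb_Q hR0).add (hR1.cmul (by linarith [hmu r1 ⟨hab, le_rfl⟩] : 0 ≤ - S.mu r1))
    refine this.mono (fun n => ?_)
    rw [hê]; linarith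
  have hle : ∀ n, ∀ r ∈ Icc r0 r1, S.ah 0 (n+1) r ≤ ê n r := by
    intro n r hr
    have := hê1 n r hr
    have h4 := mul_nonneg hδ.le (S.ah_nonneg 1 n r)
    unfold Q at this
    have h5 := mul_nonneg (S.lam_nonneg n) (S.ah_nonneg 0 n r)
    have h6 : (1:ℝ) ≤ ((n:ℝ)+1)^2 := one_le_pow₀ (by linarith [(Nat.cast_nonneg n : (0:ℝ) ≤ n)])
    have := mul_le_mul_of_nonneg_right h6 (S.ah_nonneg 0 (n+1) r)
    linarith
  have lb0 : S.LB 0 r0 r1 := by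
    refine gb_seq (K := K) (M := (r1 - r0) * E * C)
      (U := fun n => ((r1 - r0) * E) * (ê n r1 + C * ((r1 - r0) * K ^ n)))
      (fun n => intervalIntegral.integral_nonneg hab (fun r _ => S.ah_nonneg 0 n r)) hK 
      (mul_nonneg (mul_nonneg (by linarith) hE0.le) hC) ?_ (fun n => ?_)
    · exact (gr1.add (((gb_pow K).cmul (by linarith)).cmul hC)).cmul (mul_nonneg (by linarith) hE0.le)
    · have := intervalIntegral.integral_mono_on hab (S.ah_ii 0 (n+1) h1 hab) (ii_const _ _ _)
        (fun r hr => (hle n r hr).trans (hmain n r hr))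
      rw [intervalIntegral.integral_const, smul_eq_mul, S.int_Sg K 0 n h1 hab] at this
      refine this.trans (le_of_eq ?_)
      simp [ad]
      ring
  have ub1 : S.UB 1 r0 r1 := by
    have g := ((gr1.add ((S.gb_int_Sg hK0 0 h1 hab (fun j hj => by
      obtain rfl : j = 0 := by omega
      exact lb0)).cmul hC)).cmul hE0.le).cmul (inv_nonneg.2 hδ.le)
    obtain ⟨A, C', hA, hC', h⟩ := g
    refine ⟨A, C', hA, hC', fun n r hr => le_trans ?_ (h n)⟩
    show S.ah 1 n r ≤ δ⁻¹ * (E * (ê n r1 + C * _))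
    rw [inv_mul_eq_div, le_div_iff₀ hδ]
    have := hê1 n r hr
    have := hmain n r hr
    have := S.Q_nonneg 0 n r
    linarith
  exact ⟨S.UB_of_LB h1 h01 lb0 (S.LB_of_UB h1 hab ub1), ub1⟩

def PB (i : ℕ) (α β δ : ℝ) : Prop := ∃ A C : ℝ, 0 ≤ A ∧ 1 ≤ C ∧ ∀ n, ∀ r ∈ Icc α β, ∀ y ∈ Icc (-δ) δ,
  ‖S.G i n r y‖ ≤ A * C ^ n * n.factorial

lemma wt_low {κ : ℤ} {δ : ℝ} (hδ : 0 < δ) (hδ1 : δ < 1) (n : ℕ) {y : ℝ} (hy : y ∈ Icc (-δ) δ) :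
    (1 - δ ^ 2) ^ (κ.natAbs + n) ≤ wt (κ + n) y := by
  have h1 : 1 - δ ^ 2 ≤ 1 - y ^ 2 := by nlinarith [hy.1, hy.2]
  have h0 : 0 < 1 - δ ^ 2 := by nlinarith
  have h2 : 1 - y ^ 2 ≤ 1 := by nlinarith [sq_nonneg y]
  calc (1 - δ ^ 2) ^ (κ.natAbs + n) ≤ (1 - y ^ 2) ^ (κ.natAbs + n) := pow_le_pow_left₀ h0.le h1 _
    _ = (1 - y ^ 2) ^ ((κ.natAbs + n : ℕ) : ℤ) := by rw [zpow_natCast]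
    _ ≤ (1 - y ^ 2) ^ (κ + n) := by
      refine zpow_le_zpow_right_of_le_one₀ (by linarith) h2 ?_
      push_cast
      have := le_abs_self κ
      linarith
    _ = wt (κ + n) y := rfl

lemma PB_of_UB {i : ℕ} {α β δ : ℝ} (hα : S.ra < α) (hδ : 0 < δ) (hδ1 : δ < 1) (h : S.UB i α β) :
    S.PB i α β δ := by
  obtain ⟨A, C, hA, hC, h⟩ := h
  have h0 : 0 < 1 - δ ^ 2 := by nlinarith
  have hsub : Icc (-δ) δ ⊆ Ioo (-1:ℝ) 1 := fun y hy => ⟨by linarith [hy.1], by linarith [hy.2]⟩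
  let c := (1 - δ ^ 2)
  let J : ℕ → ℝ := fun n => (A * (c ^ S.κ.natAbs)⁻¹) * (C * c⁻¹) ^ n
  have hJ : GB J := (gb_pow _).cmul (by positivity)
  have hcn : ∀ n r, S.ra < r → ContinuousOn (fun y => ‖S.G i n r y‖ ^ 2) (Icc (-δ) δ) := fun n r hr =>
    ((cont_y S.jG i n hr).mono hsub).norm.pow 2
  have hint : ∀ n, ∀ r ∈ Icc α β, ∫ y in (-δ)..δ, ‖S.G i n r y‖ ^ 2 ≤ (n.factorial : ℝ) ^ 2 * J n := by
    intro n r hr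
    have hr' := hα.trans_le hr.1
    have hcp : 0 < c ^ (S.κ.natAbs + n) := by positivity
    have e1 : c ^ (S.κ.natAbs + n) * ∫ y in (-δ)..δ, ‖S.G i n r y‖ ^ 2 ≤ S.a i n r := by
      rw [← intervalIntegral.integral_const_mul, intervalIntegral.integral_of_le (by linarith),
        integral_Ioc_eq_integral_Ioo]
      unfold a
      rw [Bf_self]
      have hs : Ioo (-δ) δ ⊆ Ioo (-1:ℝ) 1 := fun y hy => ⟨by linarith [hy.1], by linarith [hy.2]⟩
      have bi := Bf_self_int (S.wbG i n hr')
      refine (setIntegral_mono_on ?_ (bi.mono_set hs) measurableSet_Ioo (fun y hy => ?_)).trans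
        (setIntegral_mono_set bi ?_ hs.eventuallyLE)
      · exact (((hcn n r hr').const_smul (c ^ (S.κ.natAbs + n))).integrableOn_Icc).mono_set Ioo_subset_Icc_self
      · exact mul_le_mul_of_nonneg_right (wt_low hδ hδ1 n (Ioo_subset_Icc_self hy)) (sq_nonneg _)
      · filter_upwards [ae_restrict_mem measurableSet_Ioo] with y hy
        exact mul_nonneg (wt_pos _ hy).le (sq_nonneg _)
    have e2 : S.a i n r ≤ (n.factorial : ℝ) ^ 2 * (A * C ^ n) := by
      rw [S.a_eq]
      have := h n r hr
      gcongr
    have e3 : (n.factorial : ℝ) ^ 2 * J n = (c ^ (S.κ.natAbs + n))⁻¹ * ((n.factorial : ℝ) ^ 2 * (A * C ^ n)) := by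
      simp only [J]
      rw [mul_pow, pow_add, mul_inv, inv_pow]; ring
    rw [e3, inv_mul_eq_div, le_div_iff₀ hcp]
    linarith
  have hG : GB (fun n => (1 / (2 * δ) + 1) * J n + ((n:ℝ)+1) * (n + 1) * J (n+1)) :=
    (hJ.cmul (by positivity)).add ((gb_succ.mul gb_succ (fun n => by positivity)).mul hJ.shift
      (fun n => by simp only [J]; positivity))
  obtain ⟨A', C', hA', hC', hB⟩ := hG
  refine ⟨A' + 1, C', by positivity, hC', fun n r hr y hy => ?_⟩
  have hr' := hα.trans_le hr.1
  have av := avg_le (a := -δ) (b := δ) (by linarith) (Φ := fun y => ‖S.G i n r y‖ ^ 2)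
    (ψ := fun y => ‖S.G i n r y‖ ^ 2 + ‖S.G i (n+1) r y‖ ^ 2) 
    (fun x hx => (S.jG.dy i n r x hr' (hsub hx)).norm_sq)
    ((hcn n r hr').add (hcn (n+1) r hr')) (fun x hx => by
      rw [abs_mul, abs_two]
      have := abs_real_inner_le_norm (S.G i n r x) (S.G i (n+1) r x)
      nlinarith [sq_nonneg (‖S.G i n r x‖ - ‖S.G i (n+1) r x‖)]) hy
  have hle : -δ ≤ δ := by linarith
  rw [intervalIntegral.integral_add ((hcn n r hr').intervalIntegrable_of_Icc hle)
    ((hcn (n+1) r hr').intervalIntegrable_of_Icc hle)] at av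
  have i1 := hint n r hr
  have i2 := hint (n+1) r hr
  rw [Nat.factorial_succ] at i2
  push_cast at i2
  have hbn := hB n
  have hf : (0:ℝ) < (n.factorial : ℝ) ^ 2 := by positivity
  have t1 : ‖S.G i n r y‖ ^ 2 ≤ (n.factorial : ℝ) ^ 2 * ((1 / (2 * δ) + 1) * J n + ((n:ℝ)+1) * (n + 1) * J (n+1)) := by
    refine le_of_mul_le_mul_left (a := 2 * δ) ?_ (by positivity)
    have e : 2 * δ * ((n.factorial : ℝ) ^ 2 * ((1 / (2 * δ) + 1) * J n + ((n:ℝ)+1) * (n + 1) * J (n+1))) =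
      (n.factorial : ℝ) ^ 2 * J n + 2 * δ * ((n.factorial : ℝ) ^ 2 * J n + (((n:ℝ)+1) * n.factorial) ^ 2 * J (n+1)) := by
      field_simp
      ring
    rw [e]
    have := mul_le_mul_of_nonneg_left (add_le_add i1 i2) (by positivity : 0 ≤ 2 * δ)
    linarith
  have t2 : ‖S.G i n r y‖ ^ 2 ≤ ((A' + 1) * C' ^ n * n.factorial) ^ 2 := by
    refine t1.trans ((mul_le_mul_of_nonneg_left hbn hf.le).trans ?_)
    have c1 : 1 ≤ C' ^ n := one_le_pow₀ hC'
    have c2 : A' * C' ^ n ≤ (A' + 1) ^ 2 * (C' ^ n) ^ 2 := by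
      have := mul_le_mul (by nlinarith : A' ≤ (A'+1)^2) (by nlinarith : C' ^ n ≤ (C' ^ n) ^ 2) (by positivity) (by positivity)
      exact this
    have := mul_le_mul_of_nonneg_left c2 hf.le
    refine this.trans (le_of_eq (by ring))
  exact (pow_le_pow_iff_left₀ (norm_nonneg _) (by positivity) two_ne_zero).1 t2

end Sys
end KerrAux
end

section
namespace KerrAux
open MeasureTheory

lemma abdd_pt {ra : ℝ} {κ : ℤ} {f : ℕ → ℕ → ℝ → ℝ → ℂ} (h : ABdd ra κ f) {α β δ : ℝ} (hα : ra < α)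
    (hδ : 0 < δ) (hδ1 : δ < 1) : ∃ A C : ℝ, 0 ≤ A ∧ 1 ≤ C ∧ ∀ i n : ℕ, ∀ r ∈ Icc α β, ∀ y ∈ Icc (-δ) δ,
      ‖f i n r y‖ ≤ A * C ^ (i + n) * i.factorial * n.factorial := by
  obtain ⟨A, C, hA, hC, h⟩ := h α β hα
  have h0 : 0 < 1 - δ ^ 2 := by nlinarith
  have h1 : 1 - δ ^ 2 ≤ 1 := by nlinarith
  refine ⟨A * ((1 - δ ^ 2) ^ κ.natAbs)⁻¹, C * (1 - δ ^ 2)⁻¹, by positivity,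
    one_le_mul_of_one_le_of_one_le hC ((one_le_inv₀ h0).2 h1), fun i n r hr y hy => ?_⟩
  have hb := h i n r hr y ⟨by linarith [hy.1], by linarith [hy.2]⟩
  have hw := Sys.wt_low (κ := κ) hδ hδ1 n hy
  set d := 1 - δ ^ 2
  have hd : 0 < d ^ (κ.natAbs + n) := by positivity
  have hd1 : d ^ (κ.natAbs + n) ≤ 1 := pow_le_one₀ h0.le h1
  have e1 : (d ^ (κ.natAbs + n) * ‖f i n r y‖) ^ 2 ≤ (A * C ^ (i + n) * i.factorial * n.factorial) ^ 2 := by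
    refine le_trans ?_ hb
    rw [mul_pow]
    refine mul_le_mul_of_nonneg_right (le_trans ?_ hw) (sq_nonneg _)
    nlinarith
  have e2 := (pow_le_pow_iff_left₀ (by positivity) (by positivity) two_ne_zero).1 e1
  have e3 : ‖f i n r y‖ ≤ (A * C ^ (i + n) * i.factorial * n.factorial) * (d ^ (κ.natAbs + n))⁻¹ := by
    rw [← div_eq_mul_inv, le_div_iff₀ hd]; linarith
  refine e3.trans ?_
  have e4 : (d ^ (κ.natAbs + n))⁻¹ ≤ (d ^ κ.natAbs)⁻¹ * (d⁻¹) ^ (i + n) := by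
    rw [pow_add, mul_inv, ← inv_pow d n]
    refine mul_le_mul_of_nonneg_left ?_ (by positivity)
    exact pow_le_pow_right₀ ((one_le_inv₀ h0).2 h1) (by omega)
  have e5 := mul_le_mul_of_nonneg_left e4 (by positivity : 0 ≤ A * C ^ (i + n) * i.factorial * n.factorial)
  refine e5.trans (le_of_eq ?_)
  rw [mul_pow]; ring

/-- the majorant -/
def W (A B C : ℝ) (i n : ℕ) : ℝ := A * B ^ i * C ^ n * ((2 * i + n).factorial / i.factorial)

lemma W_nonneg {A B C : ℝ} (hA : 0 ≤ A) (hB : 0 ≤ B) (hC : 0 ≤ C) (i n : ℕ) : 0 ≤ W A B C i n := by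
  unfold W; positivity

lemma W_n (A B C : ℝ) (i n : ℕ) : W A B C i (n+1) = C * (2 * i + n + 1) * W A B C i n := by
  unfold W
  rw [← add_assoc, Nat.factorial_succ]; push_cast; ring

lemma W_i (A B C : ℝ) (i n : ℕ) :
    (i + 1) * W A B C (i+1) n = B * ((2 * i + n + 2) * (2 * i + n + 1)) * W A B C i n := by
  unfold W
  have : 2 * (i + 1) + n = 2 * i + n + 1 + 1 := by ring
  rw [this, Nat.factorial_succ, Nat.factorial_succ, Nat.factorial_succ]; push_cast
  field_simp; ring

lemma W_i_le {A B C : ℝ} (hA : 0 ≤ A) (hB : 1 ≤ B) (hC : 0 ≤ C) (i n : ℕ) :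
    B * ((i:ℝ) + 1) * W A B C i n ≤ W A B C (i+1) n := by
  have h := W_i A B C i n
  have h0 := W_nonneg hA (zero_le_one.trans hB) hC i n
  have hi : (0:ℝ) < i + 1 := by positivity
  refine le_of_mul_le_mul_left ?_ hi
  rw [h]
  have : B * ((i + 1) * (i + 1)) * W A B C i n ≤ B * ((2 * i + n + 2) * (2 * i + n + 1)) * W A B C i n := by
    refine mul_le_mul_of_nonneg_right (mul_le_mul_of_nonneg_left ?_ (by linarith)) h0
    refine mul_le_mul ?_ ?_ (by positivity) (by positivity) <;> (have : (0:ℝ) ≤ n := by positivity) <;> nlinarith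
  linarith

lemma th_one (i n : ℕ) : i.factorial * (i.factorial * n.factorial) ≤ (2 * i + n).factorial := by
  have h1 := Nat.factorial_mul_factorial_dvd_factorial_add i (i + n)
  have h2 := Nat.factorial_mul_factorial_dvd_factorial_add i n
  have h3 := Nat.le_of_dvd (Nat.factorial_pos _) h1
  have h4 := Nat.le_of_dvd (Nat.factorial_pos _) h2
  rw [show 2 * i + n = i + (i + n) by ring]
  exact (Nat.mul_le_mul_left _ h4).trans h3

lemma W_low {A B C : ℝ} (hA : 0 ≤ A) (hB : 0 ≤ B) (hC : 0 ≤ C) (i n : ℕ) :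
    A * B ^ i * C ^ n * (i.factorial * n.factorial) ≤ W A B C i n := by
  unfold W
  refine mul_le_mul_of_nonneg_left ?_ (by positivity)
  rw [le_div_iff₀ (by positivity)]
  have := th_one i n
  have h2 : (i.factorial * (i.factorial * n.factorial) : ℝ) ≤ (2 * i + n).factorial := by exact_mod_cast this
  linarith

/-- normalized theta is monotone -/
def th (i n : ℕ) : ℝ := (2 * i + n).factorial / (i.factorial * i.factorial * n.factorial)

lemma th_mono_n (i : ℕ) : Monotone (th i) := by
  refine monotone_nat_of_le_succ (fun n => ?_)
  unfold th
  rw [div_le_div_iff₀ (by positivity) (by positivity), ← add_assoc, Nat.factorial_succ, Nat.factorial_succ]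
  push_cast
  have : (0:ℝ) ≤ (2 * i + n).factorial * (i.factorial * i.factorial * n.factorial) * (2 * i) := by positivity
  linarith

lemma th_mono_i (n : ℕ) : Monotone (fun i => th i n) := by
  refine monotone_nat_of_le_succ (fun i => ?_)
  unfold th
  have e : 2 * (i + 1) + n = 2 * i + n + 1 + 1 := by ring
  rw [div_le_div_iff₀ (by positivity) (by positivity), e, Nat.factorial_succ, Nat.factorial_succ, Nat.factorial_succ]
  push_cast
  have : (0:ℝ) ≤ (2 * i + n).factorial * (i.factorial * i.factorial * n.factorial) := by positivity
  have h2 : ((i:ℝ)+1) * (i + 1) ≤ (2 * i + n + 1 + 1) * (2 * i + n + 1) := by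
    refine mul_le_mul ?_ ?_ (by positivity) (by positivity) <;> (have : (0:ℝ) ≤ n := by positivity) <;> nlinarith
  have := mul_le_mul_of_nonneg_left h2 this
  linarith

lemma W_th (A B C : ℝ) (i n : ℕ) : W A B C i n = A * B ^ i * C ^ n * (i.factorial * n.factorial * th i n) := by
  unfold W th; field_simp

lemma W_up {A B C : ℝ} (hA : 0 ≤ A) (hB : 1 ≤ B) (hC : 1 ≤ C) (i n : ℕ) :
    W A B C i n ≤ A * (16 * B * C) ^ (i + n) * i.factorial * n.factorial := by
  have h1 : (2 * i + n).factorial ≤ 2 ^ (2 * i + n) * (2 ^ (2 * i) * (i.factorial * i.factorial)) * n.factorial := by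
    rw [← Nat.add_choose_mul_factorial_mul_factorial (2*i) n]
    refine Nat.mul_le_mul_right _ (Nat.mul_le_mul (Nat.choose_le_two_pow _ _) ?_)
    rw [two_mul i, ← Nat.add_choose_mul_factorial_mul_factorial i i, mul_assoc]
    exact Nat.mul_le_mul_right _ (Nat.choose_le_two_pow _ _)
  have h2 : (2 * i + n).factorial / (i.factorial : ℝ) ≤ 16 ^ (i+n) * (i.factorial * n.factorial) := by
    rw [div_le_iff₀ (by positivity)]
    have h3 : (2 ^ (2 * i + n) * 2 ^ (2 * i) : ℝ) ≤ 16 ^ (i + n) := by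
      rw [← pow_add, show (16:ℝ) = 2 ^ 4 by norm_num, ← pow_mul]
      exact pow_le_pow_right₀ (by norm_num) (by omega)
    have h4 : ((2 * i + n).factorial : ℝ) ≤ 2 ^ (2 * i + n) * (2 ^ (2 * i) * (i.factorial * i.factorial)) * n.factorial := by
      exact_mod_cast h1
    have := mul_le_mul_of_nonneg_right h3 (by positivity : (0:ℝ) ≤ i.factorial * i.factorial * n.factorial)
    linarith
  unfold W
  have hBC : B ^ i * C ^ n ≤ (B * C) ^ (i+n) := by
    rw [mul_pow]
    exact mul_le_mul (pow_le_pow_right₀ hB (by omega)) (pow_le_pow_right₀ hC (by omega)) (by positivity) (by positivity)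
  calc _ = A * (B ^ i * C ^ n) * ((2 * i + n).factorial / (i.factorial : ℝ)) := by ring
    _ ≤ A * (B * C) ^ (i + n) * (16 ^ (i+n) * (i.factorial * n.factorial)) := by gcongr
    _ = _ := by rw [mul_assoc 16, mul_pow 16]; ring

namespace Sys
variable (S : Sys)

lemma cG_W {α β δ : ℝ} (hα : S.ra < α) (hδ : 0 < δ) (hδ1 : δ < 1) : ∃ M K : ℝ, 0 ≤ M ∧ 1 ≤ K ∧
    ∀ A B C : ℝ, 0 ≤ A → K ≤ B → K ≤ C → ∀ i n : ℕ, ∀ r ∈ Icc α β, ∀ y ∈ Icc (-δ) δ,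
    (∀ j ≤ i, ∀ m, ‖S.G j m r y‖ ≤ W A B C j m) →
    ‖S.cG i n r y‖ ≤ M * ((2 * i + n + 2) * (2 * i + n + 1)) * W A B C i n := by
  obtain ⟨M, K, hM, hK, hc⟩ := abdd_pt S.ac (α := α) (β := β) hα hδ hδ1
  refine ⟨M, K, hM, hK, fun A B C hA hB hC i n r hr y hy hG => ?_⟩
  have hB0 : 0 ≤ B := by linarith
  have hC0 : 0 ≤ C := by linarith
  have hK0 : 0 ≤ K := by linarith
  have key : ∀ p ∈ ad i, ∀ q ∈ ad n, ‖(i.choose p.1 : ℂ) * ((n.choose q.1 : ℂ) *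
      (S.c p.1 q.1 r y * S.G p.2 q.2 r y))‖ ≤ M * W A B C i n := by
    intro p hp q hq
    have hp' := Finset.HasAntidiagonal.mem_antidiagonal.1 hp
    have hq' := Finset.HasAntidiagonal.mem_antidiagonal.1 hq
    rw [norm_mul, norm_mul, norm_mul, Complex.norm_natCast, Complex.norm_natCast]
    have h1 := hc p.1 q.1 r hr y hy
    have h2 := hG p.2 (by omega) q.2
    rw [W_th] at h2 ⊢
    have h3 : th p.2 q.2 ≤ th i n := (th_mono_n _ (by omega)).trans (th_mono_i n (by omega : p.2 ≤ i))
    have c1 : (i.choose p.1 : ℝ) * (p.1.factorial * p.2.factorial) = i.factorial := by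
      have := Nat.add_choose_mul_factorial_mul_factorial p.1 p.2
      rw [← Nat.choose_symm_add, hp'] at this
      rw [← this]; push_cast; ring
    have c2 : (n.choose q.1 : ℝ) * (q.1.factorial * q.2.factorial) = n.factorial := by
      have := Nat.add_choose_mul_factorial_mul_factorial q.1 q.2
      rw [← Nat.choose_symm_add, hq'] at this
      rw [← this]; push_cast; ring
    have hth : ∀ i n, 0 ≤ th i n := fun i n => by unfold th; positivity
    calc (i.choose p.1 : ℝ) * ((n.choose q.1 : ℝ) * (‖S.c p.1 q.1 r y‖ * ‖S.G p.2 q.2 r y‖))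
        ≤ (i.choose p.1 : ℝ) * ((n.choose q.1 : ℝ) * ((M * K ^ (p.1 + q.1) * p.1.factorial * q.1.factorial) *
          (A * B ^ p.2 * C ^ q.2 * (p.2.factorial * q.2.factorial * th p.2 q.2)))) := by
          gcongr
      _ = M * A * ((i.choose p.1 : ℝ) * (p.1.factorial * p.2.factorial)) * ((n.choose q.1 : ℝ) * (q.1.factorial * q.2.factorial)) *
          (K ^ p.1 * B ^ p.2) * (K ^ q.1 * C ^ q.2) * th p.2 q.2 := by
          rw [pow_add]; ring
      _ ≤ M * A * i.factorial * n.factorial * (B ^ p.1 * B ^ p.2) * (C ^ q.1 * C ^ q.2) * th i n := by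
          rw [c1, c2]
          have := hth p.2 q.2
          gcongr
      _ = _ := by
          rw [← pow_add, ← pow_add, hp', hq']; ring
  have h1 : ‖S.cG i n r y‖ ≤ ∑ p ∈ ad i, ∑ q ∈ ad n, M * W A B C i n := by
    unfold cG
    refine (norm_sum_le _ _).trans (Finset.sum_le_sum fun p hp => ?_)
    rw [Finset.mul_sum]
    exact (norm_sum_le _ _).trans (Finset.sum_le_sum fun q hq => key p hp q hq)
  refine h1.trans ?_
  have hW := W_nonneg hA hB0 hC0 i n
  simp only [Finset.sum_const, Finset.Nat.card_antidiagonal, nsmul_eq_mul]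
  push_cast
  have h2 : ((i:ℝ)+1) * (n + 1) ≤ (2 * i + n + 2) * (2 * i + n + 1) := by
    have : (0:ℝ) ≤ n := by positivity
    refine mul_le_mul ?_ ?_ (by positivity) (by positivity) <;> nlinarith
  have := mul_le_mul_of_nonneg_right h2 (mul_nonneg hM hW)
  linarith

set_option maxHeartbeats 1000000 in
lemma R_W {α β δ : ℝ} (hα : S.ra < α) (hδ : 0 < δ) (hδ1 : δ < 1) : ∃ M K A0 : ℝ, 0 ≤ M ∧ 1 ≤ K ∧ 0 ≤ A0 ∧
    ∀ A B C : ℝ, A0 ≤ A → K ≤ B → K ≤ C → ∀ i n : ℕ, ∀ r ∈ Icc α β, ∀ y ∈ Icc (-δ) δ,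
    (∀ j ≤ i, ∀ m, ‖S.G j m r y‖ ≤ W A B C j m) →
    ‖S.hh i n r y - S.L i n r y‖ ≤ M * C ^ 2 * ((2 * i + n + 2) * (2 * i + n + 1)) * W A B C i n := by
  obtain ⟨Mc, Kc, hMc, hKc, hc⟩ := S.cG_W (β := β) hα hδ hδ1
  obtain ⟨Af, Kf, hAf, hKf, hf⟩ := abdd_pt S.af (α := α) (β := β) hα hδ hδ1
  have hb' : ∃ N : ℝ, ∀ r ∈ Icc α β, ‖S.b' r‖ ≤ N := by
    refine isCompact_Icc.exists_bound_of_continuousOn ?_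
    unfold b'; fun_prop
  obtain ⟨N, hN⟩ := hb'
  set k : ℝ := |(S.κ:ℝ)| with hk
  have hk0 : 0 ≤ k := abs_nonneg _
  refine ⟨Mc + 1 + (1 + |N|) + ‖S.b2‖ + (1 + 2 * (k + 1) + (k+1)^2), max Kc Kf, Af, by positivity,
    hKc.trans (le_max_left _ _), hAf, fun A B C hA hB hC i n r hr y hy hG => ?_⟩
  have hKB := (le_max_left _ _).trans hB
  have hKC := (le_max_left _ _).trans hC
  have hfB := (le_max_right _ _).trans hB
  have hfC := (le_max_right _ _).trans hC
  have hA0 := hAf.trans hA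
  have hB0 : 1 ≤ B := by linarith
  have hC0 : 1 ≤ C := by linarith
  have hW := W_nonneg hA0 (by linarith : 0 ≤ B) (by linarith : 0 ≤ C) i n
  obtain ⟨w, hw⟩ : ∃ w, w = W A B C i n := ⟨_, rfl⟩
  obtain ⟨P, hP⟩ : ∃ P : ℝ, P = (2 * i + n + 2) * (2 * i + n + 1) := ⟨_, rfl⟩
  rw [← hw] at hW
  rw [← hw, ← hP]
  have hi0 : (0:ℝ) ≤ i := by positivity
  have hn0 : (0:ℝ) ≤ n := by positivity
  have hP1 : 1 ≤ P := by rw [hP]; nlinarith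
  have hPi : ((i:ℝ)+1) * (i+1) ≤ P := by rw [hP]; nlinarith [mul_nonneg hi0 hn0]
  have hPn : ((n:ℝ)+1) * (n+1) ≤ P := by rw [hP]; nlinarith [mul_nonneg hi0 hn0]
  have hC2 : 1 ≤ C ^ 2 := one_le_pow₀ hC0
  have hPw : P * w ≤ C ^ 2 * P * w := by
    rw [mul_assoc (C ^ 2)]; exact le_mul_of_one_le_left (mul_nonneg (zero_le_one.trans hP1) hW) hC2
  have hwP : w ≤ P * w := le_mul_of_one_le_left hW hP1
  -- f
  have t1 : ‖S.f i n r y‖ ≤ C ^ 2 * P * w := by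
    refine (hf i n r hr y hy).trans (le_trans ?_ (hwP.trans hPw))
    rw [hw]
    refine le_trans ?_ (W_low hA0 (by linarith) (by linarith) i n)
    rw [pow_add]
    have hKf0 : 0 ≤ Kf := by linarith
    calc _ = Af * Kf ^ i * Kf ^ n * (i.factorial * n.factorial) := by ring
      _ ≤ _ := by gcongr
  have t2 : ‖S.cG i n r y‖ ≤ Mc * (C ^ 2 * P * w) := by
    refine (hc A B C hA0 hKB hKC i n r hr y hy hG).trans ?_
    rw [← hw, ← hP, mul_assoc]
    exact mul_le_mul_of_nonneg_left hPw hMc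
  have t3 : ‖S.al i r * S.G i n r y‖ ≤ (1 + |N|) * (C ^ 2 * P * w) := by
    rw [norm_mul]
    have : ‖S.al i r‖ ≤ (1 + |N|) * P := by
      unfold al
      refine (norm_add_le _ _).trans ?_
      rw [norm_mul, norm_mul, Complex.norm_natCast]
      have e1 : ‖(i:ℂ) + 1‖ = i + 1 := by
        have := Complex.norm_natCast (i+1); push_cast at this; exact this
      rw [e1]
      have h1 := (hN r hr).trans (le_abs_self N)
      have h2 := mul_le_mul_of_nonneg_left h1 hi0
      have h3 : (i:ℝ) * |N| ≤ P * |N| := mul_le_mul_of_nonneg_right (by nlinarith) (abs_nonneg _)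
      nlinarith
    have := mul_le_mul this (hw ▸ hG i le_rfl n) (norm_nonneg _) (by positivity)
    refine this.trans ?_
    rw [mul_assoc]
    exact mul_le_mul_of_nonneg_left hPw (by positivity)
  have t4 : ‖S.be i * S.G (i-1) n r y‖ ≤ ‖S.b2‖ * (C ^ 2 * P * w) := by
    rcases Nat.eq_zero_or_pos i with h0 | h0
    · simp only [be, h0, Nat.cast_zero, zero_mul, norm_zero]
      positivity
    · obtain ⟨j, rfl⟩ : ∃ j, i = j + 1 := ⟨i - 1, by omega⟩
      have hj0 : (0:ℝ) ≤ j := by positivity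
      have h1 : W A B C j n ≤ w := by
        rw [hw]
        refine le_trans ?_ (W_i_le hA0 hB0 (by linarith) j n)
        refine le_mul_of_one_le_left (W_nonneg hA0 (by linarith) (by linarith) _ _) ?_
        exact one_le_mul_of_one_le_of_one_le hB0 (by linarith)
      have h2 : ‖S.be (j+1)‖ ≤ ‖S.b2‖ * P := by
        unfold be
        have e1 : ‖((j+1:ℕ):ℂ) * (((j+1:ℕ):ℂ) - 1) * S.b2‖ = (j+1) * j * ‖S.b2‖ := by
          rw [norm_mul, norm_mul, Complex.norm_natCast]
          push_cast
          rw [add_sub_cancel_right, Complex.norm_natCast]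
        rw [e1, mul_comm]
        push_cast at hPi
        refine mul_le_mul_of_nonneg_left (le_trans ?_ hPi) (norm_nonneg _)
        gcongr <;> linarith
      rw [norm_mul, Nat.add_sub_cancel]
      refine (mul_le_mul h2 ((hG j (by omega) n).trans h1) (norm_nonneg _) (by positivity)).trans ?_
      rw [mul_assoc]
      exact mul_le_mul_of_nonneg_left hPw (by positivity)
  have hy1 : |y| ≤ 1 := abs_le.2 ⟨by linarith [hy.1], by linarith [hy.2]⟩
  have t5 : ‖S.L i n r y‖ ≤ (1 + 2 * (k + 1) + (k+1)^2) * (C ^ 2 * P * w) := by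
    unfold L
    refine (norm_sub_le _ _).trans ((add_le_add_left (norm_sub_le _ _) _).trans ?_)
    rw [norm_mul, norm_mul, norm_mul, Complex.norm_real, Complex.norm_real, Complex.norm_real,
      Real.norm_eq_abs, Real.norm_eq_abs, Real.norm_eq_abs]
    have g1 := hG i le_rfl (n+1)
    have g2 := hG i le_rfl (n+1+1)
    rw [W_n] at g1 g2
    rw [W_n] at g2
    push_cast at g1 g2
    rw [← hw] at g1 g2
    have y1 : |1 - y^2| ≤ 1 := by
      rw [abs_le]; constructor <;> nlinarith [sq_abs y, abs_nonneg y]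
    have y2 : |2 * (((S.κ + n : ℤ):ℝ) + 1) * y| ≤ 2 * ((k+1) * (n+1)) := by
      rw [abs_mul, abs_mul, abs_two]
      have h1 : |((S.κ + n : ℤ):ℝ) + 1| ≤ k + n + 1 := by
        push_cast
        refine (abs_add_le _ _).trans ?_
        have := abs_add_le (S.κ:ℝ) n
        rw [abs_of_nonneg hn0] at this
        simp only [abs_one]; linarith
      have h2 : 2 * |((S.κ + n : ℤ):ℝ) + 1| * |y| ≤ 2 * |((S.κ + n : ℤ):ℝ) + 1| * 1 :=
        mul_le_mul_of_nonneg_left hy1 (by positivity)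
      nlinarith [mul_nonneg hk0 hn0]
    have y3 : |S.lam n| ≤ (k+1)^2 * P := by
      unfold lam
      rw [abs_mul]
      have h0 := abs_add_le (S.κ:ℝ) n
      have h1 := abs_add_le ((S.κ:ℝ) + n) 1
      rw [abs_of_nonneg hn0] at h0
      rw [abs_one] at h1
      have h2 : |(S.κ:ℝ) + n| ≤ (k+1) * (n+1) := by nlinarith [mul_nonneg hk0 hn0]
      have h3 : |(S.κ:ℝ) + n + 1| ≤ (k+1) * (n+1) := by nlinarith [mul_nonneg hk0 hn0]
      have h4 := mul_le_mul h2 h3 (abs_nonneg _) (by positivity)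
      refine h4.trans ?_
      have := mul_le_mul_of_nonneg_left hPn (sq_nonneg (k+1))
      linarith
    have z1 : |1 - y^2| * ‖S.G i (n+2) r y‖ ≤ 1 * (C ^ 2 * P * w) := by
      refine mul_le_mul y1 (g2.trans (le_of_eq ?_)) (norm_nonneg _) zero_le_one
      rw [hP]; ring
    have z2 : |2 * (((S.κ + n : ℤ):ℝ) + 1) * y| * ‖S.G i (n+1) r y‖ ≤ 2 * (k+1) * (C ^ 2 * P * w) := by
      refine (mul_le_mul y2 g1 (norm_nonneg _) (by positivity)).trans ?_
      have h1 : ((n:ℝ) + 1) * (2 * i + n + 1) ≤ P := by rw [hP]; nlinarith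
      have h2 : C * (((n:ℝ) + 1) * (2 * i + n + 1)) ≤ C ^ 2 * P :=
        mul_le_mul (by nlinarith) h1 (by positivity) (by positivity)
      have h3 := mul_le_mul_of_nonneg_right h2 hW
      have := mul_le_mul_of_nonneg_left h3 (by positivity : 0 ≤ 2 * (k+1))
      linarith
    have z3 : |S.lam n| * ‖S.G i n r y‖ ≤ (k+1)^2 * (C ^ 2 * P * w) := by
      refine (mul_le_mul y3 (hw ▸ hG i le_rfl n) (norm_nonneg _) (by positivity)).trans ?_
      rw [mul_assoc]
      exact mul_le_mul_of_nonneg_left hPw (by positivity)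
    linarith
  have hfin : ‖S.hh i n r y - S.L i n r y‖ ≤ ‖S.f i n r y‖ + ‖S.cG i n r y‖ + ‖S.al i r * S.G i n r y‖ +
      ‖S.be i * S.G (i-1) n r y‖ + ‖S.L i n r y‖ := by
    unfold hh
    refine (norm_sub_le _ _).trans (add_le_add_left ?_ _)
    refine (norm_sub_le _ _).trans (add_le_add_left ?_ _)
    refine (norm_sub_le _ _).trans (add_le_add_left ?_ _)
    exact norm_sub_le _ _
  refine hfin.trans ?_
  have : (Mc + 1 + (1 + |N|) + ‖S.b2‖ + (1 + 2 * (k + 1) + (k+1)^2)) * C ^ 2 * P * w =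
    Mc * (C ^ 2 * P * w) + 1 * (C ^ 2 * P * w) + (1 + |N|) * (C ^ 2 * P * w) + ‖S.b2‖ * (C ^ 2 * P * w) +
     (1 + 2 * (k + 1) + (k+1)^2) * (C ^ 2 * P * w) := by ring
  rw [this]; linarith

end Sys
end KerrAux
end

section
namespace KerrAux
open MeasureTheory
namespace Sys
variable (S : Sys)

lemma PB_fin {α β δ : ℝ} (N : ℕ) (h : ∀ i ≤ N, S.PB i α β δ) : ∃ A C : ℝ, 0 ≤ A ∧ 1 ≤ C ∧
    ∀ i ≤ N, ∀ n, ∀ r ∈ Icc α β, ∀ y ∈ Icc (-δ) δ, ‖S.G i n r y‖ ≤ A * C ^ n * n.factorial := by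
  induction N with
  | zero =>
    obtain ⟨A, C, hA, hC, h⟩ := h 0 le_rfl
    refine ⟨A, C, hA, hC, fun i hi => ?_⟩
    obtain rfl : i = 0 := by omega
    exact h
  | succ N ih =>
    obtain ⟨A, C, hA, hC, h1⟩ := ih (fun i hi => h i (by omega))
    obtain ⟨A', C', hA', hC', h2⟩ := h (N+1) le_rfl
    refine ⟨max A A', max C C', le_max_of_le_left hA, le_max_of_le_left hC, fun i hi n r hr y hy => ?_⟩
    have hA'' : 0 ≤ max A A' := le_max_of_le_left hA
    rcases Nat.lt_or_ge N i with hlt | hle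
    · obtain rfl : i = N + 1 := by omega
      refine (h2 n r hr y hy).trans ?_
      have := le_max_right A A'
      have := le_max_right C C'
      gcongr
    · refine (h1 i hle n r hr y hy).trans ?_
      have := le_max_left A A'
      have := le_max_left C C'
      gcongr

lemma base_W {A B C A' C' : ℝ} (hA' : 0 ≤ A') (hC' : 1 ≤ C') (hA : A' ≤ A) (hB : 1 ≤ B) (hC : C' ≤ C) (i n : ℕ) :
    A' * C' ^ n * n.factorial ≤ W A B C i n := by
  refine le_trans ?_ (W_low (hA'.trans hA) (by linarith) (by linarith) i n)
  have h1 : 1 ≤ B ^ i := one_le_pow₀ hB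
  have h2 : (1:ℝ) ≤ i.factorial := by exact_mod_cast Nat.one_le_iff_ne_zero.2 (Nat.factorial_ne_zero i)
  have hA0 : 0 ≤ A := hA'.trans hA
  calc A' * C' ^ n * n.factorial ≤ A * C ^ n * n.factorial := by gcongr
    _ = A * 1 * C ^ n * (1 * n.factorial) := by ring
    _ ≤ _ := by
      have hC0 : 0 ≤ C := by linarith
      gcongr

lemma inner_key {g g2 R bb : ℂ} {μ t : ℝ} (h : (μ:ℂ) * g2 + ((t:ℂ) + bb) * g = R)
    (hs : 0 ≤ μ * inner ℝ g g2) : (t - ‖bb‖) * ‖g‖ ≤ ‖R‖ := by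
  have h1 : inner ℝ g R = μ * inner ℝ g g2 + (t + bb.re) * ‖g‖ ^ 2 := by
    rw [← h, Complex.inner, Complex.inner, Complex.sq_norm, Complex.normSq_apply]
    simp; ring
  have h2 : inner ℝ g R ≤ ‖g‖ * ‖R‖ := real_inner_le_norm g R
  have h3 : -‖bb‖ ≤ bb.re := (abs_le.1 (Complex.abs_re_le_norm bb)).1
  rcases eq_or_lt_of_le (norm_nonneg g) with h0 | h0
  · rw [← h0]; simp
  · refine le_of_mul_le_mul_left ?_ h0
    have : (t - ‖bb‖) * ‖g‖ ^ 2 ≤ (t + bb.re) * ‖g‖ ^ 2 :=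
      mul_le_mul_of_nonneg_right (by linarith) (sq_nonneg _)
    nlinarith

lemma max_pt (i n : ℕ) {r1 R1 y : ℝ} (h1 : S.ra < r1) (h2 : r1 < S.re) (h3 : S.re < R1)
    (hy : y ∈ Ioo (-1:ℝ) 1) : ∃ r ∈ Icc r1 R1, (∀ s ∈ Icc r1 R1, ‖S.G i n s y‖ ≤ ‖S.G i n r y‖) ∧
      0 ≤ S.mu r * inner ℝ (S.G i n r y) (S.G (i+1) n r y) := by
  have hd : ∀ r ∈ Icc r1 R1, HasDerivAt (fun r => ‖S.G i n r y‖ ^ 2)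
      (2 * inner ℝ (S.G i n r y) (S.G (i+1) n r y)) r := fun r hr =>
    (S.jG.dr i n r y (h1.trans_le hr.1) hy).norm_sq
  obtain ⟨r, hr, hmax⟩ := isCompact_Icc.exists_isMaxOn (nonempty_Icc.2 (h2.trans h3).le)
    (fun r hr => (hd r hr).continuousAt.continuousWithinAt)
  refine ⟨r, hr, fun s hs => ?_, ?_⟩
  · have := hmax hs
    exact (pow_le_pow_iff_left₀ (norm_nonneg _) (norm_nonneg _) two_ne_zero).1 this
  · have hseg : segment ℝ r S.re ⊆ Icc r1 R1 := (convex_Icc r1 R1).segment_subset hr ⟨h2.le, h3.le⟩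
    have := hmax.localize.hasFDerivWithinAt_nonpos (hd r hr).hasFDerivAt.hasFDerivWithinAt
      (sub_mem_posTangentConeAt_of_segment_subset hseg)
    replace this : (S.re - r) * (2 * inner ℝ (S.G i n r y) (S.G (i+1) n r y)) ≤ 0 := this
    unfold mu
    have hp : 0 < r - S.rC := by linarith [S.hC, hr.1]
    nlinarith

lemma stage2H {r1 R1 δ : ℝ} (h1 : S.ra < r1) (hm : S.rC + S.re < 2 * r1) (h2 : r1 < S.re) (h3 : S.re < R1)
    (hδ : 0 < δ) (hδ1 : δ < 1) : ∃ A C : ℝ, 0 ≤ A ∧ 0 < C ∧ ∀ i n : ℕ, ∀ r ∈ Icc r1 R1, ∀ y ∈ Icc (-δ) δ,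
      ‖S.G i n r y‖ ≤ A * C ^ (i + n) * i.factorial * n.factorial := by
  have hab := h2.trans h3
  have hPB : ∀ i, S.PB i r1 R1 δ := fun i => S.PB_of_UB h1 hδ hδ1
    (S.UB_of_LB h1 hab (S.A_all h1 hm h2 h3 i) (S.A_all h1 hm h2 h3 (i+1)))
  obtain ⟨M, K, A0, hM, hK, hA0, hR⟩ := S.R_W (β := R1) h1 hδ hδ1
  obtain ⟨N, hN0, hN⟩ := S.b_bdd 0 r1 R1
  set d := 2 * r1 - S.rC - S.re with hd
  have hd0 : 0 < d := by rw [hd]; linarith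
  obtain ⟨i0, hi0⟩ := exists_nat_ge (2 * N / d)
  obtain ⟨A1, C1, hA1, hC1, hbase⟩ := S.PB_fin i0 (fun i _ => hPB i)
  set A := max A0 A1
  set C := max K C1
  set B := max K (2 * M * C ^ 2 / d)
  have hA : 0 ≤ A := le_max_of_le_left hA0
  have hC : 1 ≤ C := le_max_of_le_left hK
  have hB : 1 ≤ B := le_max_of_le_left hK
  have hB2 : 2 * M * C ^ 2 ≤ d * B := by
    have : 2 * M * C ^ 2 / d ≤ B := le_max_right _ _
    rw [div_le_iff₀ hd0] at this; linarith
  have main : ∀ i, ∀ j ≤ i, ∀ n, ∀ r ∈ Icc r1 R1, ∀ y ∈ Icc (-δ) δ, ‖S.G j n r y‖ ≤ W A B C j n := by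
    intro i
    induction i with
    | zero =>
      intro j hj n r hr y hy
      exact (hbase j (by omega) n r hr y hy).trans (base_W hA1 hC1 (le_max_right _ _) hB (le_max_right _ _) _ _)
    | succ i ih =>
      intro j hj n r hr y hy
      rcases Nat.lt_or_ge i j with hlt | hle
      swap
      · exact ih j hle n r hr y hy
      obtain rfl : j = i + 1 := by omega
      rcases Nat.lt_or_ge i0 (i+1) with hlt0 | hle0
      swap
      · exact (hbase _ hle0 n r hr y hy).trans (base_W hA1 hC1 (le_max_right _ _) hB (le_max_right _ _) _ _)
      have hy' : y ∈ Ioo (-1:ℝ) 1 := ⟨by linarith [hy.1], by linarith [hy.2]⟩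
      obtain ⟨s, hs, hmax, hsg⟩ := S.max_pt (i+1) n h1 h2 h3 hy'
      refine (hmax r hr).trans ?_
      have heq := S.pde_all i n s y (h1.trans_le hs.1) hy'
      have hk := inner_key (R := S.hh i n s y - S.L i n s y) (eq_sub_of_add_eq heq) hsg
      have hRb := hR A B C (le_max_left _ _) (le_max_left _ _) (le_max_left _ _) i n s hs y hy
        (fun j hj m => ih j hj m s hs y hy)
      have hWi := W_i A B C i n
      have hWn := W_nonneg hA (by linarith : 0 ≤ B) (by linarith : 0 ≤ C) i n
      have hWn' := W_nonneg hA (by linarith : 0 ≤ B) (by linarith : 0 ≤ C) (i+1) n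
      have hi1 : (0:ℝ) < (i:ℝ) + 1 := by positivity
      have hlow : d * (i + 1) / 2 ≤ ((i + 1) * S.mu' s) - ‖S.b s‖ := by
        have e1 : d ≤ S.mu' s := by unfold mu'; rw [hd]; linarith [hs.1]
        have e2 := (hN s hs).2.2.1
        have e3 : 2 * N ≤ d * (i + 1) := by
          rw [div_le_iff₀ hd0] at hi0
          have : (i0:ℝ) ≤ i + 1 := by exact_mod_cast hlt0.le
          nlinarith
        nlinarith
      have e1 : d * (i + 1) / 2 * ‖S.G (i+1) n s y‖ ≤ M * C ^ 2 * ((2 * i + n + 2) * (2 * i + n + 1)) * W A B C i n :=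
        (mul_le_mul_of_nonneg_right hlow (norm_nonneg _)).trans (hk.trans hRb)
      have e2 : M * C ^ 2 * ((2 * i + n + 2) * (2 * i + n + 1)) * W A B C i n ≤ d * (i + 1) / 2 * W A B C (i+1) n := by
        have : d * (i + 1) / 2 * W A B C (i+1) n = d * B / 2 * (((2 * i + n + 2) * (2 * i + n + 1)) * W A B C i n) := by
          linear_combination d / 2 * hWi
        rw [this, mul_assoc]
        exact mul_le_mul_of_nonneg_right (by linarith) (by positivity)
      exact le_of_mul_le_mul_left (e1.trans e2) (by positivity)
  exact ⟨A, 16 * B * C, hA, by positivity, fun i n r hr y hy => (main i i le_rfl n r hr y hy).trans (W_up hA hB hC i n)⟩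

lemma stage2N {α β δ : ℝ} (h1 : S.ra < α) (h2 : β < S.re)
    (hδ : 0 < δ) (hδ1 : δ < 1) (hU0 : S.UB 0 α β) (hU1 : S.UB 1 α β) :
    ∃ A C : ℝ, 0 ≤ A ∧ 0 < C ∧ ∀ i n : ℕ, ∀ r ∈ Icc α β, ∀ y ∈ Icc (-δ) δ,
      ‖S.G i n r y‖ ≤ A * C ^ (i + n) * i.factorial * n.factorial := by
  have hPB : ∀ i ≤ 1, S.PB i α β δ := fun i hi => by
    interval_cases i
    · exact S.PB_of_UB h1 hδ hδ1 hU0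
    · exact S.PB_of_UB h1 hδ hδ1 hU1
  obtain ⟨M, K, A0, hM, hK, hA0, hR⟩ := S.R_W (β := β) h1 hδ hδ1
  obtain ⟨N, hN0, hN⟩ := S.b_bdd 0 α β
  set d := (α - S.rC) * (S.re - β) with hd
  have hd0 : 0 < d := mul_pos (by linarith [S.hC]) (by linarith)
  have hdm : ∀ r ∈ Icc α β, d ≤ |S.mu r| := by
    intro r hr
    have e : |S.mu r| = (r - S.rC) * (S.re - r) := by
      unfold mu
      rw [abs_mul, abs_of_nonneg (by linarith [S.hC, hr.1]), abs_of_nonpos (by linarith [hr.2])]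
      ring
    rw [e]
    exact mul_le_mul (by linarith [hr.1]) (by linarith [hr.2]) (by linarith) (by linarith [S.hC, hr.1])
  obtain ⟨A1, C1, hA1, hC1, hbase⟩ := S.PB_fin 1 hPB
  set A := max A0 A1
  set C := max K C1
  set B := max K ((M * C ^ 2 + 2 * N) / d)
  have hA : 0 ≤ A := le_max_of_le_left hA0
  have hC : 1 ≤ C := le_max_of_le_left hK
  have hB : 1 ≤ B := le_max_of_le_left hK
  have hB2 : M * C ^ 2 + 2 * N ≤ d * B := by
    have : (M * C ^ 2 + 2 * N) / d ≤ B := le_max_right _ _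
    rw [div_le_iff₀ hd0] at this; linarith
  have main : ∀ i, ∀ j ≤ i + 1, ∀ n, ∀ r ∈ Icc α β, ∀ y ∈ Icc (-δ) δ, ‖S.G j n r y‖ ≤ W A B C j n := by
    intro i
    induction i with
    | zero =>
      intro j hj n r hr y hy
      exact (hbase j (by omega) n r hr y hy).trans (base_W hA1 hC1 (le_max_right _ _) hB (le_max_right _ _) _ _)
    | succ i ih =>
      intro j hj n r hr y hy
      rcases Nat.lt_or_ge (i+1) j with hlt | hle
      swap
      · exact ih j hle n r hr y hy
      obtain rfl : j = i + 2 := by omega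
      have hy' : y ∈ Ioo (-1:ℝ) 1 := ⟨by linarith [hy.1], by linarith [hy.2]⟩
      have heq := S.pde_all i n r y (h1.trans_le hr.1) hy'
      have hRb := hR A B C (le_max_left _ _) (le_max_left _ _) (le_max_left _ _) i n r hr y hy
        (fun j hj m => ih j (by omega) m r hr y hy)
      have g1 := ih (i+1) le_rfl n r hr y hy
      have hWi := W_i A B C i n
      have hWn := W_nonneg hA (by linarith : 0 ≤ B) (by linarith : 0 ≤ C) i n
      have hWn' := W_nonneg hA (by linarith : 0 ≤ B) (by linarith : 0 ≤ C) (i+1) n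
      have hW2 := W_i_le hA hB (by linarith : 0 ≤ C) (i+1) n
      have hi1 : (0:ℝ) < (i:ℝ) + 1 := by positivity
      have e0 : (S.mu r : ℂ) * S.G (i+2) n r y = (S.hh i n r y - S.L i n r y) -
        (((i + 1) * S.mu' r : ℝ) + S.b r) * S.G (i+1) n r y := by linear_combination heq
      have e1 : |S.mu r| * ‖S.G (i+2) n r y‖ ≤ ‖S.hh i n r y - S.L i n r y‖ + 2 * N * (i+1) * W A B C (i+1) n := by
        have : ‖(S.mu r : ℂ) * S.G (i+2) n r y‖ = |S.mu r| * ‖S.G (i+2) n r y‖ := by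
          rw [norm_mul, Complex.norm_real, Real.norm_eq_abs]
        rw [← this, e0]
        refine (norm_sub_le _ _).trans (add_le_add_right ?_ _)
        rw [norm_mul]
        refine mul_le_mul ?_ g1 (norm_nonneg _) (by positivity)
        refine (norm_add_le _ _).trans ?_
        rw [Complex.norm_real, Real.norm_eq_abs, abs_mul, abs_of_pos hi1]
        have n1 := (hN r hr).2.1
        have n2 := (hN r hr).2.2.1
        have : N ≤ (i + 1) * N := le_mul_of_one_le_left hN0 (by linarith [(Nat.cast_nonneg i : (0:ℝ) ≤ i)])
        have := mul_le_mul_of_nonneg_left n1 hi1.le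
        linarith
      have e2 : M * C ^ 2 * ((2 * i + n + 2) * (2 * i + n + 1)) * W A B C i n ≤ M * C ^ 2 * (i + 1) * W A B C (i+1) n := by
        have : M * C ^ 2 * (i + 1) * W A B C (i+1) n = M * C ^ 2 * (((2 * i + n + 2) * (2 * i + n + 1)) * (B * W A B C i n)) := by
          linear_combination M * C ^ 2 * hWi
        rw [this, mul_assoc (M * C ^ 2)]
        have : W A B C i n ≤ B * W A B C i n := le_mul_of_one_le_left hWn hB
        gcongr
      have e3 : d * ‖S.G (i+2) n r y‖ ≤ d * W A B C (i+2) n := by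
        refine (mul_le_mul_of_nonneg_right (hdm r hr) (norm_nonneg _)).trans (e1.trans ?_)
        have f1 : (M * C ^ 2 + 2 * N) * ((i + 1) * W A B C (i+1) n) ≤ d * B * ((i + 1) * W A B C (i+1) n) :=
          mul_le_mul_of_nonneg_right hB2 (by positivity)
        have f2 : d * B * ((i + 1) * W A B C (i+1) n) ≤ d * W A B C (i+2) n := by
          rw [mul_assoc]
          refine mul_le_mul_of_nonneg_left (le_trans ?_ hW2) hd0.le
          push_cast
          have : 0 ≤ B * W A B C (i+1) n := by positivity
          nlinarith
        linarith
      exact le_of_mul_le_mul_left e3 hd0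
  exact ⟨A, 16 * B * C, hA, by positivity, fun i n r hr y hy => (main i i (by omega) n r hr y hy).trans (W_up hA hB hC i n)⟩

lemma analytic_of_bound {α β δ r0 y0 : ℝ} (h1 : S.ra < α) (hδ1 : δ < 1) (hr : r0 ∈ Ioo α β) (hy : y0 ∈ Ioo (-δ) δ)
    (h : ∃ A C : ℝ, 0 ≤ A ∧ 0 < C ∧ ∀ i n : ℕ, ∀ r ∈ Icc α β, ∀ y ∈ Icc (-δ) δ,
      ‖S.G i n r y‖ ≤ A * C ^ (i + n) * i.factorial * n.factorial) :
    AnalyticAt ℝ (fun p : ℝ × ℝ => S.G 0 0 p.1 p.2) (r0, y0) := by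
  obtain ⟨A, C, hA, hC, h⟩ := h
  let ρ := min (min (r0 - α) (β - r0)) (min (y0 + δ) (δ - y0))
  have hρ : 0 < ρ := lt_min (lt_min (by linarith [hr.1]) (by linarith [hr.2])) (lt_min (by linarith [hy.1]) (by linarith [hy.2]))
  have a1 : ρ ≤ r0 - α := (min_le_left _ _).trans (min_le_left _ _)
  have a2 : ρ ≤ β - r0 := (min_le_left _ _).trans (min_le_right _ _)
  have a3 : ρ ≤ y0 + δ := (min_le_right _ _).trans (min_le_left _ _)
  have a4 : ρ ≤ δ - y0 := (min_le_right _ _).trans (min_le_right _ _)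
  have k1 : ∀ r, |r - r0| < ρ → r ∈ Icc α β := fun r hr => by
    rw [abs_lt] at hr; exact ⟨by linarith, by linarith⟩
  have k2 : ∀ y, |y - y0| < ρ → y ∈ Icc (-δ) δ := fun r hr => by
    rw [abs_lt] at hr; exact ⟨by linarith, by linarith⟩
  have k3 : ∀ y ∈ Icc (-δ) δ, y ∈ Ioo (-1:ℝ) 1 := fun y hy => ⟨by linarith [hy.1], by linarith [hy.2]⟩
  exact analytic_of_jet hρ hA hC (fun i n r y hr hy => S.jG.dr i n r y (h1.trans_le (k1 r hr).1) (k3 y (k2 y hy)))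
    (fun i n r y hr hy => S.jG.dy i n r y (h1.trans_le (k1 r hr).1) (k3 y (k2 y hy)))
    (fun i n r y hr hy => h i n r (k1 r hr) y (k2 y hy))

theorem analytic {r y : ℝ} (hr : S.ra < r) (hy : y ∈ Ioo (-1:ℝ) 1) :
    AnalyticAt ℝ (fun p : ℝ × ℝ => S.G 0 0 p.1 p.2) (r, y) := by
  obtain ⟨δ, hyδ, hδ1⟩ := exists_between (abs_lt.2 ⟨hy.1, hy.2⟩ : |y| < 1)
  have hδ : 0 < δ := (abs_nonneg y).trans_lt hyδ
  have hyδ' : y ∈ Ioo (-δ) δ := abs_lt.1 hyδ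
  have hC := S.hC
  have he := S.he
  rcases lt_or_ge (S.rC + S.re) (2 * r) with hm | hm
  · -- near and beyond the horizon
    obtain ⟨r1, hr1, hr1'⟩ := exists_between (show max S.ra ((S.rC + S.re) / 2) < min r S.re from
      max_lt (lt_min hr he) (lt_min (by linarith) (by linarith)))
    have b1 := (le_max_left _ _).trans_lt hr1
    have b2 := (le_max_right _ _).trans_lt hr1
    have b3 := hr1'.trans_le (min_le_left _ _)
    have b4 := hr1'.trans_le (min_le_right _ _)
    refine S.analytic_of_bound (α := r1) (β := max r S.re + 1) b1 hδ1 ⟨b3, ?_⟩ hyδ' ?_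
    · linarith [le_max_left r S.re]
    · exact S.stage2H b1 (by linarith) b4 (by linarith [le_max_right r S.re]) hδ hδ1
  · have hre : r < S.re := by linarith
    obtain ⟨r1, hr1, hr1'⟩ := exists_between (show max r ((S.rC + S.re) / 2) < S.re from
      max_lt hre (by linarith))
    have b1 := (le_max_left _ _).trans_lt hr1
    have b2 := (le_max_right _ _).trans_lt hr1
    obtain ⟨r0, c1, c2⟩ := exists_between hr
    have hU : ∀ i, GB (fun n => S.ah i n r1) := fun i => by
      have h1 := S.A_all (r1 := r1) (R1 := S.re + 1) (hr.trans b1) (by linarith) hr1' (by linarith)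
      exact S.UB_at (S.UB_of_LB (hr.trans b1) (by linarith) (h1 i) (h1 (i+1))) ⟨le_rfl, by linarith⟩
    obtain ⟨u0, u1⟩ := S.B_all c1 (c2.trans b1) hr1' (hU 0) (hU 1)
    exact S.analytic_of_bound (α := r0) (β := r1) c1 hδ1 ⟨c2, b1⟩ hyδ'
      (S.stage2N c1 hr1' hδ hδ1 u0 u1)

end Sys
end KerrAux
end

section
namespace KerrAux
open MeasureTheory
open scoped NNReal ENNReal

section bounds
variable {E F : Type*} [NormedAddCommGroup E] [NormedSpace ℝ E] [NormedAddCommGroup F] [NormedSpace ℝ F]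
  [CompleteSpace F]

lemma local_bound {f : E → F} {x : E} (hf : AnalyticAt ℝ f x) : ∃ A C : ℝ, 0 ≤ A ∧ 1 ≤ C ∧
    ∀ᶠ y in nhds x, ∀ m : ℕ, ‖iteratedFDeriv ℝ m f y‖ ≤ A * C ^ m * m.factorial := by
  obtain ⟨p, r, hp⟩ := hf
  obtain ⟨r0, h0, hr0⟩ := ENNReal.lt_iff_exists_nnreal_btwn.1 hp.r_pos
  have h0' : 0 < r0 := by exact_mod_cast h0
  let ρ : ℝ≥0 := r0 / 2
  have hρ : 0 < ρ := by positivity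
  have hρr : ((ρ : ℝ≥0∞) + ρ) < r := by
    have : ρ + ρ = r0 := by simp only [ρ]; exact add_halves r0
    rw [← ENNReal.coe_add, this]; exact hr0
  have hrad : ((ρ : ℝ≥0∞) + ρ) < p.radius := hρr.trans_le hp.r_le
  have hs := p.changeOriginSeries_summable_aux₁ hrad
  obtain ⟨M, hM⟩ : ∃ M : ℝ≥0, ∀ k, (∑' s : Σ l : ℕ, { s : Finset (Fin (k + l)) // s.card = l },
      ‖p (k + s.1)‖₊ * ρ ^ s.1 * ρ ^ k) ≤ M := by
    exact ⟨∑' k : ℕ, (∑' s : Σ l : ℕ, { s : Finset (Fin (k + l)) // s.card = l },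
      ‖p (k + s.1)‖₊ * ρ ^ s.1 * ρ ^ k), fun k =>
      (NNReal.summable_sigma.1 hs).2.le_tsum k (fun _ _ => zero_le)⟩
  refine ⟨M, max 1 (ρ:ℝ)⁻¹, M.2, le_max_left _ _, ?_⟩
  filter_upwards [Metric.closedBall_mem_nhds x (by exact_mod_cast hρ : (0:ℝ) < ρ)] with y hy m
  have hyx : ‖y - x‖₊ ≤ ρ := by
    rw [Metric.mem_closedBall, dist_eq_norm] at hy
    exact_mod_cast hy
  have hyr : (‖y - x‖₊ : ℝ≥0∞) < r := by
    refine lt_of_le_of_lt ?_ hρr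
    exact (ENNReal.coe_le_coe.2 hyx).trans le_self_add
  have hc := hp.changeOrigin hyr
  rw [add_sub_cancel] at hc
  have hb : ‖p.changeOrigin (y - x) m‖ ≤ M * ((ρ:ℝ)⁻¹) ^ m := by
    have h1 := p.nnnorm_changeOrigin_le m (hyr.trans_le hp.r_le)
    have hsm := (NNReal.summable_sigma.1 hs).1 m
    have h2 : ‖p.changeOrigin (y - x) m‖₊ * ρ ^ m ≤ M := by
      refine le_trans ?_ (hM m)
      refine (mul_le_mul_left h1 _).trans ?_
      rw [← NNReal.tsum_mul_right]
      refine Summable.tsum_le_tsum (fun s => ?_) ?_ hsm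
      · gcongr
      · refine NNReal.summable_of_le (fun s => ?_) hsm
        gcongr
    have h3 : ‖p.changeOrigin (y - x) m‖ * (ρ:ℝ) ^ m ≤ M := by exact_mod_cast h2
    rw [inv_pow, ← div_eq_mul_inv, le_div_iff₀ (by positivity)]
    exact h3
  have hb' : ‖p.changeOrigin (y - x) m‖ ≤ M * (max 1 (ρ:ℝ)⁻¹) ^ m := by
    refine hb.trans ?_
    have := le_max_right 1 (ρ:ℝ)⁻¹
    gcongr
  refine ContinuousMultilinearMap.opNorm_le_bound (by positivity) (fun v => ?_)
  rw [hc.iteratedFDeriv_eq_sum_of_completeSpace]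
  refine (norm_sum_le _ _).trans ?_
  have : ∀ s ∈ (Finset.univ : Finset (Equiv.Perm (Fin m))), ‖p.changeOrigin (y - x) m (fun i => v (s i))‖ ≤
      M * (max 1 (ρ:ℝ)⁻¹) ^ m * ∏ i, ‖v i‖ := by
    intro s _
    refine (ContinuousMultilinearMap.le_opNorm _ _).trans ?_
    rw [Equiv.prod_comp s (fun i => ‖v i‖)]
    exact mul_le_mul_of_nonneg_right hb' (by positivity)
  refine (Finset.sum_le_sum this).trans (le_of_eq ?_)
  rw [Finset.sum_const, Finset.card_univ, Fintype.card_perm, Fintype.card_fin, nsmul_eq_mul]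
  ring

lemma compact_bound {f : E → F} {K : Set E} (hK : IsCompact K) (hf : AnalyticOnNhd ℝ f K) :
    ∃ A C : ℝ, 0 ≤ A ∧ 1 ≤ C ∧ ∀ y ∈ K, ∀ m : ℕ, ‖iteratedFDeriv ℝ m f y‖ ≤ A * C ^ m * m.factorial := by
  refine hK.induction_on (p := fun K => ∃ A C : ℝ, 0 ≤ A ∧ 1 ≤ C ∧ ∀ y ∈ K, ∀ m : ℕ,
    ‖iteratedFDeriv ℝ m f y‖ ≤ A * C ^ m * m.factorial) ⟨0, 1, le_rfl, le_rfl, by simp⟩ ?_ ?_ ?_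
  · rintro s t hst ⟨A, C, hA, hC, h⟩
    exact ⟨A, C, hA, hC, fun y hy => h y (hst hy)⟩
  · rintro s t ⟨A, C, hA, hC, h⟩ ⟨A', C', hA', hC', h'⟩
    refine ⟨max A A', max C C', le_max_of_le_left hA, le_max_of_le_left hC, fun y hy m => ?_⟩
    have hA'' : 0 ≤ max A A' := le_max_of_le_left hA
    rcases hy with hy | hy
    · refine (h y hy m).trans ?_
      have := le_max_left A A'
      have := le_max_left C C'
      gcongr
    · refine (h' y hy m).trans ?_
      have := le_max_right A A'
      have := le_max_right C C'
      gcongr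
  · intro x hx
    obtain ⟨A, C, hA, hC, h⟩ := local_bound (hf x hx)
    exact ⟨_, mem_nhdsWithin_of_mem_nhds h, A, C, hA, hC, fun y hy => hy⟩

end bounds
end KerrAux
end

section
namespace KerrAux
open MeasureTheory KerrModes
open scoped ContDiff

abbrev P3 := ℝ × (Fin 3 → ℝ)

def XL : P3 →L[ℝ] P3 := LinearMap.toContinuousLinearMap
  { toFun := fun p => (0, ![p.2 2, 0, -p.2 0])
    map_add' := fun p q => by ext i <;> [simp; (fin_cases i <;> simp; ring)]
    map_smul' := fun c p => by ext i <;> [simp; (fin_cases i <;> simp)] }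

def YL : P3 →L[ℝ] P3 := LinearMap.toContinuousLinearMap
  { toFun := fun p => (0, ![0, p.2 2, -p.2 1])
    map_add' := fun p q => by ext i <;> [simp; (fin_cases i <;> simp; ring)]
    map_smul' := fun c p => by ext i <;> [simp; (fin_cases i <;> simp)] }

lemma XL_apply (p : P3) : XL p = (0, ![p.2 2, 0, -p.2 0]) := rfl
lemma YL_apply (p : P3) : YL p = (0, ![0, p.2 2, -p.2 1]) := rfl

def e1 : P3 := (1, 0)

def Dv (L : P3 →L[ℝ] P3) (f : P3 → ℂ) (p : P3) : ℂ := fderiv ℝ f p (L p)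
def D1 (f : P3 → ℂ) (p : P3) : ℂ := fderiv ℝ f p e1
def Zop (f : P3 → ℂ) : P3 → ℂ := fun p => -(Dv XL f p + Complex.I * Dv YL f p)

section ops
variable {U : Set P3}

lemma cd_fderiv (hU : IsOpen U) {f : P3 → ℂ} (hf : ContDiffOn ℝ ∞ f U) : ContDiffOn ℝ ∞ (fderiv ℝ f) U :=
  hf.fderiv_of_isOpen hU (by simp)

lemma cd_Dv (hU : IsOpen U) (L : P3 →L[ℝ] P3) {f : P3 → ℂ} (hf : ContDiffOn ℝ ∞ f U) : ContDiffOn ℝ ∞ (Dv L f) U :=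
  (cd_fderiv hU hf).clm_apply L.contDiff.contDiffOn

lemma cd_D1 (hU : IsOpen U) {f : P3 → ℂ} (hf : ContDiffOn ℝ ∞ f U) : ContDiffOn ℝ ∞ (D1 f) U :=
  (cd_fderiv hU hf).clm_apply contDiffOn_const

lemma cd_Z (hU : IsOpen U) {f : P3 → ℂ} (hf : ContDiffOn ℝ ∞ f U) : ContDiffOn ℝ ∞ (Zop f) U :=
  ((cd_Dv hU XL hf).add (contDiffOn_const.mul (cd_Dv hU YL hf))).neg

lemma diff_of {f : P3 → ℂ} (hU : IsOpen U) (hf : ContDiffOn ℝ ∞ f U) {p : P3} (hp : p ∈ U) : DifferentiableAt ℝ f p :=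
  (hf.contDiffAt (hU.mem_nhds hp)).differentiableAt (by simp)

lemma D1_congr (hU : IsOpen U) {f g : P3 → ℂ} (h : EqOn f g U) : EqOn (D1 f) (D1 g) U := fun p hp => by
  unfold D1
  rw [Filter.EventuallyEq.fderiv_eq (h.eventuallyEq_of_mem (hU.mem_nhds hp))]

lemma comm_Dv (hU : IsOpen U) (L : P3 →L[ℝ] P3) (hL : L e1 = 0) {f : P3 → ℂ} (hf : ContDiffOn ℝ ∞ f U) :
    EqOn (Dv L (D1 f)) (D1 (Dv L f)) U := by
  intro p hp
  have hd : HasFDerivAt (fderiv ℝ f) (fderiv ℝ (fderiv ℝ f) p) p :=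
    (((cd_fderiv hU hf).contDiffAt (hU.mem_nhds hp)).differentiableAt (by simp)).hasFDerivAt
  have h1 : HasFDerivAt (D1 f) _ p := hd.clm_apply (hasFDerivAt_const e1 p)
  have h2 : HasFDerivAt (Dv L f) _ p := hd.clm_apply L.hasFDerivAt
  have hs : IsSymmSndFDerivAt ℝ f p := (hf.contDiffAt (hU.mem_nhds hp)).isSymmSndFDerivAt (by simp; exact WithTop.coe_le_coe.2 (le_top : (2:ℕ∞) ≤ ⊤))
  unfold Dv D1 at *
  rw [h1.fderiv, h2.fderiv]
  simp [hL]
  exact hs _ _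

lemma comm_Z (hU : IsOpen U) {f : P3 → ℂ} (hf : ContDiffOn ℝ ∞ f U) : EqOn (Zop (D1 f)) (D1 (Zop f)) U := by
  intro p hp
  have h1 := comm_Dv hU XL (by ext i <;> [simp [XL_apply]; (fin_cases i <;> simp [XL_apply, e1])]) hf hp
  have h2 := comm_Dv hU YL (by ext i <;> [simp [YL_apply]; (fin_cases i <;> simp [YL_apply, e1])]) hf hp
  have d1 := (diff_of hU (cd_Dv hU XL hf) hp).hasFDerivAt
  have d2 := (diff_of hU (cd_Dv hU YL hf) hp).hasFDerivAt
  have d3 : HasFDerivAt (Zop f) _ p := (d1.add (d2.const_mul Complex.I)).neg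
  show -(Dv XL (D1 f) p + Complex.I * Dv YL (D1 f) p) = fderiv ℝ (Zop f) p e1
  rw [h1, h2, d3.fderiv]
  simp [D1]

lemma Dv_congr (hU : IsOpen U) (L : P3 →L[ℝ] P3) {f g : P3 → ℂ} (h : EqOn f g U) : EqOn (Dv L f) (Dv L g) U := fun p hp => by
  unfold Dv
  rw [Filter.EventuallyEq.fderiv_eq (h.eventuallyEq_of_mem (hU.mem_nhds hp))]

lemma Z_congr (hU : IsOpen U) {f g : P3 → ℂ} (h : EqOn f g U) : EqOn (Zop f) (Zop g) U := fun p hp => by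
  unfold Zop
  rw [Dv_congr hU XL h hp, Dv_congr hU YL h hp]

/-- jets -/
def JJ (f : P3 → ℂ) (i n : ℕ) : P3 → ℂ := D1^[i] (Zop^[n] f)

lemma JJ_succ_i (f : P3 → ℂ) (i n : ℕ) : JJ f (i+1) n = D1 (JJ f i n) := by
  unfold JJ; rw [Function.iterate_succ_apply']

lemma cd_JJ (hU : IsOpen U) {f : P3 → ℂ} (hf : ContDiffOn ℝ ∞ f U) (i n : ℕ) : ContDiffOn ℝ ∞ (JJ f i n) U := by
  induction i with
  | zero =>
    induction n with
    | zero => exact hf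
    | succ n ih =>
      simp only [JJ, Function.iterate_succ_apply'] at ih ⊢
      exact cd_Z hU ih
  | succ i ih => rw [JJ_succ_i]; exact cd_D1 hU ih

lemma JJ_succ_n (hU : IsOpen U) {f : P3 → ℂ} (hf : ContDiffOn ℝ ∞ f U) (i n : ℕ) : EqOn (Zop (JJ f i n)) (JJ f i (n+1)) U := by
  induction i with
  | zero => intro p _; simp only [JJ, Function.iterate_zero, id, Function.iterate_succ_apply']
  | succ i ih =>
    rw [JJ_succ_i, JJ_succ_i]
    exact (comm_Z hU (cd_JJ hU hf i n)).trans (D1_congr hU ih)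

/-- derivative bounds -/
lemma Dv_bound (hU : IsOpen U) (L : P3 →L[ℝ] P3) {f : P3 → ℂ} (hf : ContDiffOn ℝ ∞ f U) {p : P3} (hp : p ∈ U) (m : ℕ) :
    ‖iteratedFDeriv ℝ m (Dv L f) p‖ ≤ ‖iteratedFDeriv ℝ (m+1) f p‖ * ‖L p‖ + m * ‖iteratedFDeriv ℝ m f p‖ * ‖L‖ := by
  have h := norm_iteratedFDerivWithin_clm_apply (n := m) (cd_fderiv hU hf) (L.contDiff (n := ∞)).contDiffOn
    hU.uniqueDiffOn hp (by exact_mod_cast le_top)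
  simp only [iteratedFDerivWithin_of_isOpen _ hU hp] at h
  refine h.trans ?_
  have hc : fderiv ℝ (L : P3 → P3) = fun _ => L := by ext1 x; exact L.fderiv
  have hL : ∀ j, iteratedFDeriv ℝ (j+2) (L : P3 → P3) p = 0 := by
    intro j
    rw [← norm_eq_zero, ← norm_iteratedFDeriv_fderiv, hc, iteratedFDeriv_const_of_ne (by omega)]
    simp
  have hL1 : ‖iteratedFDeriv ℝ 1 (L : P3 → P3) p‖ = ‖L‖ := by
    rw [← zero_add 1, ← norm_iteratedFDeriv_fderiv, hc, norm_iteratedFDeriv_zero]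
  rcases m with _ | m
  · simp [norm_iteratedFDeriv_fderiv]
  · rw [Finset.sum_range_succ, Finset.sum_range_succ, Finset.sum_eq_zero]
    · rw [show m+1-m=1 by omega, Nat.sub_self, hL1, norm_iteratedFDeriv_zero]
      simp only [norm_iteratedFDeriv_fderiv]
      simp
      linarith
    · intro i hi
      rw [Finset.mem_range] at hi
      obtain ⟨j, hj⟩ : ∃ j, m + 1 - i = j + 2 := ⟨m + 1 - i - 2, by omega⟩
      rw [hj, hL]; simp

def Bd (K : Set P3) (A C : ℝ) (q : ℕ) (g : P3 → ℂ) : Prop :=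
  ∀ p ∈ K, ∀ m : ℕ, ‖iteratedFDeriv ℝ m g p‖ ≤ A * C ^ m * (m + q).factorial

lemma Bd.mono {K : Set P3} {A A' C : ℝ} (hC : 0 ≤ C) (h : A ≤ A') {q : ℕ} {g : P3 → ℂ} (hg : Bd K A C q g) :
    Bd K A' C q g := fun p hp m => (hg p hp m).trans (by gcongr)

lemma Bd.d1 (hU : IsOpen U) {K : Set P3} (hK : K ⊆ U) {A C : ℝ} {q : ℕ} {g : P3 → ℂ} (hc : ContDiffOn ℝ ∞ g U)
    (hg : Bd K A C q g) : Bd K (A * C) C (q+1) (D1 g) := by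
  intro p hp m
  have h := norm_iteratedFDeriv_clm_apply_const (n := m) (c := e1) (N := ∞) 
    ((cd_fderiv hU hc).contDiffAt (hU.mem_nhds (hK hp))) (by exact_mod_cast le_top)
  rw [norm_iteratedFDeriv_fderiv] at h
  have he : ‖e1‖ = 1 := by simp [e1, Prod.norm_def]
  rw [he, one_mul] at h
  refine (h.trans (hg p hp (m+1))).trans (le_of_eq ?_)
  rw [show m + 1 + q = m + (q+1) by ring]; ring

lemma Bd.z (hU : IsOpen U) {K : Set P3} (hK : K ⊆ U) {A C R N : ℝ} (hA : 0 ≤ A) (hC : 0 ≤ C) (hR : 0 ≤ R) (hN : 0 ≤ N)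
    (hX : ‖XL‖ ≤ N) (hY : ‖YL‖ ≤ N) (hKR : ∀ p ∈ K, ‖XL p‖ ≤ R ∧ ‖YL p‖ ≤ R)
    {q : ℕ} {g : P3 → ℂ} (hc : ContDiffOn ℝ ∞ g U)
    (hg : Bd K A C q g) : Bd K (A * (2 * (C * R + N))) C (q+1) (Zop g) := by
  intro p hp m
  have key : ∀ L : P3 →L[ℝ] P3, ‖L‖ ≤ N → ‖L p‖ ≤ R → ‖iteratedFDeriv ℝ m (Dv L g) p‖ ≤ 
      A * (C * R + N) * C ^ m * (m + (q+1)).factorial := by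
    intro L h1 h2
    refine (Dv_bound hU L hc (hK hp) m).trans ?_
    have e1 := hg p hp (m+1)
    have e2 := hg p hp m
    have hf : ((m + (q+1)).factorial : ℝ) = (m + q + 1) * (m+q).factorial := by
      rw [show m + (q+1) = (m+q)+1 by ring, Nat.factorial_succ]; push_cast; ring
    rw [show m + 1 + q = m + (q+1) by ring] at e1
    have : (m:ℝ) * ‖iteratedFDeriv ℝ m g p‖ ≤ A * C ^ m * (m + (q+1)).factorial := by
      rw [hf]
      calc (m:ℝ) * ‖iteratedFDeriv ℝ m g p‖ ≤ (m + q + 1) * (A * C ^ m * (m + q).factorial) := by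
            gcongr
            have : (0:ℝ) ≤ q := by positivity
            linarith
        _ = _ := by ring
    calc _ ≤ (A * C ^ (m+1) * (m + (q+1)).factorial) * R + (A * C ^ m * (m + (q+1)).factorial) * N := by
          gcongr
      _ = _ := by ring
  have hp' := hKR p hp
  have kX := key XL hX hp'.1
  have kY := key YL hY hp'.2
  have cX : ContDiffAt ℝ m (Dv XL g) p := ((cd_Dv hU XL hc).contDiffAt (hU.mem_nhds (hK hp))).of_le (by exact_mod_cast le_top)
  have cY : ContDiffAt ℝ m (Dv YL g) p := ((cd_Dv hU YL hc).contDiffAt (hU.mem_nhds (hK hp))).of_le (by exact_mod_cast le_top)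
  have e : Zop g = -(Dv XL g + Complex.I • Dv YL g) := rfl
  rw [e, iteratedFDeriv_neg_apply, norm_neg, iteratedFDeriv_add_apply cX (show ContDiffAt ℝ m (Complex.I • Dv YL g) p from cY.const_smul Complex.I),
    iteratedFDeriv_const_smul_apply cY]
  refine (norm_add_le _ _).trans ?_
  rw [norm_smul, Complex.norm_I, one_mul]
  linarith

lemma Bd.jj (hU : IsOpen U) {K : Set P3} (hK : K ⊆ U) {A C R N : ℝ} (hA : 0 ≤ A) (hC : 0 ≤ C) (hR : 0 ≤ R) (hN : 0 ≤ N)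
    (hX : ‖XL‖ ≤ N) (hY : ‖YL‖ ≤ N) (hKR : ∀ p ∈ K, ‖XL p‖ ≤ R ∧ ‖YL p‖ ≤ R)
    {g : P3 → ℂ} (hc : ContDiffOn ℝ ∞ g U)
    (hg : Bd K A C 0 g) (i n : ℕ) : Bd K (A * (C + 2 * (C * R + N)) ^ (i+n)) C (i+n) (JJ g i n) := by
  have hB : 0 ≤ C + 2 * (C * R + N) := by positivity
  induction i with
  | zero =>
    induction n with
    | zero => simpa [JJ] using hg
    | succ n ih =>
      have := Bd.z hU hK (by positivity) hC hR hN hX hY hKR (cd_JJ hU hc 0 n) ih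
      have e : Zop (JJ g 0 n) = JJ g 0 (n+1) := by simp only [JJ, Function.iterate_zero, id, Function.iterate_succ_apply']
      rw [e] at this
      rw [← add_assoc, pow_succ, ← mul_assoc]
      exact this.mono hC (by gcongr; linarith)
  | succ i ih =>
    rw [JJ_succ_i, show i + 1 + n = (i+n)+1 by ring, pow_succ, ← mul_assoc]
    exact (Bd.d1 hU hK (cd_JJ hU hc i n) ih).mono hC (by gcongr; nlinarith [mul_nonneg hC hR])

lemma jj_bound (hU : IsOpen U) {K : Set P3} (hK : K ⊆ U) (hKc : IsCompact K) {g : P3 → ℂ} (hg : AnalyticOnNhd ℝ g U) :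
    ∃ A C : ℝ, 0 ≤ A ∧ 1 ≤ C ∧ ∀ i n : ℕ, ∀ p ∈ K, ‖JJ g i n p‖ ≤ A * C ^ (i+n) * i.factorial * n.factorial := by
  obtain ⟨A, C, hA, hC, h⟩ := compact_bound hKc (hg.mono hK)
  obtain ⟨R0, hR0⟩ := (hKc.image XL.continuous).isBounded.exists_norm_le
  obtain ⟨R1, hR1⟩ := (hKc.image YL.continuous).isBounded.exists_norm_le
  have hcd : ContDiffOn ℝ ∞ g U := hg.contDiffOn hU.uniqueDiffOn
  have hb : Bd K A C 0 g := fun p hp m => by simpa using h p hp m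
  have hj := Bd.jj hU hK (R := |R0| + |R1|) (N := ‖XL‖ + ‖YL‖) hA (by linarith) (by positivity) (by positivity)
    (by have := norm_nonneg YL; linarith) (by have := norm_nonneg XL; linarith)
    (fun p hp => ⟨by linarith [hR0 _ (mem_image_of_mem _ hp), le_abs_self R0, abs_nonneg R1],
      by linarith [hR1 _ (mem_image_of_mem _ hp), le_abs_self R1, abs_nonneg R0]⟩) hcd hb
  set B := C + 2 * (C * (|R0| + |R1|) + (‖XL‖ + ‖YL‖)) with hBdef
  have hB : 1 ≤ B := by
    have : 0 ≤ 2 * (C * (|R0| + |R1|) + (‖XL‖ + ‖YL‖)) := by positivity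
    linarith
  refine ⟨A, 2 * B, hA, by linarith, fun i n p hp => ?_⟩
  have := hj i n p hp 0
  rw [norm_iteratedFDeriv_zero] at this
  refine this.trans ?_
  have h2 : ((i+n).factorial : ℝ) ≤ 2 ^ (i+n) * (i.factorial * n.factorial) := by
    have h3 : (i+n).choose n ≤ 2^(i+n) := Nat.choose_le_two_pow _ _
    have h4 := Nat.add_choose_mul_factorial_mul_factorial i n
    have : (i+n).factorial ≤ 2^(i+n) * (i.factorial * n.factorial) := by
      rw [← h4, mul_assoc]; gcongr
    exact_mod_cast this
  rw [mul_pow]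
  simp only [pow_zero, mul_one, zero_add]
  calc A * B ^ (i+n) * ((i+n).factorial : ℝ) ≤ A * B ^ (i+n) * (2 ^ (i+n) * (i.factorial * n.factorial)) := by gcongr
    _ = _ := by ring

end ops
end KerrAux
end

section
namespace KerrAux
open MeasureTheory KerrModes
open scoped ContDiff

def RL : P3 →L[ℝ] P3 := LinearMap.toContinuousLinearMap
  { toFun := fun p => (0, ![-p.2 1, p.2 0, 0])
    map_add' := fun p q => by ext i <;> [simp; (fin_cases i <;> simp; ring)]
    map_smul' := fun c p => by ext i <;> [simp; (fin_cases i <;> simp)] }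

lemma RL_apply (p : P3) : RL p = (0, ![-p.2 1, p.2 0, 0]) := rfl

lemma comm_LL {U : Set P3} (hU : IsOpen U) (L M : P3 →L[ℝ] P3) {f : P3 → ℂ} (hf : ContDiffOn ℝ ∞ f U) {p : P3} (hp : p ∈ U) :
    Dv M (Dv L f) p = Dv L (Dv M f) p + fderiv ℝ f p (L (M p)) - fderiv ℝ f p (M (L p)) := by
  have hd : HasFDerivAt (fderiv ℝ f) (fderiv ℝ (fderiv ℝ f) p) p :=
    (((cd_fderiv hU hf).contDiffAt (hU.mem_nhds hp)).differentiableAt (by simp)).hasFDerivAt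
  have h1 : HasFDerivAt (Dv L f) _ p := hd.clm_apply L.hasFDerivAt
  have h2 : HasFDerivAt (Dv M f) _ p := hd.clm_apply M.hasFDerivAt
  have hs : IsSymmSndFDerivAt ℝ f p := (hf.contDiffAt (hU.mem_nhds hp)).isSymmSndFDerivAt (by simp; exact WithTop.coe_le_coe.2 (le_top : (2:ℕ∞) ≤ ⊤))
  have e1 : Dv M (Dv L f) p = fderiv ℝ (Dv L f) p (M p) := rfl
  have e2 : Dv L (Dv M f) p = fderiv ℝ (Dv M f) p (L p) := rfl
  rw [e1, e2, h1.fderiv, h2.fderiv]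
  simp
  have := hs (M p) (L p)
  rw [this]; ring

def Md (U : Set P3) (κ : ℤ) (f : P3 → ℂ) : Prop := EqOn (Dv RL f) (fun p => Complex.I * κ * f p) U

lemma Dv_cmul {U : Set P3} (hU : IsOpen U) (L : P3 →L[ℝ] P3) {f : P3 → ℂ} (hf : ContDiffOn ℝ ∞ f U) (c : ℂ) {p : P3} (hp : p ∈ U) :
    Dv L (fun p => c * f p) p = c * Dv L f p := by
  unfold Dv
  rw [((diff_of hU hf hp).hasFDerivAt.const_mul c).fderiv]; simp

lemma Md.d1 {U : Set P3} (hU : IsOpen U) {κ : ℤ} {f : P3 → ℂ} (hf : ContDiffOn ℝ ∞ f U) (h : Md U κ f) : Md U κ (D1 f) := by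
  intro p hp
  rw [comm_Dv hU RL (by ext i <;> [simp [RL_apply]; (fin_cases i <;> simp [RL_apply, e1])]) hf hp, D1_congr hU h hp]
  unfold D1
  rw [((diff_of hU hf hp).hasFDerivAt.const_mul _).fderiv]; simp

lemma Md.z {U : Set P3} (hU : IsOpen U) {κ : ℤ} {f : P3 → ℂ} (hf : ContDiffOn ℝ ∞ f U) (h : Md U κ f) : Md U (κ+1) (Zop f) := by
  intro p hp
  have d1 := (diff_of hU (cd_Dv hU XL hf) hp).hasFDerivAt
  have d2 := (diff_of hU (cd_Dv hU YL hf) hp).hasFDerivAt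
  have d3 : HasFDerivAt (Zop f) _ p := (d1.add (d2.const_mul Complex.I)).neg
  have e : Dv RL (Zop f) p = -(Dv RL (Dv XL f) p + Complex.I * Dv RL (Dv YL f) p) := by
    show fderiv ℝ (Zop f) p (RL p) = _
    rw [d3.fderiv]; simp [Dv]
  rw [e, comm_LL hU XL RL hf hp, comm_LL hU YL RL hf hp, Dv_congr hU XL h hp, Dv_congr hU YL h hp,
    Dv_cmul hU XL hf _ hp, Dv_cmul hU YL hf _ hp]
  have a1 : fderiv ℝ f p (XL (RL p)) - fderiv ℝ f p (RL (XL p)) = - Dv YL f p := by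
    rw [← map_sub, Dv, ← map_neg]; congr 1
    ext i <;> [simp [RL_apply, XL_apply, YL_apply]; (fin_cases i <;> simp [RL_apply, XL_apply, YL_apply])]
  have a2 : fderiv ℝ f p (YL (RL p)) - fderiv ℝ f p (RL (YL p)) = Dv XL f p := by
    rw [← map_sub, Dv]; congr 1
    ext i <;> [simp [RL_apply, XL_apply, YL_apply]; (fin_cases i <;> simp [RL_apply, XL_apply, YL_apply])]
  rw [add_sub_assoc, a1, add_sub_assoc, a2]
  simp only [Zop]
  push_cast
  linear_combination (Dv YL f p) * Complex.I_sq

lemma Md.jj {U : Set P3} (hU : IsOpen U) {κ : ℤ} {f : P3 → ℂ} (hf : ContDiffOn ℝ ∞ f U) (h : Md U κ f) (i n : ℕ) :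
    Md U (κ+n) (JJ f i n) := by
  induction i with
  | zero =>
    induction n with
    | zero => simpa [JJ] using h
    | succ n ih =>
      have e : Zop (JJ f 0 n) = JJ f 0 (n+1) := by simp only [JJ, Function.iterate_zero, id, Function.iterate_succ_apply']
      have := ih.z hU (cd_JJ hU hf 0 n)
      rw [e] at this
      rw [Nat.cast_succ, ← add_assoc]; exact this
  | succ i ih => rw [JJ_succ_i]; exact ih.d1 hU (cd_JJ hU hf i n)

/-- meridian curve -/
def gam (y : ℝ) : Fin 3 → ℝ := ![√(1 - y ^ 2), 0, y]

def sy (y : ℝ) : ℝ := √(1 - y ^ 2)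

lemma sy_pos {y : ℝ} (hy : y ∈ Ioo (-1:ℝ) 1) : 0 < sy y := Real.sqrt_pos.2 (by nlinarith [hy.1, hy.2])
lemma sy_sq {y : ℝ} (hy : y ∈ Ioo (-1:ℝ) 1) : sy y ^ 2 = 1 - y ^ 2 := Real.sq_sqrt (by nlinarith [hy.1, hy.2])
lemma sy_deriv {y : ℝ} (hy : y ∈ Ioo (-1:ℝ) 1) : HasDerivAt sy (-y / sy y) y := by
  have h : HasDerivAt (fun y : ℝ => 1 - y ^ 2) (-(2 * y)) y := by
    simpa using ((hasDerivAt_id y).pow 2).const_sub 1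
  refine (h.sqrt (by nlinarith [hy.1, hy.2])).congr_deriv ?_
  have := sy_pos hy
  unfold sy at *
  field_simp

lemma gam_deriv {y : ℝ} (hy : y ∈ Ioo (-1:ℝ) 1) : HasDerivAt gam ![-y / sy y, 0, 1] y := by
  rw [hasDerivAt_pi]
  intro i
  fin_cases i
  · exact sy_deriv hy
  · exact hasDerivAt_const y 0
  · exact hasDerivAt_id y

lemma gam_cont : Continuous gam := by
  unfold gam
  refine continuous_pi (fun i => ?_)
  fin_cases i <;> simp <;> fun_prop

/-- off-axis domain -/
def UA (ra : ℝ) : Set P3 := {p | ra < p.1 ∧ (p.2 0 ≠ 0 ∨ p.2 1 ≠ 0)}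
/-- punctured domain -/
def UO (ra : ℝ) : Set P3 := {p | ra < p.1 ∧ p.2 ≠ 0}

lemma UA_open (ra : ℝ) : IsOpen (UA ra) := by
  have h0 : Continuous (fun p : P3 => p.2 0) := by fun_prop
  have h1 : Continuous (fun p : P3 => p.2 1) := by fun_prop
  exact (isOpen_lt continuous_const continuous_fst).inter
    ((isOpen_ne_fun h0 continuous_const).union (isOpen_ne_fun h1 continuous_const))

lemma UO_open (ra : ℝ) : IsOpen (UO ra) :=
  (isOpen_lt continuous_const continuous_fst).inter (isOpen_ne_fun continuous_snd continuous_const)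

lemma UA_sub (ra : ℝ) : UA ra ⊆ UO ra := fun p hp => ⟨hp.1, fun h => by
  rcases hp.2 with h' | h' <;> simp [h] at h'⟩

lemma gam_UA {ra r y : ℝ} (hr : ra < r) (hy : y ∈ Ioo (-1:ℝ) 1) : (r, gam y) ∈ UA ra :=
  ⟨hr, Or.inl (sy_pos hy).ne'⟩

def GG (κ : ℤ) (f : P3 → ℂ) (i n : ℕ) (r y : ℝ) : ℂ := ((sy y : ℝ) : ℂ) ^ (-(κ+n)) * JJ f i n (r, gam y)

lemma GG_wt (κ : ℤ) (f : P3 → ℂ) (i n : ℕ) (r : ℝ) {y : ℝ} (hy : y ∈ Ioo (-1:ℝ) 1) :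
    wt (κ+n) y * ‖GG κ f i n r y‖ ^ 2 = ‖JJ f i n (r, gam y)‖ ^ 2 := by
  unfold GG wt
  have hs := sy_pos hy
  rw [← sy_sq hy, norm_mul, norm_zpow, Complex.norm_real, Real.norm_of_nonneg hs.le, mul_pow, ← mul_assoc,
    ← zpow_natCast (sy y) 2, ← zpow_natCast (sy y ^ _) 2, ← zpow_mul, ← zpow_mul, ← zpow_add₀ hs.ne']
  have : ((2:ℕ):ℤ) * (κ + n) + -(κ+n) * ((2:ℕ):ℤ) = 0 := by ring
  rw [this]; simp

lemma key_dy {ra : ℝ} {κ : ℤ} {f : P3 → ℂ} (hf : ContDiffOn ℝ ∞ f (UA ra)) (h : Md (UA ra) κ f)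
    {r y : ℝ} (hr : ra < r) (hy : y ∈ Ioo (-1:ℝ) 1) :
    HasDerivAt (fun y => ((sy y : ℝ) : ℂ) ^ (-κ) * f (r, gam y)) (((sy y : ℝ) : ℂ) ^ (-(κ+1)) * Zop f (r, gam y)) y := by
  have hp := gam_UA hr hy
  have hs := sy_pos hy
  have hsc : ((sy y : ℝ) : ℂ) ≠ 0 := by exact_mod_cast hs.ne'
  have hfd := (diff_of (UA_open ra) hf hp).hasFDerivAt
  have hg : HasDerivAt (fun y => ((r, gam y) : P3)) (0, ![-y / sy y, 0, 1]) y := (hasDerivAt_const y r).prodMk (gam_deriv hy)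
  have h1 := hfd.comp_hasDerivAt y hg
  have h2 := (hasDerivAt_zpow (-κ) ((sy y : ℝ) : ℂ) (Or.inl hsc)).comp y (sy_deriv hy).ofReal_comp
  have h3 := h2.mul h1
  refine h3.congr_deriv ?_
  have hm : Dv RL f (r, gam y) = Complex.I * κ * f (r, gam y) := h hp
  have eY : Dv YL f (r, gam y) = ((y / sy y : ℝ) : ℂ) * (Complex.I * κ * f (r, gam y)) := by
    rw [← hm]
    unfold Dv
    rw [← Complex.real_smul, ← map_smul]; congr 1
    ext i <;> [simp [RL_apply, YL_apply]; (fin_cases i <;> simp [RL_apply, YL_apply, gam])]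
    unfold sy at *
    field_simp
  have eX : (fderiv ℝ f (r, gam y)) (0, ![-y / sy y, 0, 1]) = ((-1 / sy y : ℝ) : ℂ) * Dv XL f (r, gam y) := by
    unfold Dv
    rw [← Complex.real_smul, ← map_smul]; congr 1
    ext i <;> [simp [XL_apply]; (fin_cases i <;> simp [XL_apply, gam])]
    · unfold sy at *
      field_simp
    · unfold sy at *
      field_simp
  simp only [Function.comp]
  rw [eX, Zop, eY, neg_add, zpow_add₀ hsc, zpow_sub_one₀ hsc]
  push_cast
  simp only [zpow_neg, zpow_one]
  have hI := Complex.I_sq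
  field_simp
  linear_combination (y * κ * f (r, gam y)) * hI

lemma GG_jet {ra : ℝ} {κ : ℤ} {f : P3 → ℂ} (hf : ContDiffOn ℝ ∞ f (UA ra)) (h : Md (UA ra) κ f) : Jet ra (GG κ f) where
  dr := by
    intro i n r y hr hy
    have hp := gam_UA hr hy
    have hfd := (diff_of (UA_open ra) (cd_JJ (UA_open ra) hf i n) hp).hasFDerivAt
    have hg : HasDerivAt (fun r => ((r, gam y) : P3)) e1 r := (hasDerivAt_id r).prodMk (hasDerivAt_const r _)
    have := (hfd.comp_hasDerivAt r hg).const_mul (((sy y : ℝ) : ℂ) ^ (-(κ+n)))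
    rw [GG, JJ_succ_i]; exact this
  dy := by
    intro i n r y hr hy
    have := key_dy (cd_JJ (UA_open ra) hf i n) (h.jj (UA_open ra) hf i n) hr hy
    rw [JJ_succ_n (UA_open ra) hf i n (gam_UA hr hy)] at this
    unfold GG
    push_cast
    rw [← add_assoc]; exact this
  cont := by
    intro i n
    have h1 : ContinuousOn (fun p : ℝ × ℝ => JJ f i n (p.1, gam p.2)) (Ioi ra ×ˢ Ioo (-1:ℝ) 1) :=
      (cd_JJ (UA_open ra) hf i n).continuousOn.comp
        (continuous_fst.prodMk (gam_cont.comp continuous_snd)).continuousOn (fun p hp => gam_UA hp.1 hp.2)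
    refine ContinuousOn.mul ?_ h1
    have hsy : Continuous sy := by unfold sy; fun_prop
    refine ContinuousOn.zpow₀ (Complex.continuous_ofReal.comp (hsy.comp continuous_snd)).continuousOn _ (fun p hp => Or.inl ?_)
    simp only [Function.comp]
    exact_mod_cast (sy_pos hp.2).ne'

lemma KK (ra α β : ℝ) (hα : ra < α) : ∃ K : Set P3, IsCompact K ∧ K ⊆ UO ra ∧ ∀ r ∈ Icc α β, ∀ y ∈ Ioo (-1:ℝ) 1, (r, gam y) ∈ K := by
  refine ⟨Icc α β ×ˢ (gam '' Icc (-1) 1), isCompact_Icc.prod (isCompact_Icc.image gam_cont), ?_, 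
    fun r hr y hy => ⟨hr, mem_image_of_mem _ (Ioo_subset_Icc_self hy)⟩⟩
  rintro ⟨r, x⟩ ⟨hr, y, hy, rfl⟩
  refine ⟨hα.trans_le hr.1, fun h => ?_⟩
  have h2 : y = 0 := congrFun h 2
  have h0 : √(1 - y ^ 2) = 0 := congrFun h 0
  rw [h2] at h0; simp at h0

lemma GG_w {ra : ℝ} (κ : ℤ) {f : P3 → ℂ} (hf : ContDiffOn ℝ ∞ f (UO ra)) (i n : ℕ) (α β : ℝ) (hα : ra < α) :
    ∃ M, ∀ r ∈ Icc α β, ∀ y ∈ Ioo (-1:ℝ) 1, wt (κ + n) y * ‖GG κ f i n r y‖ ^ 2 ≤ M := by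
  obtain ⟨K, hK, hKU, hm⟩ := KK ra α β hα
  obtain ⟨M, hM⟩ := hK.exists_bound_of_continuousOn ((cd_JJ (UO_open ra) hf i n).continuousOn.mono hKU)
  refine ⟨M ^ 2, fun r hr y hy => ?_⟩
  rw [GG_wt _ _ _ _ _ hy]
  have := hM _ (hm r hr y hy)
  gcongr

lemma GG_abdd {ra : ℝ} (κ : ℤ) {f : P3 → ℂ} (hf : AnalyticOnNhd ℝ f (UO ra)) : ABdd ra κ (GG κ f) := by
  intro α β hα
  obtain ⟨K, hK, hKU, hm⟩ := KK ra α β hα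
  obtain ⟨A, C, hA, hC, h⟩ := jj_bound (UO_open ra) hKU hK hf
  refine ⟨A, C, hA, hC, fun i n r hr y hy => ?_⟩
  rw [GG_wt _ _ _ _ _ hy]
  have := h i n _ (hm r hr y hy)
  gcongr

end KerrAux
end

section
namespace KerrAux
open MeasureTheory KerrModes
open scoped ContDiff Topology

def OM (ra : ℝ) : Set (Fin 4 → ℝ) := {x | ra < x 1 ∧ x 3 ∈ Ioo 0 π}

lemma OM_open (ra : ℝ) : IsOpen (OM ra) :=
  (isOpen_lt continuous_const (continuous_apply 1)).inter (isOpen_Ioo.preimage (continuous_apply 3))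

lemma upd_ev {U : Set (Fin 4 → ℝ)} (hU : IsOpen U) {x : Fin 4 → ℝ} (hx : x ∈ U) (i : Fin 4) :
    ∀ᶠ s in 𝓝 (x i), Function.update x i s ∈ U := by
  have : Continuous (fun s => Function.update x i s) := continuous_const.update i continuous_id
  exact this.continuousAt.preimage_mem_nhds (by rw [Function.update_eq_self]; exact hU.mem_nhds hx)

lemma pd_congr {U : Set (Fin 4 → ℝ)} (hU : IsOpen U) {w w' : (Fin 4 → ℝ) → ℂ} (h : EqOn w w' U)
    {x : Fin 4 → ℝ} (hx : x ∈ U) (i : Fin 4) : pd i w x = pd i w' x := by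
  unfold pd
  refine Filter.EventuallyEq.deriv_eq ?_
  filter_upwards [upd_ev hU hx i] with s hs using h hs

/-- entries of `ρ²(g*)⁻¹` -/
def NN (a m r θ : ℝ) : Matrix (Fin 4) (Fin 4) ℝ :=
  !![a ^ 2 * Real.sin θ ^ 2, -(r ^ 2 + a ^ 2), a, 0;
     -(r ^ 2 + a ^ 2), mu a m r, -a, 0;
     a, -a, 1 / Real.sin θ ^ 2, 0;
     0, 0, 0, 1]

lemma ginv {a m r θ : ℝ} (hr : 0 < r) (hθ : θ ∈ Ioo 0 π) :
    (gstar a m r θ)⁻¹ = (1 / rhosq a r θ) • NN a m r θ := by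
  have hs : Real.sin θ ≠ 0 := (Real.sin_pos_of_mem_Ioo hθ).ne'
  have hρ : rhosq a r θ ≠ 0 := by unfold rhosq; positivity
  have hρ' : rhosq a r θ = r ^ 2 + a ^ 2 - a ^ 2 * Real.sin θ ^ 2 := by
    unfold rhosq; rw [Real.cos_sq']; ring
  refine Matrix.inv_eq_right_inv ?_
  rw [Matrix.mul_smul]
  ext i j
  fin_cases i <;> fin_cases j <;>
    simp [gstar, NN, Matrix.mul_apply, Fin.sum_univ_four, Matrix.one_apply] <;>
    field_simp <;> (try rw [hρ']) <;> first | ring1 | (right; ring1)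

variable {ra : ℝ} {G : ℕ → ℕ → ℝ → ℝ → ℂ}

def EE (σ : ℂ) (κ : ℤ) (t φ : ℝ) : ℂ := Complex.exp (-Complex.I * σ * t + Complex.I * κ * φ)

lemma EE_t (σ : ℂ) (κ : ℤ) (t φ : ℝ) : HasDerivAt (fun t => EE σ κ t φ) (-Complex.I * σ * EE σ κ t φ) t := by
  have h : HasDerivAt (fun t : ℝ => -Complex.I * σ * (t:ℂ) + Complex.I * κ * φ) (-Complex.I * σ) t := by
    simpa using ((hasDerivAt_id t).ofReal_comp.const_mul (-Complex.I * σ)).add_const (Complex.I * κ * φ)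
  refine h.cexp.congr_deriv ?_
  unfold EE; ring

lemma EE_φ (σ : ℂ) (κ : ℤ) (t φ : ℝ) : HasDerivAt (fun φ => EE σ κ t φ) (Complex.I * κ * EE σ κ t φ) φ := by
  have h : HasDerivAt (fun φ : ℝ => -Complex.I * σ * (t:ℂ) + Complex.I * κ * φ) (Complex.I * κ) φ := by
    simpa using ((hasDerivAt_id φ).ofReal_comp.const_mul (Complex.I * κ)).const_add (-Complex.I * σ * t)
  refine h.cexp.congr_deriv ?_
  unfold EE; ring

def ss (θ : ℝ) : ℂ := (Real.sin θ : ℂ)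
def cc (θ : ℝ) : ℂ := (Real.cos θ : ℂ)

lemma ss_d (θ : ℝ) : HasDerivAt ss (cc θ) θ := (Real.hasDerivAt_sin θ).ofReal_comp
lemma cc_d (θ : ℝ) : HasDerivAt cc (-ss θ) θ := by
  have := (Real.hasDerivAt_cos θ).ofReal_comp
  rw [Complex.ofReal_neg] at this; exact this
lemma ss_ne {θ : ℝ} (hθ : θ ∈ Ioo 0 π) : ss θ ≠ 0 := by
  unfold ss; exact_mod_cast (Real.sin_pos_of_mem_Ioo hθ).ne'
lemma ss_pow {θ : ℝ} (hθ : θ ∈ Ioo 0 π) (κ : ℤ) : HasDerivAt (fun θ => ss θ ^ κ) (κ * ss θ ^ (κ-1) * cc θ) θ :=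
  (hasDerivAt_zpow κ (ss θ) (Or.inl (ss_ne hθ))).comp θ (ss_d θ)
lemma cos_mem {θ : ℝ} (hθ : θ ∈ Ioo 0 π) : Real.cos θ ∈ Ioo (-1:ℝ) 1 := by
  have := Real.sin_pos_of_mem_Ioo hθ
  have h2 := Real.sin_sq_add_cos_sq θ
  constructor <;> nlinarith

lemma G_θ (jG : Jet ra G) (i n : ℕ) {r θ : ℝ} (hr : ra < r) (hθ : θ ∈ Ioo 0 π) :
    HasDerivAt (fun θ => G i n r (Real.cos θ)) (- ss θ * G i (n+1) r (Real.cos θ)) θ := by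
  have h := (jG.dy i n r _ hr (cos_mem hθ)).scomp θ (Real.hasDerivAt_cos θ)
  refine h.congr_deriv ?_
  simp [ss]

/-- reduced functions -/
def ww (κ : ℤ) (G : ℕ → ℕ → ℝ → ℝ → ℂ) (i : ℕ) (r θ : ℝ) : ℂ := ss θ ^ κ * G i 0 r (Real.cos θ)
def wθ (κ : ℤ) (G : ℕ → ℕ → ℝ → ℝ → ℂ) (r θ : ℝ) : ℂ :=
  κ * ss θ ^ (κ-1) * cc θ * G 0 0 r (Real.cos θ) - ss θ ^ (κ+1) * G 0 1 r (Real.cos θ)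

lemma ww_r (jG : Jet ra G) (κ : ℤ) (i : ℕ) {r θ : ℝ} (hr : ra < r) (hθ : θ ∈ Ioo 0 π) :
    HasDerivAt (fun r => ww κ G i r θ) (ww κ G (i+1) r θ) r := (jG.dr i 0 r _ hr (cos_mem hθ)).const_mul _

lemma ww_θ (jG : Jet ra G) (κ : ℤ) {r θ : ℝ} (hr : ra < r) (hθ : θ ∈ Ioo 0 π) :
    HasDerivAt (fun θ => ww κ G 0 r θ) (wθ κ G r θ) θ := by
  refine ((ss_pow hθ κ).mul (G_θ jG 0 0 hr hθ)).congr_deriv ?_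
  unfold wθ
  rw [zpow_add_one₀ (ss_ne hθ)]; ring

lemma wθ_θ (jG : Jet ra G) (κ : ℤ) {r θ : ℝ} (hr : ra < r) (hθ : θ ∈ Ioo 0 π) :
    HasDerivAt (fun θ => ss θ * wθ κ G r θ)
     (ss θ ^ (κ+1) * (κ^2 * cc θ ^ 2 / ss θ ^ 2 * G 0 0 r (Real.cos θ) - κ * G 0 0 r (Real.cos θ)
      - 2 * (κ+1) * cc θ * G 0 1 r (Real.cos θ) + ss θ ^ 2 * G 0 2 r (Real.cos θ))) θ := by
  have h1 := (((((ss_pow hθ (κ-1)).const_mul (κ:ℂ)).mul (cc_d θ)).mul (G_θ jG 0 0 hr hθ)).sub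
    ((ss_pow hθ (κ+1)).mul (G_θ jG 0 1 hr hθ)))
  refine ((ss_d θ).mul h1).congr_deriv ?_
  have hs := ss_ne hθ
  have e1 : ss θ ^ (κ - 1 - 1) = ss θ ^ κ / ss θ ^ 2 := by rw [zpow_sub_one₀ hs, zpow_sub_one₀ hs]; field_simp
  have e2 : ss θ ^ (κ - 1) = ss θ ^ κ / ss θ := by rw [zpow_sub_one₀ hs]; field_simp
  have e3 : ss θ ^ (κ + 1) = ss θ ^ κ * ss θ := by rw [zpow_add_one₀ hs]
  simp only [Pi.sub_apply, Pi.mul_apply, add_sub_cancel_right, e1, e2, e3]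
  push_cast
  field_simp
  ring

/-- components of the gradient -/
def dd (σ : ℂ) (κ : ℤ) (G : ℕ → ℕ → ℝ → ℝ → ℂ) (β : Fin 4) (r θ : ℝ) : ℂ :=
  ![-Complex.I * σ * ww κ G 0 r θ, ww κ G 1 r θ, Complex.I * κ * ww κ G 0 r θ, wθ κ G r θ] β

lemma pd0_form (σ : ℂ) (κ : ℤ) (H : ℝ → ℝ → ℂ) (x : Fin 4 → ℝ) :
    pd 0 (fun y => EE σ κ (y 0) (y 2) * H (y 1) (y 3)) x = EE σ κ (x 0) (x 2) * (-Complex.I * σ * H (x 1) (x 3)) := by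
  unfold pd
  simp only [Function.update_apply]
  simp
  rw [(EE_t σ κ (x 0) (x 2)).deriv]; ring

lemma pd2_form (σ : ℂ) (κ : ℤ) (H : ℝ → ℝ → ℂ) (x : Fin 4 → ℝ) :
    pd 2 (fun y => EE σ κ (y 0) (y 2) * H (y 1) (y 3)) x = EE σ κ (x 0) (x 2) * (Complex.I * κ * H (x 1) (x 3)) := by
  unfold pd
  simp only [Function.update_apply]
  simp
  rw [show EE σ κ (x 0) = fun φ => EE σ κ (x 0) φ from rfl, (EE_φ σ κ (x 0) (x 2)).deriv]; ring

lemma pd1_form (σ : ℂ) (κ : ℤ) (H : ℝ → ℝ → ℂ) (x : Fin 4 → ℝ) {d : ℂ} (h : HasDerivAt (fun r => H r (x 3)) d (x 1)) :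
    pd 1 (fun y => EE σ κ (y 0) (y 2) * H (y 1) (y 3)) x = EE σ κ (x 0) (x 2) * d := by
  unfold pd
  simp only [Function.update_apply]
  simp
  rw [h.deriv]; simp

lemma pd3_form (σ : ℂ) (κ : ℤ) (H : ℝ → ℝ → ℂ) (x : Fin 4 → ℝ) {d : ℂ} (h : HasDerivAt (fun θ => H (x 1) θ) d (x 3)) :
    pd 3 (fun y => EE σ κ (y 0) (y 2) * H (y 1) (y 3)) x = EE σ κ (x 0) (x 2) * d := by
  unfold pd
  simp only [Function.update_apply]
  simp
  rw [h.deriv]; simp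

lemma pd_ut (jG : Jet ra G) (σ : ℂ) (κ : ℤ) {ut : (Fin 4 → ℝ) → ℂ}
    (hut : EqOn ut (fun x => EE σ κ (x 0) (x 2) * ww κ G 0 (x 1) (x 3)) (OM ra)) (β : Fin 4) :
    EqOn (pd β ut) (fun x => EE σ κ (x 0) (x 2) * dd σ κ G β (x 1) (x 3)) (OM ra) := by
  intro x hx
  rw [pd_congr (OM_open ra) hut hx]
  fin_cases β
  · exact pd0_form σ κ _ x
  · exact pd1_form σ κ _ x (ww_r jG κ 0 hx.1 hx.2)
  · exact pd2_form σ κ _ x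
  · exact pd3_form σ κ _ x (ww_θ jG κ hx.1 hx.2)

/-- the reduced operator -/
def QQ (a m : ℝ) (σ : ℂ) (κ : ℤ) (G : ℕ → ℕ → ℝ → ℝ → ℂ) (r θ : ℝ) : ℂ :=
  (mu a m r : ℂ) * G 2 0 r (Real.cos θ)
  + ((2 * r - 2 * m : ℝ) + (2 * Complex.I * σ * (r^2 + a^2) - 2 * a * Complex.I * κ)) * G 1 0 r (Real.cos θ)
  + ss θ ^ 2 * G 0 2 r (Real.cos θ) - 2 * (κ + 1) * cc θ * G 0 1 r (Real.cos θ)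
  - κ * (κ + 1) * G 0 0 r (Real.cos θ)
  + (2 * Complex.I * σ * r - a^2 * σ^2 * ss θ ^ 2 + 2 * a * σ * κ) * G 0 0 r (Real.cos θ)

def CF (a m : ℝ) (σ : ℂ) (κ : ℤ) (G : ℕ → ℕ → ℝ → ℝ → ℂ) (α β : Fin 4) (r θ : ℝ) : ℂ :=
  ss θ * (NN a m r θ α β : ℂ) * dd σ κ G β r θ

lemma box_form (a m : ℝ) (hra : 0 ≤ ra) (jG : Jet ra G) (σ : ℂ) (κ : ℤ) {ut : (Fin 4 → ℝ) → ℂ}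
    (hut : EqOn ut (fun x => EE σ κ (x 0) (x 2) * ww κ G 0 (x 1) (x 3)) (OM ra)) {x : Fin 4 → ℝ} (hx : x ∈ OM ra) :
    box a m ut x = - EE σ κ (x 0) (x 2) * ss (x 3) ^ κ * QQ a m σ κ G (x 1) (x 3) / (rhosq a (x 1) (x 3) : ℂ) := by
  have hr : 0 < x 1 := hra.trans_lt hx.1
  have hρ : rhosq a (x 1) (x 3) ≠ 0 := by unfold rhosq; positivity
  have hρc : (rhosq a (x 1) (x 3) : ℂ) ≠ 0 := by exact_mod_cast hρ
  have hs := ss_ne hx.2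
  have key : ∀ α β : Fin 4, pd α (fun y =>
        (((rhosq a (y 1) (y 3) * Real.sin (y 3) *
            (gstar a m (y 1) (y 3))⁻¹ α β : ℝ)) : ℂ) * pd β ut y) x
      = pd α (fun y => EE σ κ (y 0) (y 2) * (CF a m σ κ G α β) (y 1) (y 3)) x := by
    intro α β
    refine pd_congr (OM_open ra) (fun y hy => ?_) hx α
    have hr : 0 < y 1 := hra.trans_lt hy.1
    have hρ : rhosq a (y 1) (y 3) ≠ 0 := by unfold rhosq; positivity
    have hρc : (rhosq a (y 1) (y 3) : ℂ) ≠ 0 := by exact_mod_cast hρ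
    rw [pd_ut jG σ κ hut β hy, ginv hr hy.2]
    simp only [Matrix.smul_apply, smul_eq_mul, ss, CF]
    push_cast
    field_simp
  have z1 : ∀ α, pd α (fun y => EE σ κ (y 0) (y 2) * (fun _ _ => (0:ℂ)) (y 1) (y 3)) x = 0 := by
    intro α; unfold pd; simp
  unfold box
  simp only [key]
  have k1 : ∀ β (d : ℂ), HasDerivAt (fun r => (CF a m σ κ G 1 β) r (x 3)) d (x 1) →
    pd 1 (fun y => EE σ κ (y 0) (y 2) * (CF a m σ κ G 1 β) (y 1) (y 3)) x
     = EE σ κ (x 0) (x 2) * d := fun β d h => pd1_form σ κ _ x h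
  have w0 := ww_r jG κ 0 hx.1 hx.2
  have w1 := ww_r jG κ 1 hx.1 hx.2
  have hq : HasDerivAt (fun r : ℝ => ((-(r^2+a^2) : ℝ) : ℂ)) ((-(2 * x 1) : ℝ) : ℂ) (x 1) := by
    refine HasDerivAt.ofReal_comp ?_
    refine (((hasDerivAt_id (x 1)).pow 2).add_const (a^2)).neg.congr_deriv ?_
    simp
  have hμ : HasDerivAt (fun r : ℝ => ((mu a m r : ℝ) : ℂ)) ((2 * x 1 - 2 * m : ℝ) : ℂ) (x 1) := by
    refine HasDerivAt.ofReal_comp ?_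
    unfold mu
    simpa using (((hasDerivAt_id (x 1)).pow 2).sub ((hasDerivAt_id (x 1)).const_mul (2*m))).add_const (a^2)
  have r0 := k1 0 _ ((hq.const_mul (ss (x 3))).mul (w0.const_mul (-Complex.I * σ)))
  have r1 := k1 1 _ ((hμ.const_mul (ss (x 3))).mul w1)
  have r2 := k1 2 _ ((w0.const_mul (Complex.I * κ)).const_mul (ss (x 3) * ((-a : ℝ) : ℂ)))
  have r3 : pd 1 (fun y => EE σ κ (y 0) (y 2) * (CF a m σ κ G 1 3) (y 1) (y 3)) x = 0 := by
    rw [← z1 1]; congr 1; ext y; simp [NN, CF]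
  have q0 : pd 3 (fun y => EE σ κ (y 0) (y 2) * (CF a m σ κ G 3 0) (y 1) (y 3)) x = 0 := by
    rw [← z1 3]; congr 1; ext y; simp [NN, CF]
  have q1 : pd 3 (fun y => EE σ κ (y 0) (y 2) * (CF a m σ κ G 3 1) (y 1) (y 3)) x = 0 := by
    rw [← z1 3]; congr 1; ext y; simp [NN, CF]
  have q2 : pd 3 (fun y => EE σ κ (y 0) (y 2) * (CF a m σ κ G 3 2) (y 1) (y 3)) x = 0 := by
    rw [← z1 3]; congr 1; ext y; simp [NN, CF]
  have q3 := pd3_form σ κ (CF a m σ κ G 3 3) x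
    ((wθ_θ jG κ hx.1 hx.2).congr_of_eventuallyEq (Filter.Eventually.of_forall (fun θ => by simp [NN, CF, dd])))
  simp only [Fin.sum_univ_four]
  rw [r0, r1, r2, r3, q0, q1, q2, q3]
  simp only [pd0_form, pd2_form]
  have hcs : cc (x 3) ^ 2 = 1 - ss (x 3) ^ 2 := by
    unfold cc ss; exact_mod_cast (Real.cos_sq' (x 3))
  have e3 : ss (x 3) ^ (κ + 1) = ss (x 3) ^ κ * ss (x 3) := by rw [zpow_add_one₀ hs]
  have hsin : (Real.sin (x 3) : ℂ) = ss (x 3) := rfl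
  rw [hcs, e3]
  simp [CF, NN, dd, ww, QQ, hsin, -Complex.ofReal_sin]
  field_simp
  linear_combination (EE σ κ (x 0) (x 2) * G 0 0 (x 1) (cos (x 3)) *
    (ss (x 3) ^ 2 * σ * a * κ * 2 - ss (x 3) ^ 4 * σ ^ 2 * a ^ 2 - κ ^ 2)) * Complex.I_sq

end KerrAux
end

section
namespace KerrAux
open MeasureTheory KerrModes
open scoped ContDiff Topology

def nrm (x : Fin 3 → ℝ) : ℝ := √(x 0 ^ 2 + x 1 ^ 2 + x 2 ^ 2)
def pr (p : P3) : P3 := (p.1, (nrm p.2)⁻¹ • p.2)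

lemma nrm_pos' {x : Fin 3 → ℝ} (hx : x ≠ 0) : 0 < x 0 ^ 2 + x 1 ^ 2 + x 2 ^ 2 := by
  by_contra h
  apply hx
  have h0 := sq_nonneg (x 0)
  have h1 := sq_nonneg (x 1)
  have h2 := sq_nonneg (x 2)
  ext i
  fin_cases i
  · exact pow_eq_zero_iff (two_ne_zero) |>.1 (show x 0 ^ 2 = 0 by linarith)
  · exact pow_eq_zero_iff (two_ne_zero) |>.1 (show x 1 ^ 2 = 0 by linarith)
  · exact pow_eq_zero_iff (two_ne_zero) |>.1 (show x 2 ^ 2 = 0 by linarith)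

lemma nrm_pos {x : Fin 3 → ℝ} (hx : x ≠ 0) : 0 < nrm x := Real.sqrt_pos.2 (nrm_pos' hx)

lemma coord_an (i : Fin 3) (p : P3) : AnalyticAt ℝ (fun p : P3 => p.2 i) p :=
  ((ContinuousLinearMap.proj (R := ℝ) (φ := fun _ : Fin 3 => ℝ) i).comp (ContinuousLinearMap.snd ℝ ℝ (Fin 3 → ℝ))).analyticAt p

lemma sqrt_an {x : ℝ} (hx : 0 < x) : AnalyticAt ℝ Real.sqrt x := by
  have h := (Real.contDiffAt_sqrt (n := ω) hx.ne')
  exact h.analyticAt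

lemma pr_an (ra : ℝ) : AnalyticOnNhd ℝ pr (UO ra) := by
  intro p hp
  have h1 : AnalyticAt ℝ (fun p : P3 => p.2 0 ^ 2 + p.2 1 ^ 2 + p.2 2 ^ 2) p :=
    (((coord_an 0 p).pow 2).add ((coord_an 1 p).pow 2)).add ((coord_an 2 p).pow 2)
  have h2 : AnalyticAt ℝ (fun p : P3 => nrm p.2) p := AnalyticAt.comp_of_eq (sqrt_an (nrm_pos' hp.2)) h1 rfl
  exact analyticAt_fst.prod ((h2.inv (nrm_pos hp.2).ne').smul analyticAt_snd)

lemma pr_maps (ra : ℝ) : MapsTo pr (UO ra) (UO ra) := fun p hp =>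
  ⟨hp.1, smul_ne_zero (inv_ne_zero (nrm_pos hp.2).ne') hp.2⟩

lemma nrm_Phi (φ θ : ℝ) {n : ℝ} (hn : 0 < n) : nrm (n • Phi φ θ) = n := by
  unfold nrm Phi
  simp
  rw [show (n * (sin θ * cos φ)) ^ 2 + (n * (sin θ * sin φ)) ^ 2 + (n * cos θ) ^ 2 = n ^ 2 by
    linear_combination n ^ 2 * sin θ ^ 2 * Real.sin_sq_add_cos_sq φ + n ^ 2 * Real.sin_sq_add_cos_sq θ]
  exact Real.sqrt_sq hn.le

lemma pr_Phi (r φ θ : ℝ) {n : ℝ} (hn : 0 < n) : pr (r, n • Phi φ θ) = (r, Phi φ θ) := by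
  unfold pr
  simp only [nrm_Phi φ θ hn, smul_smul, inv_mul_cancel₀ hn.ne', one_smul]

lemma pr_Phi1 (r φ θ : ℝ) : pr (r, Phi φ θ) = (r, Phi φ θ) := by
  have := pr_Phi r φ θ one_pos
  rwa [one_smul] at this

lemma polar {x : Fin 3 → ℝ} (hx : x 0 ≠ 0 ∨ x 1 ≠ 0) : ∃ n φ θ : ℝ, 0 < n ∧ θ ∈ Ioo 0 π ∧ x = n • Phi φ θ := by
  have hx0 : x ≠ 0 := fun h => by rcases hx with h' | h' <;> simp [h] at h'
  have hn := nrm_pos hx0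
  have hnn : nrm x ^ 2 = x 0 ^ 2 + x 1 ^ 2 + x 2 ^ 2 := Real.sq_sqrt (nrm_pos' hx0).le
  have hp : 0 < x 0 ^ 2 + x 1 ^ 2 := by rcases hx with h | h <;> positivity
  have hlt : |x 2| < nrm x := abs_lt_of_sq_lt_sq (by linarith) hn.le
  obtain ⟨hl, hu⟩ := abs_lt.1 hlt
  set q := x 2 / nrm x with hq
  have hq1 : -1 < q := by rw [hq, lt_div_iff₀ hn]; linarith
  have hq2 : q < 1 := by rw [hq, div_lt_iff₀ hn]; linarith
  set z : ℂ := ⟨x 0, x 1⟩ with hz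
  have hzn : ‖z‖ = √(x 0 ^ 2 + x 1 ^ 2) := by rw [Complex.norm_def, Complex.normSq_apply]; simp [hz, sq]
  have hsin : nrm x * sin (arccos q) = ‖z‖ := by
    rw [Real.sin_arccos, hzn]
    have : 0 ≤ nrm x * √(1 - q ^ 2) := by positivity
    rw [← Real.sqrt_sq this, mul_pow, Real.sq_sqrt (by nlinarith), hq]
    congr 1
    field_simp
    linarith
  refine ⟨nrm x, Complex.arg z, arccos q, hn, ⟨?_, ?_⟩, ?_⟩
  · exact Real.arccos_pos.2 hq2
  · refine lt_of_le_of_ne (Real.arccos_le_pi q) (fun h => ?_)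
    have := Real.cos_arccos hq1.le hq2.le
    rw [h, Real.cos_pi] at this
    linarith
  · ext i
    fin_cases i
    · simp only [Phi, Pi.smul_apply, smul_eq_mul]
      simp
      rw [← mul_assoc, hsin, Complex.norm_mul_cos_arg]
    · simp only [Phi, Pi.smul_apply, smul_eq_mul]
      simp
      rw [← mul_assoc, hsin, Complex.norm_mul_sin_arg]
    · simp only [Phi, Pi.smul_apply, smul_eq_mul]
      simp
      rw [Real.cos_arccos hq1.le hq2.le, hq]; field_simp

lemma Phi_deriv (φ θ : ℝ) : HasDerivAt (fun φ => Phi φ θ) ![-(sin θ * sin φ), sin θ * cos φ, 0] φ := by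
  rw [hasDerivAt_pi]
  intro i
  fin_cases i
  · simpa [Phi] using (Real.hasDerivAt_cos φ).const_mul (sin θ)
  · simpa [Phi] using (Real.hasDerivAt_sin φ).const_mul (sin θ)
  · simpa [Phi] using hasDerivAt_const φ (cos θ)

lemma md_of {ra : ℝ} {κ : ℤ} {g : P3 → ℂ} (hf : ContDiffOn ℝ ∞ (fun p => g (pr p)) (UA ra))
    (h : ∀ r φ θ, ra < r → θ ∈ Ioo 0 π → g (r, Phi φ θ) = Complex.exp (Complex.I * κ * φ) * g (r, Phi 0 θ)) :
    Md (UA ra) κ (fun p => g (pr p)) := by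
  rintro ⟨r, x⟩ hp
  obtain ⟨n, φ, θ, hn, hθ, rfl⟩ := polar hp.2
  have hd := (diff_of (UA_open ra) hf hp).hasFDerivAt
  have hc : HasDerivAt (fun φ => ((r, n • Phi φ θ) : P3)) (RL (r, n • Phi φ θ)) φ := by
    refine ((hasDerivAt_const φ r).prodMk ((Phi_deriv φ θ).const_smul n)).congr_deriv ?_
    ext i <;> [simp [RL_apply]; (fin_cases i <;> simp [RL_apply, Phi])]
  have h1 := hd.comp_hasDerivAt φ hc
  have e : ((fun p => g (pr p)) ∘ fun φ => ((r, n • Phi φ θ) : P3)) = fun φ : ℝ => Complex.exp (Complex.I * κ * φ) * g (r, Phi 0 θ) := by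
    ext s
    simp only [Function.comp, pr_Phi r s θ hn]
    exact h r s θ hp.1 hθ
  rw [e] at h1
  have h2 : HasDerivAt (fun φ : ℝ => Complex.exp (Complex.I * κ * φ) * g (r, Phi 0 θ)) 
      (Complex.exp (Complex.I * κ * φ) * (Complex.I * κ) * g (r, Phi 0 θ)) φ := by
    have h : HasDerivAt (fun φ : ℝ => Complex.I * κ * (φ:ℂ)) (Complex.I * κ) φ := by
      simpa using ((hasDerivAt_id φ).ofReal_comp.const_mul (Complex.I * κ))
    exact h.cexp.mul_const _
  have h3 := h1.unique h2
  show fderiv ℝ (fun p => g (pr p)) (r, n • Phi φ θ) (RL (r, n • Phi φ θ)) = _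
  rw [h3]
  simp only [pr_Phi r φ θ hn]
  rw [h r φ θ hp.1 hθ]; ring

lemma gam_cos {θ : ℝ} (hθ : θ ∈ Ioo 0 π) : gam (cos θ) = Phi 0 θ := by
  have h : √(1 - cos θ ^ 2) = sin θ := by
    rw [← Real.sin_sq, Real.sqrt_sq (Real.sin_pos_of_mem_Ioo hθ).le]
  unfold gam Phi
  rw [h]; simp

lemma sy_cos {θ : ℝ} (hθ : θ ∈ Ioo 0 π) : ((sy (cos θ) : ℝ) : ℂ) = ss θ := by
  have h : sy (cos θ) = sin θ := by
    unfold sy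
    rw [← Real.sin_sq, Real.sqrt_sq (Real.sin_pos_of_mem_Ioo hθ).le]
  rw [h]; rfl

lemma GG00 (κ : ℤ) (g : P3 → ℂ) (r : ℝ) {θ : ℝ} (hθ : θ ∈ Ioo 0 π) :
    GG κ (fun p => g (pr p)) 0 0 r (cos θ) = ss θ ^ (-κ) * g (r, Phi 0 θ) := by
  unfold GG
  simp [JJ, gam_cos hθ, pr_Phi1, sy_cos hθ]

lemma Phi_an (φ θ : ℝ) : AnalyticAt ℝ (fun p : ℝ × ℝ => Phi p.1 p.2) (φ, θ) := by
  have hs : AnalyticAt ℝ (fun p : ℝ × ℝ => sin p.2) (φ, θ) := (Real.analyticAt_sin).comp analyticAt_snd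
  have hc : AnalyticAt ℝ (fun p : ℝ × ℝ => cos p.2) (φ, θ) := (Real.analyticAt_cos).comp analyticAt_snd
  have hs1 : AnalyticAt ℝ (fun p : ℝ × ℝ => sin p.1) (φ, θ) := (Real.analyticAt_sin).comp analyticAt_fst
  have hc1 : AnalyticAt ℝ (fun p : ℝ × ℝ => cos p.1) (φ, θ) := (Real.analyticAt_cos).comp analyticAt_fst
  rw [analyticAt_pi_iff]
  intro i
  fin_cases i
  · exact hs.mul hc1
  · exact hs.mul hs1
  · exact hc

lemma Phi_ne {φ θ : ℝ} : Phi φ θ ≠ 0 := by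
  intro h
  have := nrm_Phi φ θ one_pos
  rw [h] at this
  simp [nrm] at this

lemma rot_Phi (φ θ : ℝ) : rotZ φ (Phi 0 θ) = Phi φ θ := by
  unfold rotZ Phi
  ext i
  fin_cases i <;> simp <;> ring

/-- one dimensional modes -/
lemma ode_mode {w : ℝ → ℂ} {c : ℂ} (hd : ∀ s, HasDerivAt w (c * w s) s) (s : ℝ) : w s = Complex.exp (c * s) * w 0 := by
  have h : ∀ s, HasDerivAt (fun s : ℝ => Complex.exp (-(c * s)) * w s) 0 s := by
    intro s
    have h : HasDerivAt (fun s : ℝ => -(c * (s:ℂ))) (-c) s := by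
      refine ((hasDerivAt_id s).ofReal_comp.const_mul c).neg.congr_deriv ?_
      simp
    refine (h.cexp.mul (hd s)).congr_deriv ?_
    ring
  have := is_const_of_deriv_eq_zero (fun s => (h s).differentiableAt) (fun s => (h s).deriv) s 0
  simp at this
  rw [← this, ← mul_assoc, ← Complex.exp_add]; simp

end KerrAux
end

/-- **Real analyticity of joint quasinormal modes on subextremal Kerr** (Theorem 1 of the
paper, `Λ = 0`, scalar case, in the spherical chart).  A smooth function `u` on
`ℝ × I × S²`, `I = (r_e − c₁, ∞)` (encoded by a function smooth on `ℝ × I × (ℝ³ ∖ {0})`,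
composed with the chart `Φ` of the unit sphere) which is a joint mode (`∂_{t*}ũ = −iσũ`,
`∂_{φ*}ũ = −ikũ`) of a wave equation `□_{g*}ũ + Vũ = F` with real analytic axisymmetric
potential `V` and real analytic right-hand side `F` is real analytic on
`Ω = ℝ × I × ℝ × (0,π)`. -/
theorem joint_quasinormal_modes_analytic_Kerr
    (a m : ℝ) (ha : |a| < m)
    (rC re : ℝ) (hrC : rC = m - Real.sqrt (m ^ 2 - a ^ 2))
    (hre : re = m + Real.sqrt (m ^ 2 - a ^ 2))
    (c1 : ℝ) (hc1 : 0 < c1) (hc : rC < re - c1)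
    (I : Set ℝ) (hI : I = Ioi (re - c1))
    (V : ℝ × (Fin 3 → ℝ) → ℂ)
    (hVan : AnalyticOnNhd ℝ V {p : ℝ × (Fin 3 → ℝ) | p.1 ∈ I})
    (hVax : ∀ (r α : ℝ) (ω : Fin 3 → ℝ), V (r, rotZ α ω) = V (r, ω))
    (u : ℝ × ℝ × (Fin 3 → ℝ) → ℂ)
    (hu : ContDiffOn ℝ (⊤ : ℕ∞) u {p : ℝ × ℝ × (Fin 3 → ℝ) | p.2.1 ∈ I ∧ p.2.2 ≠ 0})
    (ut : (Fin 4 → ℝ) → ℂ) (hut : ut = fun x => u (x 0, x 1, Phi (x 2) (x 3)))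
    (Ω : Set (Fin 4 → ℝ)) (hΩ : Ω = {x | x 1 ∈ I ∧ x 3 ∈ Ioo 0 π})
    (F : ℝ × ℝ × (Fin 3 → ℝ) → ℂ)
    (hFan : AnalyticOnNhd ℝ F {p : ℝ × ℝ × (Fin 3 → ℝ) | p.2.1 ∈ I})
    (heq : ∀ x ∈ Ω,
      box a m ut x + V (x 1, Phi (x 2) (x 3)) * ut x = F (x 0, x 1, Phi (x 2) (x 3)))
    (σ : ℂ) (hmodeT : ∀ x ∈ Ω, pd 0 ut x = -Complex.I * σ * ut x)
    (k : ℤ) (hmodeΦ : ∀ x ∈ Ω, pd 2 ut x = -Complex.I * (k : ℂ) * ut x) :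
    AnalyticOnNhd ℝ ut Ω := by
  subst hI
  set ra := re - c1 with hradef
  set κ : ℤ := -k with hκ
  have hΩ' : Ω = KerrAux.OM ra := hΩ
  clear hΩ
  subst hΩ'
  have hm : 0 < m := (abs_nonneg a).trans_lt ha
  have ham : a ^ 2 < m ^ 2 := by
    rw [← sq_abs a]; exact pow_lt_pow_left₀ ha (abs_nonneg a) two_ne_zero
  have hsq : √(m ^ 2 - a ^ 2) ^ 2 = m ^ 2 - a ^ 2 := Real.sq_sqrt (by linarith)
  have hrC0 : 0 ≤ rC := by
    rw [hrC, sub_nonneg, Real.sqrt_le_left hm.le]; nlinarith [sq_nonneg a]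
  have hra0 : 0 ≤ ra := hrC0.trans hc.le
  have hmu : ∀ r, mu a m r = (r - rC) * (r - re) := by
    intro r; unfold mu; rw [hrC, hre]; linear_combination hsq
  have hsum : rC + re = 2 * m := by rw [hrC, hre]; ring
  -- modal decomposition
  have hUopen : IsOpen {p : ℝ × ℝ × (Fin 3 → ℝ) | p.2.1 ∈ Ioi ra ∧ p.2.2 ≠ 0} :=
    (isOpen_Ioi.preimage (continuous_fst.comp continuous_snd)).inter
      (isOpen_ne_fun (continuous_snd.comp continuous_snd) continuous_const)
  have hud : ∀ x ∈ KerrAux.OM ra, DifferentiableAt ℝ ut x := by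
    intro x hx
    rw [hut]
    have h1 : DifferentiableAt ℝ u (x 0, x 1, Phi (x 2) (x 3)) :=
      (hu.contDiffAt (hUopen.mem_nhds (show (x 0, x 1, Phi (x 2) (x 3)) ∈ {p : ℝ × ℝ × (Fin 3 → ℝ) | p.2.1 ∈ Ioi ra ∧ p.2.2 ≠ 0} from
        ⟨hx.1, KerrAux.Phi_ne⟩))).differentiableAt (by simp)
    have h2 : DifferentiableAt ℝ (fun x : Fin 4 → ℝ => Phi (x 2) (x 3)) x := by
      have hh := (KerrAux.Phi_an (x 2) (x 3)).differentiableAt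
      exact DifferentiableAt.comp (f := fun x : Fin 4 → ℝ => (x 2, x 3)) x hh (by fun_prop)
    have h3 : DifferentiableAt ℝ (fun x : Fin 4 → ℝ => (x 0, x 1, Phi (x 2) (x 3))) x :=
      DifferentiableAt.prodMk (by fun_prop) (DifferentiableAt.prodMk (by fun_prop) h2)
    exact DifferentiableAt.comp x h1 h3
  have hline : ∀ (i : Fin 4) (c : ℂ), i ≠ 1 → i ≠ 3 → (∀ x ∈ KerrAux.OM ra, pd i ut x = c * ut x) → 
      ∀ x ∈ KerrAux.OM ra, ut x = Complex.exp (c * x i) * ut (Function.update x i 0) := by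
    intro i c h1 h3 hmode x hx
    have hmem : ∀ s, Function.update x i s ∈ KerrAux.OM ra := by
      intro s
      refine ⟨?_, ?_⟩
      · rw [Function.update_of_ne h1.symm]; exact hx.1
      · rw [Function.update_of_ne h3.symm]; exact hx.2
    have := KerrAux.ode_mode (w := fun s => ut (Function.update x i s)) (c := c) (fun s => ?_) (x i)
    · simpa using this
    · have hd : DifferentiableAt ℝ (fun s => ut (Function.update x i s)) s :=
        DifferentiableAt.comp s (hud _ (hmem s)) (hasDerivAt_update x i s).differentiableAt
      have h := hmode _ (hmem s)
      unfold pd at h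
      simp only [Function.update_idem, Function.update_self] at h
      rw [← h]
      exact hd.hasDerivAt
  have hl0 := hline 0 _ (by decide) (by decide) hmodeT
  have hl2 := hline 2 _ (by decide) (by decide) hmodeΦ
  have hmod : ∀ x ∈ KerrAux.OM ra, ut x = KerrAux.EE σ κ (x 0) (x 2) * u (0, x 1, Phi 0 (x 3)) := by
    intro x hx
    rw [hl0 x hx, hl2 (Function.update x 0 0) ⟨by simpa using hx.1, by simpa using hx.2⟩, ← mul_assoc, ← Complex.exp_add]
    unfold KerrAux.EE
    congr 1
    · congr 1
      simp [hκ]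
    · rw [hut]; simp
  have hF0 : ∀ t r φ θ, ra < r → θ ∈ Ioo 0 π → u (t, r, Phi φ θ) = KerrAux.EE σ κ t φ * u (0, r, Phi 0 θ) := by
    intro t r φ θ hr hθ
    have := hmod ![t, r, φ, θ] ⟨by simpa using hr, by simpa using hθ⟩
    rw [hut] at this
    simpa using this
  -- the three functions
  let gh : KerrAux.P3 → ℂ := fun p => u (0, p.1, p.2)
  let gf : KerrAux.P3 → ℂ := fun p => -((p.1 ^ 2 + a ^ 2 * p.2 2 ^ 2 : ℝ) : ℂ) * F (0, p.1, p.2)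
  let gc : KerrAux.P3 → ℂ := fun p => 2 * Complex.I * σ * (p.1 : ℂ) - a ^ 2 * σ ^ 2 * ((1 - p.2 2 ^ 2 : ℝ) : ℂ) + 2 * a * σ * κ 
     - ((p.1 ^ 2 + a ^ 2 * p.2 2 ^ 2 : ℝ) : ℂ) * V p
  have hhcd : ContDiffOn ℝ (⊤ : ℕ∞) (fun p => gh (KerrAux.pr p)) (KerrAux.UO ra) := by
    have h1 : ContDiffOn ℝ (⊤ : ℕ∞) gh (KerrAux.UO ra) := by
      refine hu.comp (t := {p : ℝ × ℝ × (Fin 3 → ℝ) | p.2.1 ∈ Ioi ra ∧ p.2.2 ≠ 0}) (f := fun p : KerrAux.P3 => (0, p.1, p.2)) ?_ ?_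
      · exact contDiffOn_const.prodMk contDiffOn_id
      · intro p hp; exact hp
    exact h1.comp ((KerrAux.pr_an ra).contDiffOn (KerrAux.UO_open ra).uniqueDiffOn) (KerrAux.pr_maps ra)
  have hre : ∀ p, AnalyticAt ℝ (fun x : ℝ => (x : ℂ)) p := fun p => Complex.ofRealCLM.analyticAt p
  have hz2 : ∀ p, AnalyticAt ℝ (fun p : KerrAux.P3 => ((p.1 ^ 2 + a ^ 2 * p.2 2 ^ 2 : ℝ) : ℂ)) p := fun p =>
    AnalyticAt.comp (hre _) ((analyticAt_fst.pow 2).add (analyticAt_const.mul ((KerrAux.coord_an 2 p).pow 2)))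
  have hgf : AnalyticOnNhd ℝ gf (KerrAux.UO ra) := by
    intro p hp
    refine (hz2 p).neg.mul ?_
    have h1 : AnalyticAt ℝ F (0, p.1, p.2) := hFan _ hp.1
    exact AnalyticAt.comp_of_eq h1 (f := fun p : KerrAux.P3 => ((0:ℝ), p.1, p.2)) (analyticAt_const.prod (analyticAt_fst.prod analyticAt_snd)) rfl
  have hgc : AnalyticOnNhd ℝ gc (KerrAux.UO ra) := by
    intro p hp
    have h1 : AnalyticAt ℝ V p := hVan _ hp.1
    have h2 : AnalyticAt ℝ (fun p : KerrAux.P3 => ((p.1 : ℝ) : ℂ)) p := AnalyticAt.comp (hre _) analyticAt_fst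
    have h3 : AnalyticAt ℝ (fun p : KerrAux.P3 => ((1 - p.2 2 ^ 2 : ℝ) : ℂ)) p :=
      AnalyticAt.comp (hre _) (analyticAt_const.sub ((KerrAux.coord_an 2 p).pow 2))
    exact (((analyticAt_const.mul h2).sub (analyticAt_const.mul h3)).add analyticAt_const).sub ((hz2 p).mul h1)
  have hgf' : AnalyticOnNhd ℝ (fun p => gf (KerrAux.pr p)) (KerrAux.UO ra) := hgf.comp (KerrAux.pr_an ra) (KerrAux.pr_maps ra)
  have hgc' : AnalyticOnNhd ℝ (fun p => gc (KerrAux.pr p)) (KerrAux.UO ra) := hgc.comp (KerrAux.pr_an ra) (KerrAux.pr_maps ra)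
  have hVP : ∀ r φ θ, V (r, Phi φ θ) = V (r, Phi 0 θ) := fun r φ θ => by
    rw [← KerrAux.rot_Phi φ θ, hVax]
  have cdA : ∀ {g : KerrAux.P3 → ℂ}, AnalyticOnNhd ℝ g (KerrAux.UO ra) → ContDiffOn ℝ (⊤ : ℕ∞) g (KerrAux.UA ra) := fun h =>
    (h.mono (KerrAux.UA_sub ra)).contDiffOn (KerrAux.UA_open ra).uniqueDiffOn
  have hE0 : ∀ φ : ℝ, KerrAux.EE σ κ 0 φ = Complex.exp (Complex.I * κ * φ) := fun φ => by simp [KerrAux.EE]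
  have mdh : KerrAux.Md (KerrAux.UA ra) κ (fun p => gh (KerrAux.pr p)) :=
    KerrAux.md_of (hhcd.mono (KerrAux.UA_sub ra)) (fun r φ θ hr hθ => by
      show u (0, r, Phi φ θ) = _ * u (0, r, Phi 0 θ)
      rw [hF0 0 r φ θ hr hθ, hE0])
  have jG := KerrAux.GG_jet (hhcd.mono (KerrAux.UA_sub ra)) mdh
  have hutG : EqOn ut (fun x => KerrAux.EE σ κ (x 0) (x 2) * KerrAux.ww κ (KerrAux.GG κ (fun p => gh (KerrAux.pr p))) 0 (x 1) (x 3)) (KerrAux.OM ra) := by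
    intro x hx
    simp only [KerrAux.ww]
    rw [hmod x hx, KerrAux.GG00 κ gh (x 1) hx.2, ← mul_assoc (KerrAux.ss _ ^ κ), ← zpow_add₀ (KerrAux.ss_ne hx.2)]
    simp [gh]
  have hbox : ∀ x ∈ KerrAux.OM ra, _ := fun x hx => KerrAux.box_form a m hra0 jG σ κ hutG hx
  set G := KerrAux.GG κ (fun p => gh (KerrAux.pr p)) with hG
  have hFm : ∀ r φ θ, ra < r → θ ∈ Ioo 0 π → F (0, r, Phi φ θ) = KerrAux.EE σ κ 0 φ *
      (KerrAux.ss θ ^ κ * (- KerrAux.QQ a m σ κ G r θ / (rhosq a r θ : ℂ) + V (r, Phi 0 θ) * G 0 0 r (cos θ))) := by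
    intro r φ θ hr hθ
    have hx : ![0, r, φ, θ] ∈ KerrAux.OM ra := ⟨by simpa using hr, by simpa using hθ⟩
    have h := heq _ hx
    rw [hbox _ hx, hutG hx] at h
    simp [hVP r φ θ, KerrAux.ww] at h
    rw [← h]; ring
  have mdf : KerrAux.Md (KerrAux.UA ra) κ (fun p => gf (KerrAux.pr p)) :=
    KerrAux.md_of (cdA hgf') (fun r φ θ hr hθ => by
      have e1 := hFm r φ θ hr hθ
      have e2 := hFm r 0 θ hr hθ
      have e3 : KerrAux.EE σ κ 0 0 = 1 := by simp [KerrAux.EE]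
      rw [e3, one_mul] at e2
      rw [← e2, hE0] at e1
      simp only [gf, e1]
      have : Phi φ θ 2 = Phi 0 θ 2 := by simp [Phi]
      rw [this]; ring)
  have mdc : KerrAux.Md (KerrAux.UA ra) 0 (fun p => gc (KerrAux.pr p)) :=
    KerrAux.md_of (cdA hgc') (fun r φ θ hr hθ => by
      simp only [gc, hVP r φ θ]
      have : Phi φ θ 2 = Phi 0 θ 2 := by simp [Phi]
      rw [this]; simp)
  let S : KerrAux.Sys :=
    { rC := rC, re := re, ra := ra, hC := hc, he := by rw [hradef]; linarith
      κ := κ, b0 := 2 * Complex.I * σ * a ^ 2 - 2 * a * Complex.I * κ, b1 := 0, b2 := 2 * Complex.I * σ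
      G := G
      c := KerrAux.GG 0 (fun p => gc (KerrAux.pr p))
      f := KerrAux.GG κ (fun p => gf (KerrAux.pr p))
      jG := jG
      jc := KerrAux.GG_jet (cdA hgc') mdc
      jf := KerrAux.GG_jet (cdA hgf') mdf
      wG := KerrAux.GG_w κ hhcd
      ac := KerrAux.GG_abdd 0 hgc'
      af := KerrAux.GG_abdd κ hgf'
      pde := by
        intro r y hr hy
        have hθ : arccos y ∈ Ioo 0 π := by
          refine ⟨Real.arccos_pos.2 hy.2, lt_of_le_of_ne (Real.arccos_le_pi y) (fun h => ?_)⟩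
          have := Real.cos_arccos hy.1.le hy.2.le
          rw [h, Real.cos_pi] at this
          linarith [hy.1]
        have hcos := Real.cos_arccos hy.1.le hy.2.le
        have hs := KerrAux.ss_ne hθ
        have e2 := hFm r 0 (arccos y) hr hθ
        have e3 : KerrAux.EE σ κ 0 0 = 1 := by simp [KerrAux.EE]
        rw [e3, one_mul] at e2
        have f1 := KerrAux.GG00 κ gf r hθ
        have f2 := KerrAux.GG00 0 gc r hθ
        have hss : KerrAux.ss (arccos y) ^ 2 = ((1 - y ^ 2 : ℝ) : ℂ) := by
          unfold KerrAux.ss; rw [← Complex.ofReal_pow, Real.sin_sq, hcos]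
        have hcc : KerrAux.cc (arccos y) = (y : ℂ) := by unfold KerrAux.cc; rw [hcos]
        have hP : Phi 0 (arccos y) 2 = y := by simp [Phi, hcos]
        have hρ : rhosq a r (arccos y) = r ^ 2 + a ^ 2 * y ^ 2 := by unfold rhosq; rw [hcos]
        have hr0 : 0 < r := hra0.trans_lt hr
        have hρne : ((r ^ 2 + a ^ 2 * y ^ 2 : ℝ) : ℂ) ≠ 0 := by
          have : 0 < r ^ 2 + a ^ 2 * y ^ 2 := by positivity
          exact_mod_cast this.ne'
        simp only [gf, hP] at f1
        simp only [gc, hP] at f2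
        rw [hcos] at f1 f2
        rw [f1, f2, e2]
        have hz : KerrAux.ss (arccos y) ^ (-κ) * KerrAux.ss (arccos y) ^ κ = 1 := by
          rw [← zpow_add₀ hs]; simp
        have gen : ∀ p q D Q W : ℂ, D ≠ 0 → p * q = 1 → p * (-D * (q * (-Q / D + W))) = Q - D * W := by
          intro p q D Q W hD hpq
          have : -D * (-Q / D + W) = Q - D * W := by field_simp; ring
          linear_combination p * q * this + (Q - D * W) * hpq
        rw [hρ, hcos, gen _ _ _ _ _ hρne hz]
        unfold KerrAux.QQ
        rw [hss, hcc, hcos, hmu r, ← hsum]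
        generalize ((r ^ 2 + a ^ 2 * y ^ 2 : ℝ) : ℂ) = D
        simp only [neg_zero, zpow_zero, one_mul]
        push_cast
        ring }
  intro x hx
  have hS := S.analytic (r := x 1) (y := cos (x 3)) hx.1 (KerrAux.cos_mem hx.2)
  have hpr : ∀ i : Fin 4, AnalyticAt ℝ (fun x : Fin 4 → ℝ => x i) x := fun i =>
    (ContinuousLinearMap.proj (R := ℝ) (φ := fun _ : Fin 4 => ℝ) i).analyticAt x
  have hprc : ∀ i : Fin 4, AnalyticAt ℝ (fun x : Fin 4 → ℝ => ((x i : ℝ) : ℂ)) x := fun i => AnalyticAt.comp (hre _) (hpr i)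
  have hsn : AnalyticAt ℝ (fun x : Fin 4 → ℝ => sin (x 3)) x := AnalyticAt.comp_of_eq (g := Real.sin) Real.analyticAt_sin (hpr 3) rfl
  have hcn : AnalyticAt ℝ (fun x : Fin 4 → ℝ => cos (x 3)) x := AnalyticAt.comp_of_eq (g := Real.cos) Real.analyticAt_cos (hpr 3) rfl
  have a1 : AnalyticAt ℝ (fun x : Fin 4 → ℝ => KerrAux.EE σ κ (x 0) (x 2)) x :=
    AnalyticAt.comp_of_eq (g := Complex.exp) (AnalyticAt.restrictScalars (𝕜 := ℝ) (analyticAt_cexp)) ((analyticAt_const.mul (hprc 0)).add (analyticAt_const.mul (hprc 2))) rfl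
  have a2 : AnalyticAt ℝ (fun x : Fin 4 → ℝ => KerrAux.ss (x 3) ^ κ) x :=
    AnalyticAt.zpow (AnalyticAt.comp_of_eq (hre _) hsn rfl) (KerrAux.ss_ne hx.2)
  have a3 : AnalyticAt ℝ (fun x : Fin 4 → ℝ => G 0 0 (x 1) (cos (x 3))) x :=
    AnalyticAt.comp_of_eq hS (f := fun x : Fin 4 → ℝ => (x 1, cos (x 3))) ((hpr 1).prod hcn) rfl
  refine (a1.mul (a2.mul a3)).congr ?_
  filter_upwards [(KerrAux.OM_open ra).mem_nhds hx] with y hy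
  exact (hutG hy).symm
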